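/- Boundary Harnack (Carleson-type) inequality: Let Ω ⊂ ℝⁿ be a bounded Lipschitz domain with Lipschitz character (r_Ω, m_Ω), let T > 0 and Q_Ω := Ω × (0,T). Fix Y = (y,s) with y ∈ ∂Ω and 0 < s < T, and fix r with 0 < r < (1/2)·min(r_Ω, √(T−s), √s). Let u be a nonnegative solution of −u_t + Lu = 0 in Q_Ω (u ∈ C^{2,1}(Q_Ω)) which extends continuously to Γ := (∂Ω × (0,T)) ∩ Q_{2r}(Y) and vanishes on Γ. Then sup over Q_Ω ∩ Q_r(Y) of u is at most N · u(Ȳ_r), where Ȳ_r := (y + r·e_y, s + r²), e_y being the unit vector of the x_n-axis of the Lipschitz coordinate frame at y (so that y + ρ·e_y ∈ Ω for 0 < ρ ≤ r_Ω), and N is a positive constant depending only on n, ν, S and m_Ω. -/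

import Mathlib

open MeasureTheory ENNReal Metric Set RealInnerProductSpace

noncomputable section

/-- `n`-dimensional Euclidean space. -/
abbrev En (n : ℕ) : Type := EuclideanSpace ℝ (Fin n)

variable {n : ℕ}

/-- Time derivative `u_t`. -/
def Dt (u : En n × ℝ → ℝ) (X : En n × ℝ) : ℝ :=
  deriv (fun t => u (X.1, t)) X.2

/-- First spatial derivative `D_i u`. -/
def Dx (u : En n × ℝ → ℝ) (i : Fin n) (X : En n × ℝ) : ℝ :=
  fderiv ℝ (fun x => u (x, X.2)) X.1 (EuclideanSpace.single i 1)

/-- Second spatial derivative `D_{ij} u`. -/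
def Dxx (u : En n × ℝ → ℝ) (i j : Fin n) (X : En n × ℝ) : ℝ :=
  Dx (Dx u j) i X

/-- `u` is of class `C^{2,1}` on `Q`: `u`, `D_i u`, `D_{ij} u`, `u_t` exist and are
continuous on `Q`. -/
structure IsC21 (u : En n × ℝ → ℝ) (Q : Set (En n × ℝ)) : Prop where
  cont : ContinuousOn u Q
  diff_t : ∀ X ∈ Q, DifferentiableAt ℝ (fun t => u (X.1, t)) X.2
  diff_x : ∀ X ∈ Q, DifferentiableAt ℝ (fun x => u (x, X.2)) X.1
  diff_xx : ∀ j : Fin n, ∀ X ∈ Q, DifferentiableAt ℝ (fun x => Dx u j (x, X.2)) X.1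
  cont_t : ContinuousOn (Dt u) Q
  cont_x : ∀ i, ContinuousOn (Dx u i) Q
  cont_xx : ∀ i j, ContinuousOn (Dxx u i j) Q

/-- Uniform parabolicity with constant `ν` on `Q`:
`ν⁻¹|ξ|² ≤ Σ a_ij ξ_i ξ_j` and `Σ a_ij² ≤ ν²`. -/
def UnifParabolic (ν : ℝ) (a : En n × ℝ → Matrix (Fin n) (Fin n) ℝ)
    (Q : Set (En n × ℝ)) : Prop :=
  ∀ X ∈ Q, (∀ ξ : Fin n → ℝ, ν⁻¹ * (∑ i, ξ i ^ 2) ≤ ∑ i, ∑ j, a X i j * ξ i * ξ j) ∧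
    (∑ i, ∑ j, (a X i j) ^ 2) ≤ ν ^ 2

/-- `Lu = Σ_{ij} a_ij D_ij u + Σ_i b_i D_i u`. -/
def Lop (a : En n × ℝ → Matrix (Fin n) (Fin n) ℝ) (b : En n × ℝ → En n)
    (u : En n × ℝ → ℝ) (X : En n × ℝ) : ℝ :=
  (∑ i, ∑ j, a X i j * Dxx u i j X) + ∑ i, b X i * Dx u i X

/-- `∫ (ess sup_t |f(x,t)|)ⁿ dx`, the `n`-th power of the `L^n_x L^∞_t` norm of `f`
over the set `Q ⊆ ℝⁿ × ℝ`. -/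
def LxnLtinfPow {E : Type*} [NNNorm E] (f : En n × ℝ → E) (Q : Set (En n × ℝ)) : ℝ≥0∞ :=
  ∫⁻ x, (essSup (fun t => (‖f (x, t)‖₊ : ℝ≥0∞)) (volume.restrict {t | (x, t) ∈ Q})) ^ n

/-- The `L^n_x L^∞_t` norm of `f` over `Q`. -/
def LxnLtinf {E : Type*} [NNNorm E] (f : En n × ℝ → E) (Q : Set (En n × ℝ)) : ℝ≥0∞ :=
  (LxnLtinfPow f Q) ^ (1 / (n : ℝ))

/-- The box `B_ρ(y) × (t₁, t₂)`. -/
def box (y : En n) (ρ t₁ t₂ : ℝ) : Set (En n × ℝ) := ball y ρ ×ˢ Ioo t₁ t₂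

/-- The standard parabolic cylinder `Q_r(Y) = B_r(y) × (s - r², s)`. -/
def pcyl (Y : En n × ℝ) (r : ℝ) : Set (En n × ℝ) := box Y.1 r (Y.2 - r ^ 2) Y.2

/-- The slanted cylinder `V_r(Y) = {(x,t) : |x - (t/s)y| < r, 0 < t < s}`. -/
def slantCyl (Y : En n × ℝ) (r : ℝ) : Set (En n × ℝ) :=
  {X | ‖X.1 - (X.2 / Y.2) • Y.1‖ < r ∧ 0 < X.2 ∧ X.2 < Y.2}

/-- Supremum of the positive part `u₊` over a set `A`. -/
def supPos (u : En n × ℝ → ℝ) (A : Set (En n × ℝ)) : ℝ :=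
  sSup ((fun X => max (u X) 0) '' A)

/-- `Ω` is a Lipschitz domain with character `(rΩ, mΩ)`: at every boundary point `y`
there is a coordinate frame, encoded by the unit "vertical" direction `e`, in which
`Ω ∩ B_{rΩ}(y)` is the region above the graph of an `mΩ`-Lipschitz function `φ`
of the tangential variables. -/
def IsLipschitzDomain (Ω : Set (En n)) (rΩ mΩ : ℝ) : Prop :=
  0 < rΩ ∧ 0 ≤ mΩ ∧
  ∀ y ∈ frontier Ω, ∃ (e : En n) (φ : En n → ℝ),
    ‖e‖ = 1 ∧ LipschitzWith (Real.toNNReal mΩ) φ ∧ φ 0 = 0 ∧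
    (∀ x, x ∈ Ω ∩ ball y rΩ ↔
      dist x y < rΩ ∧ φ ((x - y) - ⟪x - y, e⟫ • e) < ⟪x - y, e⟫) ∧
    (∀ ρ : ℝ, 0 < ρ → ρ ≤ rΩ → y + ρ • e ∈ Ω)

structure C21 {n : ℕ} (w θ : En n × ℝ → ℝ) (p : En n × ℝ → En n)
    (H : En n × ℝ → (En n →L[ℝ] En n)) (G : Set (En n × ℝ)) : Prop where
  op : IsOpen G
  dt : ∀ X ∈ G, HasDerivAt (fun t => w (X.1, t)) (θ X) X.2
  dx : ∀ X ∈ G, HasFDerivAt (fun x => w (x, X.2)) (innerSL ℝ (p X)) X.1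
  dxx : ∀ X ∈ G, HasFDerivAt (fun x => p (x, X.2)) (H X) X.1
  cw : ContinuousOn w G
  ct : ContinuousOn θ G
  cp : ContinuousOn p G
  cH : ContinuousOn H G

def Adm {n : ℕ} (ν : ℝ) (A : En n →L[ℝ] En n) : Prop :=
  (∀ ξ, ν⁻¹ * ‖ξ‖ ^ 2 ≤ ⟪A ξ, ξ⟫) ∧ ‖A‖ ≤ ν

def trc {n : ℕ} (A H : En n →L[ℝ] En n) : ℝ :=
  LinearMap.trace ℝ (En n) ((A ∘L H : En n →L[ℝ] En n) : En n →ₗ[ℝ] En n)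

theorem trc_add {n : ℕ} (A H K : En n →L[ℝ] En n) : trc A (H + K) = trc A H + trc A K := by
  unfold trc; rw [ContinuousLinearMap.comp_add]; simp
theorem trc_smul {n : ℕ} (c : ℝ) (A H : En n →L[ℝ] En n) : trc A (c • H) = c * trc A H := by
  unfold trc; rw [ContinuousLinearMap.comp_smul]; simp
theorem trc_neg {n : ℕ} (A H : En n →L[ℝ] En n) : trc A (-H) = - trc A H := by
  unfold trc
  have : (A ∘L (-H)) = -(A ∘L H) := by ext; simp
  rw [this]; simp

theorem trc_eq_sum {n : ℕ} {ι : Type*} [Fintype ι] (b : OrthonormalBasis ι ℝ (En n))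
    (A H : En n →L[ℝ] En n) : trc A H = ∑ i, ⟪b i, A (H (b i))⟫ := by
  unfold trc
  rw [LinearMap.trace_eq_sum_inner _ b]; rfl

theorem trc_abs_le {n : ℕ} (A H : En n →L[ℝ] En n) : |trc A H| ≤ n * (‖A‖ * ‖H‖) := by
  rw [trc_eq_sum (EuclideanSpace.basisFun (Fin n) ℝ)]
  refine (Finset.abs_sum_le_sum_abs _ _).trans ?_
  have : ∀ i ∈ (Finset.univ : Finset (Fin n)),
      |⟪EuclideanSpace.basisFun (Fin n) ℝ i, A (H (EuclideanSpace.basisFun (Fin n) ℝ i))⟫| ≤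
        ‖A‖ * ‖H‖ := by
    intro i _
    refine (abs_real_inner_le_norm _ _).trans ?_
    have h1 : ‖EuclideanSpace.basisFun (Fin n) ℝ i‖ = 1 := by simp
    rw [h1, one_mul]
    refine (A.le_opNorm _).trans ?_
    refine mul_le_mul_of_nonneg_left ?_ (norm_nonneg _)
    refine (H.le_opNorm _).trans ?_
    rw [h1, mul_one]
  refine (Finset.sum_le_sum this).trans ?_
  simp

/-- determinant bound -/
theorem det_le_trc {n : ℕ} (hn : 0 < n) {ν : ℝ} (hν : 1 ≤ ν) {A H : En n →L[ℝ] En n} (hA : Adm ν A)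
    (hs : ∀ v w, ⟪H v, w⟫ = ⟪v, H w⟫) (hneg : ∀ v, ⟪H v, v⟫ ≤ 0) :
    0 ≤ -trc A H ∧ |H.det| ≤ (ν * (-trc A H)) ^ n := by
  have hsym : ((-H : En n →L[ℝ] En n) : En n →ₗ[ℝ] En n).IsSymmetric := by
    intro v w
    simp [inner_neg_left, inner_neg_right, hs]
  have hfr : Module.finrank ℝ (En n) = n := by simp
  set b := hsym.eigenvectorBasis hfr with hb
  set μ := hsym.eigenvalues hfr with hμ
  have hev : ∀ i, (-H) (b i) = μ i • b i := by
    intro i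
    have := hsym.apply_eigenvectorBasis hfr i
    simpa using this
  have hμ0 : ∀ i, 0 ≤ μ i := by
    intro i
    have h1 : ⟪(-H) (b i), b i⟫ = μ i := by
      rw [hev, inner_smul_left]
      have : ⟪b i, b i⟫ = (1:ℝ) := by
        rw [real_inner_self_eq_norm_sq, b.orthonormal.1]; norm_num
      simp [this]
    rw [← h1]
    have := hneg (b i)
    simp [inner_neg_left]; linarith
  have htr : -trc A H = ∑ i, μ i * ⟪A (b i), b i⟫ := by
    rw [← trc_neg, trc_eq_sum b]
    refine Finset.sum_congr rfl fun i _ => ?_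
    rw [hev, map_smul, inner_smul_right, real_inner_comm]
  have hlow : ∑ i, μ i * ν⁻¹ ≤ -trc A H := by
    rw [htr]
    refine Finset.sum_le_sum fun i _ => mul_le_mul_of_nonneg_left ?_ (hμ0 i)
    have := hA.1 (b i)
    rw [b.orthonormal.1] at this
    simpa using this
  have hsum : ∑ i, μ i ≤ ν * (-trc A H) := by
    rw [← Finset.sum_mul] at hlow
    have hν0 : 0 < ν := by linarith
    calc ∑ i, μ i = ν * ((∑ i, μ i) * ν⁻¹) := by field_simp
      _ ≤ _ := mul_le_mul_of_nonneg_left hlow hν0.le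
  have h0 : 0 ≤ ∑ i, μ i := Finset.sum_nonneg fun i _ => hμ0 i
  refine ⟨?_, ?_⟩
  · refine le_trans ?_ hlow
    exact Finset.sum_nonneg fun i _ => mul_nonneg (hμ0 i) (by positivity)
  · have hdet : |H.det| = ∏ i, μ i := by
      have h1 : LinearMap.det ((-H : En n →L[ℝ] En n) : En n →ₗ[ℝ] En n) = ∏ i, μ i := by
        have := hsym.det_eq_prod_eigenvalues hfr
        simpa using this
      have h2 : ((-H : En n →L[ℝ] En n) : En n →ₗ[ℝ] En n) = (-1:ℝ) • (H : En n →ₗ[ℝ] En n) := by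
        ext; simp
      rw [h2, LinearMap.det_smul] at h1
      have h3 : 0 ≤ ∏ i, μ i := Finset.prod_nonneg fun i _ => hμ0 i
      rw [← abs_of_nonneg h3, ← h1, abs_mul, abs_pow]
      simp [ContinuousLinearMap.det]
    rw [hdet]
    calc ∏ i, μ i ≤ ∏ _i : Fin n, (∑ i, μ i) := by
          refine Finset.prod_le_prod (fun i _ => hμ0 i) fun i _ => ?_
          exact Finset.single_le_sum (fun i _ => hμ0 i) (Finset.mem_univ i)
      _ = (∑ i, μ i) ^ n := by simp
      _ ≤ _ := by gcongr

theorem C21.symm {n : ℕ} {w θ : En n × ℝ → ℝ} {p : En n × ℝ → En n}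
    {H : En n × ℝ → (En n →L[ℝ] En n)} {G : Set (En n × ℝ)} (h : C21 w θ p H G)
    {X : En n × ℝ} (hX : X ∈ G) (v v' : En n) : ⟪H X v, v'⟫ = ⟪v, H X v'⟫ := by
  have hG : ∀ᶠ y in nhds X.1, (y, X.2) ∈ G := by
    have : ContinuousAt (fun y : En n => (y, X.2)) X.1 := by fun_prop
    exact this.eventually_mem (h.op.mem_nhds (by simpa using hX))
  have h1 : ∀ᶠ y in nhds X.1, HasFDerivAt (fun x => w (x, X.2)) (innerSL ℝ (p (y, X.2))) y := by
    filter_upwards [hG] with y hy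
    exact h.dx (y, X.2) hy
  have h2 : HasFDerivAt (fun y => innerSL ℝ (p (y, X.2))) ((innerSL ℝ (E := En n)) ∘L (H X)) X.1 :=
    ((innerSL ℝ (E := En n)).hasFDerivAt).comp X.1 (h.dxx X hX)
  have := second_derivative_symmetric_of_eventually h1 h2 v v'
  have h3 : ⟪H X v, v'⟫ = ⟪H X v', v⟫ := this
  rw [h3, real_inner_comm]

theorem C21.contact {n : ℕ} {w θ : En n × ℝ → ℝ} {p : En n × ℝ → En n}
    {H : En n × ℝ → (En n →L[ℝ] En n)} {G : Set (En n × ℝ)} (h : C21 w θ p H G)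
    {X : En n × ℝ} (hX : X ∈ G) (q : En n)
    (hmax : ∀ᶠ y in nhds X.1, w (y, X.2) - ⟪q, y⟫ ≤ w X - ⟪q, X.1⟫) :
    p X = q ∧ ∀ v, ⟪H X v, v⟫ ≤ 0 := by
  have hG : ∀ᶠ y in nhds X.1, (y, X.2) ∈ G := by
    have : ContinuousAt (fun y : En n => (y, X.2)) X.1 := by fun_prop
    exact this.eventually_mem (h.op.mem_nhds (by simpa using hX))
  have hd : ∀ y, (y, X.2) ∈ G → HasFDerivAt (fun y => w (y, X.2) - ⟪q, y⟫)
      (innerSL ℝ (p (y, X.2)) - innerSL ℝ q) y := by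
    intro y hy
    exact (h.dx (y, X.2) hy).sub ((innerSL ℝ q).hasFDerivAt)
  have hloc : IsLocalMax (fun y => w (y, X.2) - ⟪q, y⟫) X.1 := hmax
  have hp : p X = q := by
    have := hloc.hasFDerivAt_eq_zero (hd X.1 hX)
    rw [sub_eq_zero] at this
    have h3 : ∀ v, ⟪p X, v⟫ = ⟪q, v⟫ := fun v => by
      have := congrArg (fun f => f v) this
      simpa using this
    exact ext_inner_right ℝ h3
  refine ⟨hp, fun v => ?_⟩
  by_contra hcon
  push Not at hcon
  set g : ℝ → ℝ := fun s => w (X.1 + s • v, X.2) - ⟪q, X.1 + s • v⟫ with hg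
  have hline : ContinuousAt (fun s : ℝ => X.1 + s • v) 0 := by fun_prop
  have hl0 : X.1 + (0:ℝ) • v = X.1 := by simp
  have hGs : ∀ᶠ s in nhds (0:ℝ), (X.1 + s • v, X.2) ∈ G := by
    have := hline.tendsto
    rw [hl0] at this
    exact this.eventually hG
  have hline' : ∀ s : ℝ, HasDerivAt (fun s : ℝ => X.1 + s • v) v s := by
    intro s
    have := ((hasDerivAt_id s).smul_const v).const_add X.1
    simpa using this
  have hgd : ∀ s, (X.1 + s • v, X.2) ∈ G → HasDerivAt g (⟪p (X.1 + s • v, X.2), v⟫ - ⟪q, v⟫) s := by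
    intro s hs
    have := (hd _ hs).comp_hasDerivAt s (hline' s)
    simp only [ContinuousLinearMap.sub_apply, innerSL_apply_apply] at this
    exact this
  have hderiv : deriv g =ᶠ[nhds 0] fun s => ⟪p (X.1 + s • v, X.2), v⟫ - ⟪q, v⟫ := by
    filter_upwards [hGs] with s hs
    exact (hgd s hs).deriv
  have hdd : HasDerivAt (fun s : ℝ => ⟪p (X.1 + s • v, X.2), v⟫ - ⟪q, v⟫) (⟪H X v, v⟫) 0 := by
    have h5 : HasFDerivAt (fun x => p (x, X.2)) (H X) (X.1 + (0:ℝ) • v) := by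
      rw [hl0]; exact h.dxx X hX
    have h4 := h5.comp_hasDerivAt (0:ℝ) (hline' 0)
    have := (h4.inner ℝ (hasDerivAt_const (0:ℝ) v)).sub_const ⟪q, v⟫
    simpa using this
  have hdd0 : deriv (deriv g) 0 = ⟪H X v, v⟫ := by
    rw [hderiv.deriv_eq, hdd.deriv]
  have hg0 : deriv g 0 = 0 := by
    rw [(hgd 0 (by rw [hl0]; exact hX)).deriv, hl0, hp, sub_self]
  have hmin : IsLocalMin g 0 := isLocalMin_of_deriv_deriv_pos (by rw [hdd0]; exact hcon) hg0
    (hgd 0 (by rw [hl0]; exact hX)).continuousAt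
  have hmaxg : ∀ᶠ s in nhds (0:ℝ), g s ≤ g 0 := by
    have := hline.tendsto
    rw [hl0] at this
    have := this.eventually hmax
    filter_upwards [this] with s hs
    simpa [hg] using hs
  have hconst : g =ᶠ[nhds 0] fun _ => g 0 := by
    filter_upwards [hmin, hmaxg] with s h1 h2
    exact le_antisymm h2 h1
  have : deriv (deriv g) 0 = 0 := by
    have h1 : deriv g =ᶠ[nhds 0] fun _ => 0 := by
      have := hconst.deriv
      simpa using this
    rw [h1.deriv_eq]; simp
  rw [hdd0] at this
  linarith

theorem weighted_area {n : ℕ} {f : En n → En n} {f' : En n → (En n →L[ℝ] En n)} {C : Set (En n)}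
    (hC : MeasurableSet C) (hf : ∀ x ∈ C, HasFDerivAt f (f' x) x)
    (hf' : ContinuousOn f' C)
    {ρ φ : En n → ℝ} (hρ : ContinuousOn ρ C) (hρ0 : ∀ x ∈ C, 0 ≤ ρ x)
    (hφm : Measurable φ) (hφ0 : ∀ q, 0 ≤ φ q)
    (hφ : ∀ q, 0 < φ q → ∃ x ∈ C, f x = q ∧ φ q ≤ ρ x) :
    ∫⁻ q, ENNReal.ofReal (φ q) ≤ ∫⁻ x in C, ENNReal.ofReal (ρ x * |(f' x).det|) := by
  have hdet : ContinuousOn (fun x => |(f' x).det|) C :=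
    (ContinuousLinearMap.continuous_det.comp_continuousOn hf').abs
  set μ : Measure (En n) := (volume.restrict C).withDensity (fun x => ENNReal.ofReal |(f' x).det|) with hμ
  have haed : AEMeasurable (fun x => ENNReal.ofReal |(f' x).det|) (volume.restrict C) :=
    (hdet.aemeasurable hC).ennreal_ofReal
  have hρm : AEMeasurable ρ (volume.restrict C) := hρ.aemeasurable hC
  have hac : μ ≪ volume.restrict C := withDensity_absolutelyContinuous _ _
  have hCae : ∀ᵐ x ∂(volume.restrict C), x ∈ C := ae_restrict_mem hC
  have hmeas : ∀ t : ℝ, MeasurableSet (C ∩ {x | t < ρ x}) := by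
    intro t
    obtain ⟨u, hu, hu2⟩ := continuousOn_iff'.1 hρ (Ioi t) isOpen_Ioi
    have : C ∩ {x | t < ρ x} = u ∩ C := by
      rw [← hu2, inter_comm]; rfl
    rw [this]
    exact hu.measurableSet.inter hC
  calc ∫⁻ q, ENNReal.ofReal (φ q) = ∫⁻ t in Ioi 0, volume {q | t < φ q} :=
        lintegral_eq_lintegral_meas_lt _ (Filter.Eventually.of_forall hφ0) hφm.aemeasurable
    _ ≤ ∫⁻ t in Ioi 0, μ {x | t < ρ x} := by
        refine setLIntegral_mono' measurableSet_Ioi fun t ht => ?_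
        have hsub : {q | t < φ q} ⊆ f '' (C ∩ {x | t < ρ x}) := by
          intro q hq
          obtain ⟨x, hx, hx1, hx2⟩ := hφ q (lt_trans ht hq)
          exact ⟨x, ⟨hx, lt_of_lt_of_le hq hx2⟩, hx1⟩
        calc volume {q | t < φ q} ≤ volume (f '' (C ∩ {x | t < ρ x})) := measure_mono hsub
          _ ≤ ∫⁻ x in C ∩ {x | t < ρ x}, ENNReal.ofReal |(f' x).det| :=
              addHaar_image_le_lintegral_abs_det_fderiv volume (hmeas t)
                (fun x hx => (hf x hx.1).hasFDerivWithinAt)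
          _ = μ (C ∩ {x | t < ρ x}) := by
              rw [hμ, withDensity_apply _ (hmeas t), Measure.restrict_restrict (hmeas t)]
              congr 2
              ext x; simp; tauto
          _ ≤ μ {x | t < ρ x} := measure_mono inter_subset_right
    _ = ∫⁻ x, ENNReal.ofReal (ρ x) ∂μ := by
        refine (lintegral_eq_lintegral_meas_lt _ ?_ (hρm.mono_ac hac)).symm
        refine hac.ae_le ?_
        filter_upwards [hCae] with x hx
        exact hρ0 x hx
    _ = ∫⁻ x in C, ENNReal.ofReal (ρ x * |(f' x).det|) := by
        rw [hμ, lintegral_withDensity_eq_lintegral_mul₀ haed hρm.ennreal_ofReal]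
        refine lintegral_congr_ae ?_
        filter_upwards [hCae] with x hx
        simp only [Pi.mul_apply]
        rw [mul_comm, ← ENNReal.ofReal_mul (hρ0 x hx)]

/-- lower bound for the weight -/
theorem weight_lower (n : ℕ) (hn : 0 < n) : ∃ c : ℝ, 0 < c ∧ ∀ (K : ℕ) (P : ℝ), 0 < P →
    ENNReal.ofReal (c * K) ≤
      ∫⁻ q in ball (0 : En n) P, ENNReal.ofReal (((‖q‖ + P / 2 ^ K) ^ n)⁻¹) := by
  haveI : Nontrivial (En n) := by
    haveI : Nonempty (Fin n) := ⟨⟨0, hn⟩⟩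
    infer_instance
  have hfr : Module.finrank ℝ (En n) = n := by simp
  set ω : ℝ := (volume (ball (0 : En n) 1)).toReal with hω
  have hωpos : 0 < ω := ENNReal.toReal_pos (measure_ball_pos _ _ one_pos).ne' measure_ball_lt_top.ne
  have hωe : volume (ball (0 : En n) 1) = ENNReal.ofReal ω := (ENNReal.ofReal_toReal measure_ball_lt_top.ne).symm
  refine ⟨ω / 2 / 2 ^ n, by positivity, fun K P hP => ?_⟩
  have hvol : ∀ r : ℝ, 0 ≤ r → volume (ball (0 : En n) r) = ENNReal.ofReal (r ^ n * ω) := by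
    intro r hr
    rw [Measure.addHaar_ball _ _ hr, hfr, hωe, ← ENNReal.ofReal_mul (by positivity)]
  set A : ℕ → Set (En n) := fun i => ball 0 (P / 2 ^ i) \ ball 0 (P / 2 ^ (i + 1)) with hA
  have hAm : ∀ i, MeasurableSet (A i) := fun i => measurableSet_ball.diff measurableSet_ball
  have hmono : ∀ i j : ℕ, i ≤ j → P / 2 ^ j ≤ P / 2 ^ i := by
    intro i j hij
    have : (2:ℝ) ^ i ≤ 2 ^ j := pow_le_pow_right₀ (by norm_num) hij
    gcongr
  have hdisj : (Finset.range K : Set ℕ).PairwiseDisjoint A := by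
    intro i _ j _ hij
    rw [Function.onFun, Set.disjoint_left]
    rintro q ⟨h1, h2⟩ ⟨h3, h4⟩
    simp only [mem_ball, dist_zero_right, not_lt] at h1 h2 h3 h4
    rcases lt_or_gt_of_ne hij with h | h
    · have := hmono (i+1) j h; linarith
    · have := hmono (j+1) i h; linarith
  have hsub : (⋃ i ∈ Finset.range K, A i) ⊆ ball (0 : En n) P := by
    intro q hq
    simp only [mem_iUnion] at hq
    obtain ⟨i, _, h1, _⟩ := hq
    have := hmono 0 i (Nat.zero_le _)
    simp only [mem_ball, dist_zero_right] at h1 ⊢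
    simp at this
    linarith
  have hAvol : ∀ i, ENNReal.ofReal (ω / 2 * (P / 2 ^ i) ^ n) ≤ volume (A i) := by
    intro i
    have h1 : ball (0 : En n) (P / 2 ^ (i+1)) ⊆ ball 0 (P / 2 ^ i) := ball_subset_ball (hmono _ _ (Nat.le_succ _))
    rw [hA]
    simp only
    rw [measure_sdiff h1 measurableSet_ball.nullMeasurableSet measure_ball_lt_top.ne,
      hvol _ (by positivity), hvol _ (by positivity), ← ENNReal.ofReal_sub _ (by positivity)]
    refine ENNReal.ofReal_le_ofReal ?_
    have h2 : (P / 2 ^ (i+1)) ^ n ≤ (P / 2 ^ i) ^ n / 2 := by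
      have : P / 2 ^ (i+1) = (P / 2 ^ i) * (1/2) := by rw [pow_succ]; field_simp
      rw [this, mul_pow]
      have h3 : ((1:ℝ)/2) ^ n ≤ 1/2 := by
        calc ((1:ℝ)/2) ^ n ≤ (1/2) ^ 1 := pow_le_pow_of_le_one (by norm_num) (by norm_num) hn
          _ = 1/2 := by norm_num
      have h4 : 0 ≤ (P / 2 ^ i) ^ n := by positivity
      nlinarith
    nlinarith
  have hAint : ∀ i ∈ Finset.range K, ENNReal.ofReal (ω / 2 / 2 ^ n) ≤
      ∫⁻ q in A i, ENNReal.ofReal (((‖q‖ + P / 2 ^ K) ^ n)⁻¹) := by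
    intro i hi
    have hPi : 0 < P / 2 ^ i := by positivity
    have hle : ∀ q ∈ A i, ENNReal.ofReal (((2 * (P / 2 ^ i)) ^ n)⁻¹) ≤
        ENNReal.ofReal (((‖q‖ + P / 2 ^ K) ^ n)⁻¹) := by
      rintro q ⟨h1, _⟩
      simp only [mem_ball, dist_zero_right] at h1
      have h2 := hmono i K (Finset.mem_range.1 hi).le
      have h3 : 0 < P / 2 ^ K := by positivity
      refine ENNReal.ofReal_le_ofReal ?_
      have : 0 ≤ ‖q‖ := norm_nonneg q
      gcongr
      linarith
    calc ENNReal.ofReal (ω / 2 / 2 ^ n)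
        = ENNReal.ofReal (((2 * (P / 2 ^ i)) ^ n)⁻¹) * ENNReal.ofReal (ω / 2 * (P / 2 ^ i) ^ n) := by
          rw [← ENNReal.ofReal_mul (by positivity), mul_pow]
          congr 1
          field_simp
      _ ≤ ENNReal.ofReal (((2 * (P / 2 ^ i)) ^ n)⁻¹) * volume (A i) := by
          gcongr; exact hAvol i
      _ = ∫⁻ q in A i, ENNReal.ofReal (((2 * (P / 2 ^ i)) ^ n)⁻¹) := by simp
      _ ≤ _ := setLIntegral_mono' (hAm i) hle
  calc ENNReal.ofReal (ω / 2 / 2 ^ n * K) = ∑ i ∈ Finset.range K, ENNReal.ofReal (ω / 2 / 2 ^ n) := by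
        rw [Finset.sum_const, Finset.card_range, nsmul_eq_mul, mul_comm, ENNReal.ofReal_mul (by positivity)]
        simp
    _ ≤ ∑ i ∈ Finset.range K, ∫⁻ q in A i, ENNReal.ofReal (((‖q‖ + P / 2 ^ K) ^ n)⁻¹) :=
        Finset.sum_le_sum hAint
    _ = ∫⁻ q in ⋃ i ∈ Finset.range K, A i, ENNReal.ofReal (((‖q‖ + P / 2 ^ K) ^ n)⁻¹) :=
        (lintegral_biUnion_finset hdisj (fun i _ => hAm i) _).symm
    _ ≤ _ := lintegral_mono_set hsub

def legH {n : ℕ} (B : Set (En n)) (y1 : En n) (m : En n → ℝ) (q : En n) : ℝ :=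
  sSup ((fun x => m x - ⟪q, x - y1⟫) '' B)

theorem legH_bdd {n : ℕ} {B : Set (En n)} (hB : IsCompact B) (y1 : En n) {m : En n → ℝ}
    (hm : ContinuousOn m B) (q : En n) : IsCompact ((fun x => m x - ⟪q, x - y1⟫) '' B) := by
  refine hB.image_of_continuousOn (hm.sub ?_)
  exact Continuous.continuousOn (by fun_prop)

theorem legH_le {n : ℕ} {B : Set (En n)} (hB : IsCompact B) (y1 : En n) {m : En n → ℝ}
    (hm : ContinuousOn m B) (q : En n) {x : En n} (hx : x ∈ B) :
    m x - ⟪q, x - y1⟫ ≤ legH B y1 m q :=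
  le_csSup (legH_bdd hB y1 hm q).bddAbove ⟨x, hx, rfl⟩

theorem legH_attained {n : ℕ} {B : Set (En n)} (hB : IsCompact B) (hBn : B.Nonempty) (y1 : En n)
    {m : En n → ℝ} (hm : ContinuousOn m B) (q : En n) :
    ∃ x ∈ B, legH B y1 m q = m x - ⟪q, x - y1⟫ := by
  obtain ⟨x, hx, hx2⟩ := (legH_bdd hB y1 hm q).sSup_mem (hBn.image _)
  exact ⟨x, hx, hx2.symm⟩

theorem legH_cont {n : ℕ} {B : Set (En n)} (hB : IsCompact B) (hBn : B.Nonempty) (y1 : En n)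
    {m : En n → ℝ} (hm : ContinuousOn m B) : Continuous (legH B y1 m) := by
  obtain ⟨D, hD⟩ := hB.isBounded.subset_closedBall y1
  refine LipschitzWith.continuous (K := Real.toNNReal D) (LipschitzWith.of_le_add_mul _ ?_)
  intro q q'
  obtain ⟨x, hx, hxe⟩ := legH_attained hB hBn y1 hm q
  have h1 := legH_le hB y1 hm q' hx
  have hD2 : ‖x - y1‖ ≤ D := by have := hD hx; rwa [mem_closedBall, dist_eq_norm] at this
  have hD0 : 0 ≤ D := (norm_nonneg _).trans hD2
  rw [Real.coe_toNNReal D hD0]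
  have h2 : ⟪q', x - y1⟫ - ⟪q, x - y1⟫ ≤ D * dist q q' := by
    rw [← inner_sub_left]
    refine (real_inner_le_norm _ _).trans ?_
    rw [dist_eq_norm, norm_sub_rev q' q, mul_comm]
    exact mul_le_mul_of_nonneg_right hD2 (norm_nonneg _)
  rw [hxe]; linarith

/-- pointwise estimate at contact points -/
theorem contact_point_est {n : ℕ} (hn : 0 < n) {ν : ℝ} (hν : 1 ≤ ν) {A H : En n →L[ℝ] En n}
    (hA : Adm ν A) (hs : ∀ v w, ⟪H v, w⟫ = ⟪v, H w⟫) (hneg : ∀ v, ⟪H v, v⟫ ≤ 0)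
    {θ k ℓ F ρ τ δ P : ℝ} (hk : 0 ≤ k) (hℓ : 0 ≤ ℓ) (hF : 0 ≤ F) (hP : 0 ≤ P) (hδ : 0 < δ)
    (hτ : 0 < τ) (hρ : 0 ≤ ρ) (hρτ : ρ ≤ τ * θ) (hpde : θ ≤ trc A H + k * P + ℓ + F) :
    ((P + δ) ^ n)⁻¹ * ρ * |H.det| ≤ τ * ((2 * F) ^ (n + 1) * ν ^ n * (δ ^ n)⁻¹) +
      ρ * ((4 * ν) ^ n * (k ^ n + (δ ^ n)⁻¹ * ℓ ^ n)) := by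
  obtain ⟨hD, hdet⟩ := det_le_trc hn hν hA hs hneg
  set D := -trc A H with hDdef
  have hθ : 0 ≤ θ := by
    by_contra h
    push Not at h
    nlinarith
  have hpde' : θ + D ≤ k * P + ℓ + F := by rw [hDdef]; linarith
  have hν0 : 0 < ν := by linarith
  have hg1 : ((P + δ) ^ n)⁻¹ ≤ (δ ^ n)⁻¹ := by
    apply inv_anti₀ (by positivity)
    exact pow_le_pow_left₀ hδ.le (by linarith) n
  have hg0 : 0 ≤ ((P + δ) ^ n)⁻¹ := by positivity
  have hkP : 0 ≤ k * P := by positivity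
  rcases le_total (k * P + ℓ) F with hc | hc
  · have h1 : D ≤ 2 * F := by linarith
    have h2 : θ ≤ 2 * F := by linarith
    have h3 : |H.det| ≤ (ν * (2 * F)) ^ n := hdet.trans (by gcongr)
    have h4 : ρ ≤ τ * (2 * F) := hρτ.trans (by gcongr)
    have h5 : ((P + δ) ^ n)⁻¹ * ρ * |H.det| ≤ (δ ^ n)⁻¹ * (τ * (2 * F)) * (ν * (2 * F)) ^ n := by
      gcongr
    have h6 : (δ ^ n)⁻¹ * (τ * (2 * F)) * (ν * (2 * F)) ^ n =
        τ * ((2 * F) ^ (n + 1) * ν ^ n * (δ ^ n)⁻¹) := by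
      rw [mul_pow, pow_succ]; ring
    have h7 : 0 ≤ ρ * ((4 * ν) ^ n * (k ^ n + (δ ^ n)⁻¹ * ℓ ^ n)) := by positivity
    linarith
  · have h1 : D ≤ 2 * (k * P + ℓ) := by linarith
    have h3 : |H.det| ≤ (ν * (2 * (k * P + ℓ))) ^ n := hdet.trans (by gcongr)
    have h4 : (ν * (2 * (k * P + ℓ))) ^ n ≤ (4 * ν) ^ n * ((k * P) ^ n + ℓ ^ n) := by
      have h5 : k * P + ℓ ≤ 2 * max (k * P) ℓ := by
        have := le_max_left (k*P) ℓ
        have := le_max_right (k*P) ℓ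
        linarith
      have hmx : 0 ≤ max (k * P) ℓ := le_max_of_le_right hℓ
      calc (ν * (2 * (k * P + ℓ))) ^ n ≤ (ν * (2 * (2 * max (k * P) ℓ))) ^ n := by gcongr
        _ = (4 * ν) ^ n * (max (k * P) ℓ) ^ n := by rw [← mul_pow]; congr 1; ring
        _ ≤ _ := by
          gcongr
          rcases max_choice (k * P) ℓ with h | h <;> rw [h]
          · have : 0 ≤ ℓ ^ n := by positivity
            linarith
          · have : 0 ≤ (k * P) ^ n := by positivity
            linarith
    have h6 : ((P + δ) ^ n)⁻¹ * ((k * P) ^ n + ℓ ^ n) ≤ k ^ n + (δ ^ n)⁻¹ * ℓ ^ n := by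
      rw [mul_add]
      have h8 : ((P + δ) ^ n)⁻¹ * (k * P) ^ n ≤ k ^ n := by
        rw [mul_pow]
        have h9 : P ^ n ≤ (P + δ) ^ n := pow_le_pow_left₀ hP (by linarith) n
        have h10 : 0 < (P + δ) ^ n := by positivity
        rw [inv_mul_le_iff₀ h10]
        have : 0 ≤ k ^ n := by positivity
        nlinarith
      have : ((P + δ) ^ n)⁻¹ * ℓ ^ n ≤ (δ ^ n)⁻¹ * ℓ ^ n := by gcongr
      linarith
    have h7 : 0 ≤ τ * ((2 * F) ^ (n + 1) * ν ^ n * (δ ^ n)⁻¹) := by positivity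
    calc ((P + δ) ^ n)⁻¹ * ρ * |H.det| ≤ ((P + δ) ^ n)⁻¹ * ρ * ((4 * ν) ^ n * ((k * P) ^ n + ℓ ^ n)) := by
          gcongr; exact h3.trans h4
      _ = ρ * ((4 * ν) ^ n * (((P + δ) ^ n)⁻¹ * ((k * P) ^ n + ℓ ^ n))) := by ring
      _ ≤ ρ * ((4 * ν) ^ n * (k ^ n + (δ ^ n)⁻¹ * ℓ ^ n)) := by gcongr
      _ ≤ _ := by linarith

/-- one time slice -/
theorem slice_lemma {n : ℕ} (hn : 0 < n) {ν : ℝ} (hν : 1 ≤ ν)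
    {W θ : En n × ℝ → ℝ} {p : En n × ℝ → En n}
    {H : En n × ℝ → (En n →L[ℝ] En n)} {G : Set (En n × ℝ)} (hC : C21 W θ p H G)
    {x1 y1 : En n} {R t M P δ τ F η : ℝ} (hR : 0 < R) (hM : 0 < M) (hP : 0 < P) (hPR : 8 * P * R ≤ M)
    (hδ : 0 < δ) (hτ : 0 < τ) (hF : 0 ≤ F) (hη : 0 ≤ η)
    (hy1 : y1 ∈ closedBall x1 R) {k ℓ : En n → ℝ} (hk : ∀ x, 0 ≤ k x) (hℓ : ∀ x, 0 ≤ ℓ x)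
    (hkm : Measurable k) (hℓm : Measurable ℓ)
    (hWc : ContinuousOn (fun x => W (x, t)) (closedBall x1 R))
    (hbd : ∀ x ∈ closedBall x1 R, 0 < W (x, t) → x ∈ ball x1 R ∧ (x, t) ∈ G)
    {m : En n → ℝ} (hmc : ContinuousOn m (closedBall x1 R))
    (hinc : ∀ x ∈ closedBall x1 R, M / 4 ≤ W (x, t) → W (x, t) - m x ≤ τ * (θ (x, t) + η))
    (hpde : ∀ᵐ x, x ∈ ball x1 R → (x, t) ∈ G → 0 < W (x, t) → ∃ A, Adm ν A ∧
      θ (x, t) ≤ trc A (H (x, t)) + k x * ‖p (x, t)‖ + ℓ x + F) :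
    ∫⁻ q in ball (0 : En n) P, ENNReal.ofReal (((‖q‖ + δ) ^ n)⁻¹ *
      (max (legH (closedBall x1 R) y1 (fun x => max (m x) (W (x, t))) q) (M / 2) -
        max (legH (closedBall x1 R) y1 m q) (M / 2))) ≤
    ENNReal.ofReal (τ * ((2 * (F + η)) ^ (n + 1) * ν ^ n * (δ ^ n)⁻¹)) *
      volume {x | x ∈ closedBall x1 R ∧ M / 4 ≤ W (x, t)} +
    ∫⁻ x in ball x1 R, ENNReal.ofReal (max (m x) (W (x, t)) - m x) *
      ENNReal.ofReal ((4 * ν) ^ n * (k x ^ n + (δ ^ n)⁻¹ * ℓ x ^ n)) := by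
  set B := closedBall x1 R with hBdef
  have hB : IsCompact B := isCompact_closedBall _ _
  have hBn : B.Nonempty := ⟨y1, hy1⟩
  set m' : En n → ℝ := fun x => max (m x) (W (x, t)) with hm'
  have hm'c : ContinuousOn m' B := hmc.sup hWc
  set Kt : Set (En n) := {x | x ∈ B ∧ M / 4 ≤ W (x, t)} with hKt
  have hKtc : IsClosed Kt := by
    have := hWc.preimage_isClosed_of_isClosed hB.isClosed (isClosed_Ici (a := M / 4))
    exact this
  have hKtG : ∀ x ∈ Kt, x ∈ ball x1 R ∧ (x, t) ∈ G := fun x hx => hbd x hx.1 (by linarith [hx.2])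
  have hmk : ContinuousOn (fun x : En n => (x, t)) Kt := Continuous.continuousOn (by fun_prop)
  have hmaps : MapsTo (fun x : En n => (x, t)) Kt G := fun x hx => (hKtG x hx).2
  have hpc : ContinuousOn (fun x => p (x, t)) Kt := hC.cp.comp hmk hmaps
  have hHc : ContinuousOn (fun x => H (x, t)) Kt := hC.cH.comp hmk hmaps
  set C : Set (En n) := Kt ∩ ⋂ y ∈ B, (Kt ∩ {x | W (y, t) - ⟪p (x, t), y⟫ - (W (x, t) - ⟪p (x, t), x⟫) ≤ 0}) with hCset
  have hCcl : IsClosed C := by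
    refine hKtc.inter (isClosed_biInter fun y hy => ?_)
    have hc : ContinuousOn (fun x => W (y, t) - ⟪p (x, t), y⟫ - (W (x, t) - ⟪p (x, t), x⟫)) Kt := by
      have h1 : ContinuousOn (fun x => ⟪p (x, t), y⟫) Kt := hpc.inner continuousOn_const
      have h2 : ContinuousOn (fun x => ⟪p (x, t), x⟫) Kt := hpc.inner continuousOn_id
      exact (continuousOn_const.sub h1).sub ((hWc.mono fun x hx => hx.1).sub h2)
    exact hc.preimage_isClosed_of_isClosed hKtc (isClosed_Iic (a := (0:ℝ)))
  have hCK : C ⊆ Kt := inter_subset_left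
  have hCcontact : ∀ x ∈ C, ∀ v, ⟪H (x, t) v, v⟫ ≤ 0 := by
    intro x hx
    have hG := (hKtG x (hCK hx))
    refine (hC.contact hG.2 (p (x, t)) ?_).2
    filter_upwards [isOpen_ball.mem_nhds hG.1] with y hy
    have := hx.2
    simp only [mem_iInter] at this
    have := (this y (ball_subset_closedBall hy)).2
    simp only [mem_setOf_eq] at this ⊢
    linarith
  set φ : En n → ℝ := (ball (0 : En n) P).indicator (fun q => ((‖q‖ + δ) ^ n)⁻¹ *
      (max (legH B y1 m' q) (M / 2) - max (legH B y1 m q) (M / 2))) with hφ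
  have hcont : Continuous (fun q : En n => ((‖q‖ + δ) ^ n)⁻¹) := by
    refine Continuous.inv₀ (by fun_prop) fun q => ?_
    have := norm_nonneg q
    positivity
  have hφm : Measurable φ := by
    refine Measurable.indicator ?_ measurableSet_ball
    have h1 := legH_cont hB hBn y1 hm'c
    have h2 := legH_cont hB hBn y1 hmc
    exact (hcont.mul ((h1.sup continuous_const).sub (h2.sup continuous_const))).measurable
  have hmono : ∀ q, legH B y1 m q ≤ legH B y1 m' q := by
    intro q
    obtain ⟨x, hx, hxe⟩ := legH_attained hB hBn y1 hmc q
    have := legH_le hB y1 hm'c q hx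
    rw [hxe]
    have h3 : m x ≤ m' x := le_max_left _ _
    linarith
  have hφ0 : ∀ q, 0 ≤ φ q := by
    intro q
    refine indicator_nonneg (fun q _ => ?_) q
    have := norm_nonneg q
    have h3 := max_le_max_right (M/2) (hmono q)
    exact mul_nonneg (by positivity) (by linarith)
  have hkey : ∀ q, 0 < φ q → ∃ x ∈ C, p (x, t) = q ∧
      φ q ≤ ((‖p (x, t)‖ + δ) ^ n)⁻¹ * (m' x - m x) := by
    intro q hq
    have hqP : q ∈ ball (0 : En n) P := by
      by_contra h
      rw [hφ, indicator_of_notMem h] at hq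
      exact lt_irrefl _ hq
    rw [hφ, indicator_of_mem hqP] at hq ⊢
    have hgp : 0 < ((‖q‖ + δ) ^ n)⁻¹ := by have := norm_nonneg q; positivity
    have hpos : 0 < max (legH B y1 m' q) (M / 2) - max (legH B y1 m q) (M / 2) := by
      by_contra h
      push Not at h
      nlinarith
    have h1 : M / 2 < legH B y1 m' q := by
      by_contra h
      push Not at h
      rw [max_eq_right h] at hpos
      have := le_max_right (legH B y1 m q) (M/2)
      linarith
    rw [max_eq_left h1.le] at hpos ⊢
    obtain ⟨x, hx, hxe⟩ := legH_attained hB hBn y1 hm'c q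
    have h2 := legH_le hB y1 hmc q hx
    have h3 := le_max_left (legH B y1 m q) (M/2)
    have h4 : legH B y1 m' q - max (legH B y1 m q) (M / 2) ≤ m' x - m x := by rw [hxe]; linarith
    have h5 : m x < W (x, t) := by
      by_contra h
      push Not at h
      have : m' x = m x := max_eq_left h
      linarith
    have h6 : m' x = W (x, t) := max_eq_right h5.le
    have hin : |⟪q, x - y1⟫| ≤ M / 4 := by
      refine (abs_real_inner_le_norm _ _).trans ?_
      have hq' : ‖q‖ ≤ P := by simpa using (mem_ball.1 hqP).le
      have hxy : ‖x - y1‖ ≤ 2 * R := by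
        rw [← dist_eq_norm]
        have := dist_triangle_right x y1 x1
        have a1 := mem_closedBall.1 hx
        have a2 := mem_closedBall.1 hy1
        linarith
      have := mul_le_mul hq' hxy (norm_nonneg _) hP.le
      linarith
    have h7 : M / 4 ≤ W (x, t) := by
      have := (abs_le.1 hin).1
      rw [hxe, h6] at h1
      linarith
    have hxK : x ∈ Kt := ⟨hx, h7⟩
    have hcon : ∀ y ∈ B, W (y, t) - ⟪q, y⟫ ≤ W (x, t) - ⟪q, x⟫ := by
      intro y hy
      have a1 := legH_le hB y1 hm'c q hy
      have a2 : W (y, t) ≤ m' y := le_max_right _ _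
      rw [hxe, h6, inner_sub_right, inner_sub_right] at a1
      linarith
    have hG := hKtG x hxK
    have hpq : p (x, t) = q := by
      refine (hC.contact hG.2 q ?_).1
      filter_upwards [isOpen_ball.mem_nhds hG.1] with y hy
      exact hcon y (ball_subset_closedBall hy)
    refine ⟨x, ⟨hxK, ?_⟩, hpq, ?_⟩
    · simp only [mem_iInter]
      intro y hy
      refine ⟨hxK, ?_⟩
      simp only [mem_setOf_eq, hpq]
      linarith [hcon y hy]
    · rw [hpq]
      exact mul_le_mul_of_nonneg_left h4 hgp.le
  have harea := weighted_area (f := fun x => p (x, t)) (f' := fun x => H (x, t)) (C := C)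
    (ρ := fun x => ((‖p (x, t)‖ + δ) ^ n)⁻¹ * (m' x - m x)) (φ := φ) hCcl.measurableSet
    (fun x hx => hC.dxx (x, t) (hKtG x (hCK hx)).2) (hHc.mono hCK)
    (by
      have h1 : ContinuousOn (fun x => ((‖p (x, t)‖ + δ) ^ n)⁻¹) C :=
        hcont.comp_continuousOn (hpc.mono hCK)
      exact h1.mul ((hm'c.sub hmc).mono fun x hx => (hCK hx).1))
    (fun x hx => mul_nonneg (by positivity) (sub_nonneg.2 (le_max_left _ _)))
    hφm hφ0 hkey
  have hL : ∫⁻ q, ENNReal.ofReal (φ q) = ∫⁻ q in ball (0 : En n) P, ENNReal.ofReal (((‖q‖ + δ) ^ n)⁻¹ *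
      (max (legH B y1 m' q) (M / 2) - max (legH B y1 m q) (M / 2))) := by
    rw [← lintegral_indicator measurableSet_ball]
    refine lintegral_congr fun q => ?_
    by_cases hq : q ∈ ball (0 : En n) P
    · rw [hφ, indicator_of_mem hq, indicator_of_mem hq]
    · rw [hφ, indicator_of_notMem hq, indicator_of_notMem hq]; simp
  rw [← hL]
  refine harea.trans ?_
  set c1 := τ * ((2 * (F + η)) ^ (n + 1) * ν ^ n * (δ ^ n)⁻¹) with hc1
  have hc10 : 0 ≤ c1 := by
    have : 0 ≤ ν := by linarith
    positivity
  set κ : En n → ℝ := fun x => (4 * ν) ^ n * (k x ^ n + (δ ^ n)⁻¹ * ℓ x ^ n) with hκ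
  have hκ0 : ∀ x, 0 ≤ κ x := fun x => by
    have := hk x; have := hℓ x
    have : 0 ≤ ν := by linarith
    simp only [hκ]; positivity
  calc ∫⁻ x in C, ENNReal.ofReal (((‖p (x, t)‖ + δ) ^ n)⁻¹ * (m' x - m x) * |(H (x, t)).det|)
      ≤ ∫⁻ x in C, (ENNReal.ofReal c1 + ENNReal.ofReal (m' x - m x) * ENNReal.ofReal (κ x)) := by
        refine lintegral_mono_ae ?_
        filter_upwards [ae_restrict_of_ae hpde, ae_restrict_mem hCcl.measurableSet] with x hx hxC
        have hxK := hCK hxC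
        have hG := hKtG x hxK
        have hm0 : 0 ≤ m' x - m x := sub_nonneg.2 (le_max_left _ _)
        obtain ⟨A, hA, hA2⟩ := hx hG.1 hG.2 (by linarith [hxK.2])
        rw [← ENNReal.ofReal_mul hm0, ← ENNReal.ofReal_add hc10 (mul_nonneg hm0 (hκ0 x))]
        refine ENNReal.ofReal_le_ofReal ?_
        rcases le_total (W (x, t)) (m x) with h | h
        · have : m' x = m x := max_eq_left h
          rw [this]; simp [hc10]
        · have h6 : m' x = W (x, t) := max_eq_right h
          exact contact_point_est hn hν hA (fun v w => hC.symm hG.2 v w) (hCcontact x hxC)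
            (hk x) (hℓ x) (by linarith) (norm_nonneg _) hδ hτ hm0
            (by rw [h6]; exact hinc x hxK.1 hxK.2) (by linarith)
    _ ≤ ENNReal.ofReal c1 * volume C + ∫⁻ x in C, ENNReal.ofReal (m' x - m x) * ENNReal.ofReal (κ x) := by
        rw [lintegral_add_left measurable_const]
        simp
    _ ≤ _ := by
        refine add_le_add ?_ ?_
        · gcongr
        · exact lintegral_mono_set fun x hx => (hKtG x (hCK hx)).1

def runMax {α : Type*} (w : ℕ → α → ℝ) : ℕ → α → ℝ
  | 0 => w 0
  | j + 1 => fun x => max (runMax w j x) (w (j + 1) x)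

theorem runMax_ge {α : Type*} (w : ℕ → α → ℝ) (j : ℕ) (x : α) : w j x ≤ runMax w j x := by
  cases j with
  | zero => exact le_rfl
  | succ j => exact le_max_right _ _

theorem runMax_le {α : Type*} (w : ℕ → α → ℝ) (j : ℕ) (x : α) {M : ℝ} (h : ∀ i ≤ j, w i x ≤ M) :
    runMax w j x ≤ M := by
  induction j with
  | zero => exact h 0 le_rfl
  | succ j ih => exact max_le (ih fun i hi => h i (hi.trans (Nat.le_succ _))) (h _ le_rfl)

theorem runMax_cont {n : ℕ} {B : Set (En n)} (w : ℕ → En n → ℝ) (j : ℕ)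
    (h : ∀ i ≤ j, ContinuousOn (w i) B) : ContinuousOn (runMax w j) B := by
  induction j with
  | zero => exact h 0 le_rfl
  | succ j ih => exact (ih fun i hi => h i (hi.trans (Nat.le_succ _))).sup (h _ le_rfl)

theorem grid_scale {n : ℕ} {W θ : En n × ℝ → ℝ} {p : En n × ℝ → En n}
    {H : En n × ℝ → (En n →L[ℝ] En n)} {G : Set (En n × ℝ)} (hC : C21 W θ p H G)
    {x1 : En n} {R t0 t1 M η : ℝ} (hM : 0 < M) (hη : 0 < η)
    (hWc : ContinuousOn W (closedBall x1 R ×ˢ Icc t0 t1))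
    (hbot : ∀ x ∈ closedBall x1 R, W (x, t0) = 0)
    (hG : ∀ X ∈ closedBall x1 R ×ˢ Icc t0 t1, 0 < W X → X ∈ G) :
    ∃ d > 0, ∀ x ∈ closedBall x1 R, ∀ t ∈ Icc t0 t1, M / 4 ≤ W (x, t) → ∀ σ, 0 < σ → σ < d →
      0 < W (x, t - σ) ∧ W (x, t) - W (x, t - σ) ≤ σ * (θ (x, t) + η) := by
  set Q := closedBall x1 R ×ˢ Icc t0 t1 with hQ
  have hQc : IsCompact Q := (isCompact_closedBall _ _).prod isCompact_Icc
  have huc := hQc.uniformContinuousOn_of_continuous hWc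
  obtain ⟨d1, hd1, hd1'⟩ := Metric.uniformContinuousOn_iff.1 huc (M / 8) (by positivity)
  set K : Set (En n × ℝ) := {X | X ∈ Q ∧ M / 4 ≤ W X} with hK
  have hKcl : IsClosed K := hWc.preimage_isClosed_of_isClosed hQc.isClosed (isClosed_Ici (a := M/4))
  have hKc : IsCompact K := hQc.of_isClosed_subset hKcl fun X hX => hX.1
  have hKG : K ⊆ G := fun X hX => hG X hX.1 (by linarith [hX.2])
  obtain ⟨ε, hε, hεG⟩ := hKc.exists_cthickening_subset_open hC.op hKG
  have hcc : IsCompact (cthickening ε K) := hKc.cthickening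
  have huc2 := hcc.uniformContinuousOn_of_continuous (hC.ct.mono hεG)
  obtain ⟨d2, hd2, hd2'⟩ := Metric.uniformContinuousOn_iff.1 huc2 η hη
  refine ⟨min d1 (min ε d2), by positivity, fun x hx t ht hW σ hσ hσd => ?_⟩
  have hσ1 : σ < d1 := hσd.trans_le (min_le_left _ _)
  have hσ2 : σ < ε := hσd.trans_le ((min_le_right _ _).trans (min_le_left _ _))
  have hσ3 : σ < d2 := hσd.trans_le ((min_le_right _ _).trans (min_le_right _ _))
  have hdist : ∀ s s' : ℝ, dist ((x, s) : En n × ℝ) (x, s') = |s - s'| := by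
    intro s s'; rw [Prod.dist_eq]; simp [Real.dist_eq]
  have htt : t0 < t - σ := by
    by_contra h
    push Not at h
    have h1 := hd1' (x, t) ⟨hx, ht⟩ (x, t0) ⟨hx, ⟨le_rfl, ht.1.trans ht.2⟩⟩ (by
      rw [hdist, abs_of_nonneg (by linarith [ht.1])]; linarith)
    rw [hbot x hx, Real.dist_eq, sub_zero] at h1
    have := le_abs_self (W (x, t))
    linarith
  have hXK : (x, t) ∈ K := ⟨⟨hx, ht⟩, hW⟩
  have hmem : ∀ s ∈ Icc (t - σ) t, (x, s) ∈ cthickening ε K := by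
    intro s hs
    refine mem_cthickening_of_dist_le _ (x, t) _ _ hXK ?_
    rw [hdist, abs_sub_comm, abs_of_nonneg (by linarith [hs.2])]
    linarith [hs.1]
  refine ⟨?_, ?_⟩
  · have h1 := hd1' (x, t) ⟨hx, ht⟩ (x, t - σ) ⟨hx, ⟨htt.le, by linarith [ht.2]⟩⟩ (by
      rw [hdist]; rw [abs_of_nonneg (by linarith)]; linarith)
    rw [Real.dist_eq] at h1
    have := (abs_lt.1 h1).2
    linarith
  · have hd : ∀ s ∈ Icc (t - σ) t, HasDerivAt (fun s => W (x, s)) (θ (x, s)) s :=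
      fun s hs => hC.dt (x, s) (hεG (hmem s hs))
    obtain ⟨s, hs, hs2⟩ := exists_hasDerivAt_eq_slope (fun s => W (x, s)) (fun s => θ (x, s))
      (by linarith : t - σ < t) (fun s hs => (hd s hs).continuousAt.continuousWithinAt)
      (fun s hs => hd s (Ioo_subset_Icc_self hs))
    have h3 := hd2' (x, s) (hmem s (Ioo_subset_Icc_self hs)) (x, t) (hmem t ⟨by linarith, le_rfl⟩) (by
      rw [hdist, abs_sub_comm, abs_of_nonneg (by linarith [hs.2])]; linarith [hs.1])
    rw [Real.dist_eq] at h3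
    have h4 := (abs_lt.1 h3).2
    have h5 : W (x, t) - W (x, t - σ) = σ * θ (x, s) := by
      rw [hs2, show t - (t - σ) = σ by ring]; field_simp
    rw [h5]
    have : θ (x, s) ≤ θ (x, t) + η := by linarith
    gcongr

theorem abp_core {n : ℕ} (hn : 0 < n) {ν : ℝ} (hν : 1 ≤ ν)
    {W θ : En n × ℝ → ℝ} {p : En n × ℝ → En n}
    {H : En n × ℝ → (En n →L[ℝ] En n)} {G : Set (En n × ℝ)} (hC : C21 W θ p H G)
    {x1 y1 : En n} {R t0 t1 τ1 M P δ F η : ℝ} (hR : 0 < R) (hM : 0 < M) (hP : 0 < P)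
    (hPR : 8 * P * R ≤ M)
    (hδ : 0 < δ) (hF : 0 ≤ F) (hη : 0 < η)
    {k ℓ : En n → ℝ} (hk : ∀ x, 0 ≤ k x) (hℓ : ∀ x, 0 ≤ ℓ x)
    (hkm : Measurable k) (hℓm : Measurable ℓ)
    (hWc : ContinuousOn W (closedBall x1 R ×ˢ Icc t0 t1))
    (hbot : ∀ x ∈ closedBall x1 R, W (x, t0) = 0)
    (hG : ∀ X ∈ closedBall x1 R ×ˢ Icc t0 t1, 0 < W X → X ∈ G)
    (hside : ∀ X ∈ closedBall x1 R ×ˢ Icc t0 t1, 0 < W X → X.1 ∈ ball x1 R)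
    (hW0 : ∀ X ∈ closedBall x1 R ×ˢ Icc t0 t1, 0 ≤ W X)
    (hWM : ∀ X ∈ closedBall x1 R ×ˢ Icc t0 t1, W X ≤ M)
    (hy1 : y1 ∈ closedBall x1 R) (hτ1 : τ1 ∈ Icc t0 t1) (hy1M : W (y1, τ1) = M)
    (hpde : ∀ᵐ x, ∀ t, x ∈ ball x1 R → t ∈ Icc t0 t1 → (x, t) ∈ G → 0 < W (x, t) → ∃ A, Adm ν A ∧
      θ (x, t) ≤ trc A (H (x, t)) + k x * ‖p (x, t)‖ + ℓ x + F) :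
    ENNReal.ofReal (M / 4) * ∫⁻ q in ball (0 : En n) P, ENNReal.ofReal (((‖q‖ + δ) ^ n)⁻¹) ≤
    ENNReal.ofReal ((2 * (F + η)) ^ (n + 1) * ν ^ n * (δ ^ n)⁻¹) *
      volume {X | X ∈ closedBall x1 R ×ˢ Icc t0 t1 ∧ 0 < W X} +
    ENNReal.ofReal M * ∫⁻ x in ball x1 R,
      ENNReal.ofReal ((4 * ν) ^ n * (k x ^ n + (δ ^ n)⁻¹ * ℓ x ^ n)) := by
  obtain ⟨d, hd, hgrid⟩ := grid_scale hC hM hη hWc hbot hG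
  set B := closedBall x1 R with hBdef
  have hB : IsCompact B := isCompact_closedBall _ _
  have hBn : B.Nonempty := ⟨y1, hy1⟩
  have ht01 : t0 < τ1 := by
    rcases hτ1.1.lt_or_eq with h | h
    · exact h
    · rw [← h, hbot y1 hy1] at hy1M; linarith
  obtain ⟨J, hJ⟩ := exists_nat_gt ((τ1 - t0) / d)
  have hJ0 : (0:ℝ) < J := lt_of_le_of_lt (div_nonneg (by linarith) hd.le) hJ
  set τ := (τ1 - t0) / J with hτdef
  have hτ : 0 < τ := div_pos (by linarith) hJ0
  have hτd : τ < d := by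
    rw [hτdef, div_lt_iff₀ hJ0]
    rw [div_lt_iff₀ hd] at hJ
    linarith
  have hJτ : J * τ = τ1 - t0 := by rw [hτdef]; field_simp
  set tt : ℕ → ℝ := fun j => t0 + j * τ with htt
  have htt0 : tt 0 = t0 := by simp [htt]
  have httJ : tt J = τ1 := by simp only [htt]; linarith
  have httm : ∀ j ≤ J, tt j ∈ Icc t0 t1 := by
    intro j hj
    have h1 : (j:ℝ) ≤ J := by exact_mod_cast hj
    have h2 : (j:ℝ) * τ ≤ J * τ := by gcongr
    have h3 : 0 ≤ (j:ℝ) * τ := by positivity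
    exact ⟨by simp only [htt]; linarith, by simp only [htt]; linarith [hτ1.2]⟩
  have htts : ∀ j, tt (j + 1) - τ = tt j := by
    intro j; simp only [htt]; push_cast; ring
  set w : ℕ → En n → ℝ := fun j x => W (x, tt j) with hw
  have hwc : ∀ j ≤ J, ContinuousOn (w j) B := by
    intro j hj
    refine hWc.comp (Continuous.continuousOn (by fun_prop)) fun x hx => ⟨hx, httm j hj⟩
  have hmc : ∀ j ≤ J, ContinuousOn (runMax w j) B := fun j hj =>
    runMax_cont w j fun i hi => hwc i (hi.trans hj)
  set Ĥ : ℕ → En n → ℝ := fun j q => max (legH B y1 (runMax w j) q) (M / 2) with hĤ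
  set c1 := (2 * (F + η)) ^ (n + 1) * ν ^ n * (δ ^ n)⁻¹ with hc1
  set κ : En n → ℝ := fun x => (4 * ν) ^ n * (k x ^ n + (δ ^ n)⁻¹ * ℓ x ^ n) with hκ
  set Kt : ℕ → Set (En n) := fun j => {x | x ∈ B ∧ M / 4 ≤ W (x, tt j)} with hKt
  have hslice : ∀ j ∈ Finset.range J,
      ∫⁻ q in ball (0 : En n) P, ENNReal.ofReal (((‖q‖ + δ) ^ n)⁻¹ * (Ĥ (j + 1) q - Ĥ j q)) ≤
      ENNReal.ofReal (τ * c1) * volume (Kt (j + 1)) +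
      ∫⁻ x in ball x1 R, ENNReal.ofReal (runMax w (j + 1) x - runMax w j x) * ENNReal.ofReal (κ x) := by
    intro j hj
    have hj : j + 1 ≤ J := Finset.mem_range.1 hj
    refine slice_lemma hn hν hC (t := tt (j + 1)) (m := runMax w j) hR hM hP hPR hδ hτ hF hη.le hy1 hk hℓ hkm hℓm
      (hwc (j + 1) hj) ?_ (hmc j (by omega)) ?_ ?_
    · intro x hx hpos
      exact ⟨hside (x, tt (j+1)) ⟨hx, httm _ hj⟩ hpos, hG _ ⟨hx, httm _ hj⟩ hpos⟩
    · intro x hx hx2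
      have h1 := (hgrid x hx _ (httm _ hj) hx2 τ hτ hτd).2
      have h2 := runMax_ge w j x
      rw [htts] at h1
      simp only [hw] at h2 ⊢
      linarith
    · filter_upwards [hpde] with x hx h1 h2 h3
      exact hx _ h1 (httm _ hj) h2 h3
  have hsum := Finset.sum_le_sum hslice
  have hĤc : ∀ j ≤ J, Continuous (Ĥ j) := fun j hj =>
    (legH_cont hB hBn y1 (hmc j hj)).sup continuous_const
  have hcont : Continuous (fun q : En n => ((‖q‖ + δ) ^ n)⁻¹) := by
    refine Continuous.inv₀ (by fun_prop) fun q => ?_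
    have := norm_nonneg q
    positivity
  have hĤmono : ∀ j < J, ∀ q, Ĥ j q ≤ Ĥ (j + 1) q := by
    intro j hj q
    refine max_le_max_right _ ?_
    obtain ⟨x, hx, hxe⟩ := legH_attained hB hBn y1 (hmc j hj.le) q
    have := legH_le hB y1 (hmc (j+1) hj) q hx
    rw [hxe]
    have h3 : runMax w j x ≤ runMax w (j+1) x := le_max_left _ _
    linarith
  -- left side
  have hleft : ENNReal.ofReal (M / 4) * ∫⁻ q in ball (0 : En n) P, ENNReal.ofReal (((‖q‖ + δ) ^ n)⁻¹) ≤
      ∑ j ∈ Finset.range J, ∫⁻ q in ball (0 : En n) P,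
        ENNReal.ofReal (((‖q‖ + δ) ^ n)⁻¹ * (Ĥ (j + 1) q - Ĥ j q)) := by
    rw [← lintegral_finset_sum', ← lintegral_const_mul']
    · refine setLIntegral_mono' measurableSet_ball fun q hq => ?_
      have hg0 : 0 ≤ ((‖q‖ + δ) ^ n)⁻¹ := by have := norm_nonneg q; positivity
      rw [← ENNReal.ofReal_sum_of_nonneg, ← Finset.mul_sum, Finset.sum_range_sub (fun j => Ĥ j q),
        ← ENNReal.ofReal_mul (by positivity)]
      · refine ENNReal.ofReal_le_ofReal ?_
        rw [mul_comm]
        refine mul_le_mul_of_nonneg_left ?_ hg0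
        have h1 : Ĥ J q ≥ M := by
          have := legH_le hB y1 (hmc J le_rfl) q hy1
          have h2 := runMax_ge w J y1
          simp only [hw] at h2
          rw [httJ, hy1M] at h2
          simp only [sub_self, inner_zero_right, sub_zero] at this
          exact le_max_of_le_left (by linarith)
        have h2 : Ĥ 0 q = M / 2 := by
          refine max_eq_right ?_
          obtain ⟨x, hx, hxe⟩ := legH_attained hB hBn y1 (hmc 0 (Nat.zero_le _)) q
          rw [hxe]
          have h3 : runMax w 0 x = 0 := by
            show W (x, tt 0) = 0
            rw [htt0]; exact hbot x hx
          have hin : |⟪q, x - y1⟫| ≤ M / 4 := by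
            refine (abs_real_inner_le_norm _ _).trans ?_
            have hq' : ‖q‖ ≤ P := by simpa using (mem_ball.1 hq).le
            have hxy : ‖x - y1‖ ≤ 2 * R := by
              rw [← dist_eq_norm]
              have := dist_triangle_right x y1 x1
              have a1 := mem_closedBall.1 hx
              have a2 := mem_closedBall.1 hy1
              linarith
            have := mul_le_mul hq' hxy (norm_nonneg _) hP.le
            linarith
          have := (abs_le.1 hin).1
          rw [h3]; linarith
        rw [h2]; linarith
      · intro j hj
        have := hĤmono j (Finset.mem_range.1 hj) q
        exact mul_nonneg hg0 (by linarith)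
    · exact ENNReal.ofReal_ne_top
    · intro j hj
      have hj := Finset.mem_range.1 hj
      exact ((hcont.mul ((hĤc (j+1) hj).sub (hĤc j hj.le))).measurable.ennreal_ofReal).aemeasurable
  refine hleft.trans (hsum.trans ?_)
  rw [Finset.sum_add_distrib]
  refine add_le_add ?_ ?_
  · -- volumes
    have hν0 : 0 ≤ ν := by linarith
    have hc10 : 0 ≤ c1 := by positivity
    rw [← Finset.mul_sum, mul_comm τ c1, ENNReal.ofReal_mul hc10, mul_assoc]
    gcongr
    rw [Finset.mul_sum]
    set S : ℕ → Set (En n × ℝ) := fun j => Kt (j + 1) ×ˢ Ioo (tt j) (tt (j + 1)) with hS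
    have hSvol : ∀ j, volume (S j) = ENNReal.ofReal τ * volume (Kt (j + 1)) := by
      intro j
      have : tt (j+1) - tt j = τ := by have := htts j; linarith
      rw [hS, Measure.volume_eq_prod, Measure.prod_prod, Real.volume_Ioo, this, mul_comm]
    have hKm : ∀ j ≤ J, MeasurableSet (Kt j) := by
      intro j hj
      exact ((hwc j hj).preimage_isClosed_of_isClosed hB.isClosed (isClosed_Ici (a := M / 4))).measurableSet
    calc ∑ j ∈ Finset.range J, ENNReal.ofReal τ * volume (Kt (j + 1))
        = ∑ j ∈ Finset.range J, volume (S j) := Finset.sum_congr rfl fun j _ => (hSvol j).symm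
      _ = volume (⋃ j ∈ Finset.range J, S j) := by
          refine (measure_biUnion_finset ?_ ?_).symm
          · intro i _ j _ hij
            rw [Function.onFun, Set.disjoint_left]
            rintro X ⟨_, h1⟩ ⟨_, h2⟩
            simp only [htt, mem_Ioo] at h1 h2
            rcases lt_or_gt_of_ne hij with h | h
            · have h3 : ((i + 1 : ℕ) : ℝ) ≤ j := by exact_mod_cast h
              have := mul_le_mul_of_nonneg_right h3 hτ.le
              linarith [h1.2, h2.1]
            · have h3 : ((j + 1 : ℕ) : ℝ) ≤ i := by exact_mod_cast h
              have := mul_le_mul_of_nonneg_right h3 hτ.le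
              linarith [h2.2, h1.1]
          · intro j hj
            exact (hKm _ (Finset.mem_range.1 hj)).prod measurableSet_Ioo
      _ ≤ _ := by
          refine measure_mono ?_
          refine iUnion₂_subset fun j hj => ?_
          rintro ⟨x, t⟩ ⟨⟨hx, hx2⟩, ht⟩
          have hj1 : j + 1 ≤ J := Finset.mem_range.1 hj
          have ht1 : tt j < t := ht.1
          have ht2 : t < tt (j+1) := ht.2
          have h1 := (hgrid x hx _ (httm _ hj1) hx2 (tt (j+1) - t) (by linarith)
            (by have := htts j; linarith)).1
          rw [show tt (j + 1) - (tt (j + 1) - t) = t by ring] at h1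
          refine ⟨⟨hx, ⟨?_, ?_⟩⟩, h1⟩
          · have := (httm j (by omega)).1; linarith
          · have := (httm _ hj1).2; linarith
  · rw [← lintegral_finset_sum', ← lintegral_const_mul']
    · refine setLIntegral_mono' measurableSet_ball fun x hx => ?_
      have hxB : x ∈ B := ball_subset_closedBall hx
      rw [← Finset.sum_mul]
      gcongr
      rw [← ENNReal.ofReal_sum_of_nonneg, Finset.sum_range_sub (fun j => runMax w j x)]
      · refine ENNReal.ofReal_le_ofReal ?_
        have h1 : runMax w J x ≤ M := runMax_le w J x fun i hi => hWM _ ⟨hxB, httm i hi⟩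
        have h2 : runMax w 0 x = 0 := by
          show W (x, tt 0) = 0
          rw [htt0]; exact hbot x hxB
        rw [h2]; linarith
      · intro j _
        exact sub_nonneg.2 (le_max_left _ _)
    · exact ENNReal.ofReal_ne_top
    · intro j hj
      have hj := Finset.mem_range.1 hj
      have h1 : AEMeasurable (fun x => ENNReal.ofReal (runMax w (j + 1) x - runMax w j x))
          (volume.restrict (ball x1 R)) :=
        ((((hmc (j+1) hj).sub (hmc j hj.le)).mono ball_subset_closedBall).aemeasurable
          measurableSet_ball).ennreal_ofReal
      have h2 : AEMeasurable (fun x => ENNReal.ofReal (κ x)) (volume.restrict (ball x1 R)) := by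
        refine (Measurable.ennreal_ofReal ?_).aemeasurable
        simp only [hκ]
        fun_prop
      exact h1.mul h2

def mass {n : ℕ} (k : En n → ℝ) (U : Set (En n)) : ℝ≥0∞ := ∫⁻ x in U, ENNReal.ofReal (k x ^ n)

theorem mass_mono {n : ℕ} (k : En n → ℝ) {U V : Set (En n)} (h : U ⊆ V) : mass k U ≤ mass k V :=
  lintegral_mono_set h

theorem abp {n : ℕ} (hn : 0 < n) {ν : ℝ} (hν : 1 ≤ ν) (S : ℝ) (hS : 0 ≤ S) :
    ∃ ε0 : ℝ, 0 < ε0 ∧ ∀ (W θ : En n × ℝ → ℝ) (p : En n × ℝ → En n)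
    (H : En n × ℝ → (En n →L[ℝ] En n)) (G : Set (En n × ℝ)) (x1 : En n) (R t0 t1 M F : ℝ)
    (k ℓ : En n → ℝ), C21 W θ p H G → 0 < R → 0 < M → 0 ≤ F → (∀ x, 0 ≤ k x) → (∀ x, 0 ≤ ℓ x) →
    Measurable k → Measurable ℓ →
    ContinuousOn W (closedBall x1 R ×ˢ Icc t0 t1) →
    (∀ x ∈ closedBall x1 R, W (x, t0) = 0) →
    (∀ X ∈ closedBall x1 R ×ˢ Icc t0 t1, 0 < W X → X ∈ G) →
    (∀ X ∈ closedBall x1 R ×ˢ Icc t0 t1, 0 < W X → X.1 ∈ ball x1 R) →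
    (∀ X ∈ closedBall x1 R ×ˢ Icc t0 t1, 0 ≤ W X) →
    (∀ᵐ x, ∀ t, x ∈ ball x1 R → t ∈ Icc t0 t1 → (x, t) ∈ G → 0 < W (x, t) → ∃ A, Adm ν A ∧
      θ (x, t) ≤ trc A (H (x, t)) + k x * ‖p (x, t)‖ + ℓ x + F) →
    mass k (ball x1 R) ≤ ENNReal.ofReal S →
    mass ℓ (ball x1 R) ≤ ENNReal.ofReal (ε0 * (M / R) ^ n) →
    ENNReal.ofReal (F ^ (n + 1)) * volume {X | X ∈ closedBall x1 R ×ˢ Icc t0 t1 ∧ 0 < W X} ≤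
      ENNReal.ofReal (ε0 * (M ^ (n + 1) / R ^ n)) →
    ∀ X ∈ closedBall x1 R ×ˢ Icc t0 t1, W X < M := by
  obtain ⟨c, hc, hcK⟩ := weight_lower n hn
  obtain ⟨K, hK⟩ := exists_nat_gt (((4 * ν) ^ n * S + 1) * 4 / c)
  have hν0 : 0 < ν := by linarith
  set Λ : ℝ := (8 * 2 ^ K) ^ n with hΛ
  have hΛ0 : 0 < Λ := by positivity
  set D : ℝ := 2 ^ (n + 2) * ν ^ n + (4 * ν) ^ n with hD
  have hD0 : 0 < D := by positivity
  refine ⟨1 / (2 * D * Λ), by positivity, ?_⟩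
  set ε0 : ℝ := 1 / (2 * D * Λ) with hε0
  have hε00 : 0 < ε0 := by positivity
  intro W θ p H G x1 R t0 t1 M F k ℓ hC hR hM hF hk hℓ hkm hℓm hWc hbot hG hside hW0 hpde hmk hmℓ hvol
  by_contra hcon
  push Not at hcon
  obtain ⟨X0, hX0, hX0M⟩ := hcon
  set Q := closedBall x1 R ×ˢ Icc t0 t1 with hQ
  have hQc : IsCompact Q := (isCompact_closedBall _ _).prod isCompact_Icc
  obtain ⟨⟨y1, τ1⟩, hXm, hmax⟩ := hQc.exists_isMaxOn ⟨X0, hX0⟩ hWc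
  set M' := W (y1, τ1) with hM'
  have hMM' : M ≤ M' := hX0M.trans (hmax hX0)
  have hM'0 : 0 < M' := hM.trans_le hMM'
  set Z : Set (En n × ℝ) := {X | X ∈ Q ∧ 0 < W X} with hZ
  have hZfin : volume Z ≠ ⊤ := ((measure_mono (fun X hX => hX.1)).trans_lt hQc.measure_lt_top).ne
  set V := (volume Z).toReal with hV
  have hV0 : 0 ≤ V := ENNReal.toReal_nonneg
  have hVe : volume Z = ENNReal.ofReal V := (ENNReal.ofReal_toReal hZfin).symm
  have hvolV : F ^ (n + 1) * V ≤ ε0 * (M ^ (n + 1) / R ^ n) := by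
    rw [hVe, ← ENNReal.ofReal_mul (by positivity)] at hvol
    exact (ENNReal.ofReal_le_ofReal_iff (by positivity)).1 hvol
  have hvolV' : F ^ (n + 1) * V < 2 * (ε0 * (M' ^ (n + 1) / R ^ n)) := by
    have h1 : ε0 * (M ^ (n + 1) / R ^ n) ≤ ε0 * (M' ^ (n + 1) / R ^ n) := by gcongr
    have h2 : 0 < ε0 * (M' ^ (n + 1) / R ^ n) := by positivity
    linarith
  obtain ⟨η, hη, hηV⟩ : ∃ η > 0, (F + η) ^ (n + 1) * V < 2 * (ε0 * (M' ^ (n + 1) / R ^ n)) := by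
    have hct : ContinuousAt (fun η : ℝ => (F + η) ^ (n + 1) * V) 0 := by fun_prop
    have h1 : ∀ᶠ η in nhds (0:ℝ), (F + η) ^ (n + 1) * V < 2 * (ε0 * (M' ^ (n + 1) / R ^ n)) := by
      refine hct.eventually_lt continuousAt_const ?_
      simpa using hvolV'
    obtain ⟨η, h2, h3⟩ := ((h1.filter_mono nhdsWithin_le_nhds).and
      (self_mem_nhdsWithin : Ioi (0:ℝ) ∈ nhdsWithin 0 (Ioi 0))).exists
    exact ⟨η, h3, h2⟩
  set P := M' / (8 * R) with hP
  have hP0 : 0 < P := by positivity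
  set δ := P / 2 ^ K with hδ
  have hδ0 : 0 < δ := by positivity
  have hcore := abp_core (y1 := y1) (τ1 := τ1) (M := M') (P := P) (δ := δ) (F := F) (η := η) hn hν hC hR hM'0 hP0
    (by rw [hP]; field_simp; exact le_rfl) hδ0 hF hη hk hℓ hkm hℓm hWc hbot hG hside hW0
    (fun X hX => hmax hX) hXm.1 hXm.2 rfl hpde
  have hδn : (δ ^ n)⁻¹ = Λ * (R / M') ^ n := by
    rw [hΛ, ← mul_pow, ← inv_pow]; congr 1
    rw [hδ, hP]; field_simp
  have hκ : ∫⁻ x in ball x1 R, ENNReal.ofReal ((4 * ν) ^ n * (k x ^ n + (δ ^ n)⁻¹ * ℓ x ^ n)) ≤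
      ENNReal.ofReal ((4 * ν) ^ n * (S + Λ * ε0)) := by
    have h1 : ∀ x, ENNReal.ofReal ((4 * ν) ^ n * (k x ^ n + (δ ^ n)⁻¹ * ℓ x ^ n)) =
        ENNReal.ofReal ((4 * ν) ^ n) * (ENNReal.ofReal (k x ^ n) + ENNReal.ofReal ((δ ^ n)⁻¹) * ENNReal.ofReal (ℓ x ^ n)) := by
      intro x
      have := hk x; have := hℓ x
      rw [← ENNReal.ofReal_mul (by positivity), ← ENNReal.ofReal_add (by positivity) (by positivity),
        ← ENNReal.ofReal_mul (by positivity)]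
    simp_rw [h1]
    rw [lintegral_const_mul' _ _ ENNReal.ofReal_ne_top, lintegral_add_left (by fun_prop),
      lintegral_const_mul' _ _ ENNReal.ofReal_ne_top, ENNReal.ofReal_mul (by positivity)]
    gcongr
    rw [ENNReal.ofReal_add hS (by positivity)]
    refine add_le_add hmk ?_
    calc ENNReal.ofReal ((δ ^ n)⁻¹) * mass ℓ (ball x1 R)
        ≤ ENNReal.ofReal ((δ ^ n)⁻¹) * ENNReal.ofReal (ε0 * (M / R) ^ n) := by gcongr
      _ = ENNReal.ofReal ((δ ^ n)⁻¹ * (ε0 * (M / R) ^ n)) := (ENNReal.ofReal_mul (by positivity)).symm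
      _ ≤ ENNReal.ofReal (Λ * ε0) := by
        refine ENNReal.ofReal_le_ofReal ?_
        have h2 : (M / R) ^ n ≤ (M' / R) ^ n := by gcongr
        rw [hδn]
        calc Λ * (R / M') ^ n * (ε0 * (M / R) ^ n) ≤ Λ * (R / M') ^ n * (ε0 * (M' / R) ^ n) := by gcongr
          _ = Λ * ε0 * ((R / M') * (M' / R)) ^ n := by rw [mul_pow]; ring
          _ = Λ * ε0 := by
            have : (R / M') * (M' / R) = 1 := by field_simp
            rw [this]; simp
  have hfin : ENNReal.ofReal (M' / 4 * (c * K)) ≤ ENNReal.ofReal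
      ((2 * (F + η)) ^ (n + 1) * ν ^ n * (δ ^ n)⁻¹ * V + M' * ((4 * ν) ^ n * (S + Λ * ε0))) := by
    rw [ENNReal.ofReal_mul (by positivity), ENNReal.ofReal_add (by positivity) (by positivity),
      ENNReal.ofReal_mul (p := (2 * (F + η)) ^ (n + 1) * ν ^ n * (δ ^ n)⁻¹) (by positivity),
      ENNReal.ofReal_mul (p := M') (by positivity), ← hVe]
    refine le_trans ?_ (hcore.trans ?_)
    · gcongr; exact hcK K P hP0
    · gcongr
  rw [ENNReal.ofReal_le_ofReal_iff (by positivity)] at hfin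
  have hT1 : (2 * (F + η)) ^ (n + 1) * ν ^ n * (δ ^ n)⁻¹ * V ≤ M' * (2 ^ (n + 2) * ν ^ n * Λ * ε0) := by
    rw [hδn, mul_pow]
    calc 2 ^ (n + 1) * (F + η) ^ (n + 1) * ν ^ n * (Λ * (R / M') ^ n) * V
        = 2 ^ (n + 1) * ν ^ n * (Λ * (R / M') ^ n) * ((F + η) ^ (n + 1) * V) := by ring
      _ ≤ 2 ^ (n + 1) * ν ^ n * (Λ * (R / M') ^ n) * (2 * (ε0 * (M' ^ (n + 1) / R ^ n))) := by gcongr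
      _ = M' * (2 ^ (n + 2) * ν ^ n * Λ * ε0) := by
        rw [div_pow, pow_succ M', pow_succ 2 (n+1)]; field_simp
  have hall : M' * (c * K / 4) ≤ M' * ((4 * ν) ^ n * S + D * Λ * ε0) := by
    have : M' * ((4 * ν) ^ n * S + D * Λ * ε0) = M' * (2 ^ (n + 2) * ν ^ n * Λ * ε0) +
      M' * ((4 * ν) ^ n * (S + Λ * ε0)) := by rw [hD]; ring
    rw [this]; linarith
  have hall' := le_of_mul_le_mul_left hall hM'0
  have hDε : D * Λ * ε0 = 1 / 2 := by rw [hε0]; field_simp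
  rw [div_lt_iff₀ hc] at hK
  linarith

theorem C21.mono {n : ℕ} {w θ : En n × ℝ → ℝ} {p : En n × ℝ → En n}
    {H : En n × ℝ → (En n →L[ℝ] En n)} {G G' : Set (En n × ℝ)} (h : C21 w θ p H G)
    (hG : IsOpen G') (hs : G' ⊆ G) : C21 w θ p H G' :=
  ⟨hG, fun X hX => h.dt X (hs hX), fun X hX => h.dx X (hs hX), fun X hX => h.dxx X (hs hX),
    h.cw.mono hs, h.ct.mono hs, h.cp.mono hs, h.cH.mono hs⟩

theorem evt_t {n : ℕ} {G : Set (En n × ℝ)} (hG : IsOpen G) {X : En n × ℝ} (hX : X ∈ G) :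
    ∀ᶠ t in nhds X.2, (X.1, t) ∈ G := by
  have : ContinuousAt (fun t : ℝ => (X.1, t)) X.2 := by fun_prop
  exact this.eventually_mem (hG.mem_nhds (by simpa using hX))

theorem evt_x {n : ℕ} {G : Set (En n × ℝ)} (hG : IsOpen G) {X : En n × ℝ} (hX : X ∈ G) :
    ∀ᶠ y in nhds X.1, (y, X.2) ∈ G := by
  have : ContinuousAt (fun y : En n => (y, X.2)) X.1 := by fun_prop
  exact this.eventually_mem (hG.mem_nhds (by simpa using hX))

theorem C21.congr {n : ℕ} {w w' θ : En n × ℝ → ℝ} {p : En n × ℝ → En n}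
    {H : En n × ℝ → (En n →L[ℝ] En n)} {G : Set (En n × ℝ)} (h : C21 w θ p H G)
    (he : ∀ X ∈ G, w' X = w X) : C21 w' θ p H G := by
  refine ⟨h.op, fun X hX => ?_, fun X hX => ?_, h.dxx, h.cw.congr he, h.ct, h.cp, h.cH⟩
  · refine (h.dt X hX).congr_of_eventuallyEq ?_
    filter_upwards [evt_t h.op hX] with t ht using he _ ht
  · refine (h.dx X hX).congr_of_eventuallyEq ?_
    filter_upwards [evt_x h.op hX] with t ht using he _ ht

theorem C21.add {n : ℕ} {w θ : En n × ℝ → ℝ} {p : En n × ℝ → En n}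
    {H : En n × ℝ → (En n →L[ℝ] En n)} {w' θ' : En n × ℝ → ℝ} {p' : En n × ℝ → En n}
    {H' : En n × ℝ → (En n →L[ℝ] En n)} {G : Set (En n × ℝ)} (h : C21 w θ p H G)
    (h' : C21 w' θ' p' H' G) : C21 (fun X => w X + w' X) (fun X => θ X + θ' X)
      (fun X => p X + p' X) (fun X => H X + H' X) G := by
  refine ⟨h.op, fun X hX => (h.dt X hX).add (h'.dt X hX), fun X hX => ?_,
    fun X hX => (h.dxx X hX).add (h'.dxx X hX), h.cw.add h'.cw, h.ct.add h'.ct, h.cp.add h'.cp,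
    h.cH.add h'.cH⟩
  rw [map_add]
  exact (h.dx X hX).add (h'.dx X hX)

theorem C21.const_smul {n : ℕ} {w θ : En n × ℝ → ℝ} {p : En n × ℝ → En n}
    {H : En n × ℝ → (En n →L[ℝ] En n)} {G : Set (En n × ℝ)} (h : C21 w θ p H G) (c : ℝ) :
    C21 (fun X => c * w X) (fun X => c * θ X) (fun X => c • p X) (fun X => c • H X) G := by
  refine ⟨h.op, fun X hX => (h.dt X hX).const_mul c, fun X hX => ?_,
    fun X hX => (h.dxx X hX).const_smul c, continuousOn_const.mul h.cw,
    continuousOn_const.mul h.ct, h.cp.const_smul c, h.cH.const_smul c⟩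
  have := (h.dx X hX).const_mul c
  rw [map_smul]
  exact this

theorem C21.const_add {n : ℕ} {w θ : En n × ℝ → ℝ} {p : En n × ℝ → En n}
    {H : En n × ℝ → (En n →L[ℝ] En n)} {G : Set (En n × ℝ)} (h : C21 w θ p H G) (c : ℝ) :
    C21 (fun X => c + w X) θ p H G :=
  ⟨h.op, fun X hX => (h.dt X hX).const_add c, fun X hX => (h.dx X hX).const_add c,
    h.dxx, continuousOn_const.add h.cw, h.ct, h.cp, h.cH⟩

/-- twice continuously differentiable functions of `x` -/
structure C2x {n : ℕ} (s : En n → ℝ) (ps : En n → En n) (Hs : En n → (En n →L[ℝ] En n)) : Prop where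
  d1 : ∀ x, HasFDerivAt s (innerSL ℝ (ps x)) x
  d2 : ∀ x, HasFDerivAt ps (Hs x) x
  cH : Continuous Hs

theorem C2x.cs {n : ℕ} {s : En n → ℝ} {ps : En n → En n} {Hs : En n → (En n →L[ℝ] En n)}
    (h : C2x s ps Hs) : Continuous s :=
  continuous_iff_continuousAt.2 fun x => (h.d1 x).continuousAt
theorem C2x.cp {n : ℕ} {s : En n → ℝ} {ps : En n → En n} {Hs : En n → (En n →L[ℝ] En n)}
    (h : C2x s ps Hs) : Continuous ps :=
  continuous_iff_continuousAt.2 fun x => (h.d2 x).continuousAt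

theorem exists_C2x {n : ℕ} {s : En n → ℝ} (h : ContDiff ℝ 2 s) : ∃ ps Hs, C2x s ps Hs := by
  set T := (InnerProductSpace.toDual ℝ (En n)).symm
  have hd : Differentiable ℝ s := h.differentiable (by norm_num)
  have h1 : ContDiff ℝ 1 (fderiv ℝ s) := h.fderiv_right (by norm_num)
  have hps : ContDiff ℝ 1 (fun x => T (fderiv ℝ s x)) := T.toContinuousLinearEquiv.contDiff.comp h1
  refine ⟨fun x => T (fderiv ℝ s x), fun x => fderiv ℝ (fun x => T (fderiv ℝ s x)) x, ?_, ?_, ?_⟩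
  · intro x
    have : innerSL ℝ (T (fderiv ℝ s x)) = fderiv ℝ s x := by
      ext v
      rw [innerSL_apply_apply]
      exact InnerProductSpace.toDual_symm_apply
    rw [this]
    exact (hd x).hasFDerivAt
  · intro x
    exact (hps.differentiable (by norm_num) x).hasFDerivAt
  · exact hps.continuous_fderiv (by norm_num)

theorem C2x.scale {n : ℕ} {s : En n → ℝ} {ps : En n → En n} {Hs : En n → (En n →L[ℝ] En n)}
    (h : C2x s ps Hs) (c : ℝ) (x1 : En n) : C2x (fun x => s (c • (x - x1)))
      (fun x => c • ps (c • (x - x1))) (fun x => (c * c) • Hs (c • (x - x1))) := by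
  have hl : ∀ x : En n, HasFDerivAt (fun x => c • (x - x1)) (c • ContinuousLinearMap.id ℝ (En n)) x :=
    fun x => ((hasFDerivAt_id x).sub_const x1).const_smul c
  refine ⟨fun x => ?_, fun x => ?_, ?_⟩
  · have := (h.d1 (c • (x - x1))).comp x (hl x)
    have e : innerSL ℝ (c • ps (c • (x - x1))) = (innerSL ℝ (ps (c • (x - x1)))) ∘L
        (c • ContinuousLinearMap.id ℝ (En n)) := by
      ext v
      simp [inner_smul_left, inner_smul_right]
    rw [e]
    exact this
  · have := ((h.d2 (c • (x - x1))).comp x (hl x)).const_smul c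
    have e : (c * c) • Hs (c • (x - x1)) = c • ((Hs (c • (x - x1))) ∘L
        (c • ContinuousLinearMap.id ℝ (En n))) := by
      ext1 v
      simp [mul_smul]
    rw [e]
    exact this
  · have := h.cH
    fun_prop

theorem C2x.add_time {n : ℕ} {s : En n → ℝ} {ps : En n → En n} {Hs : En n → (En n →L[ℝ] En n)}
    (h : C2x s ps Hs) {a a' : ℝ → ℝ} (ha : ∀ t, HasDerivAt a (a' t) t) (ha' : Continuous a') :
    C21 (fun X => s X.1 + a X.2) (fun X => a' X.2) (fun X => ps X.1) (fun X => Hs X.1) univ := by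
  have hac : Continuous a := continuous_iff_continuousAt.2 fun x => (ha x).continuousAt
  have h1 := h.cs
  have h2 := h.cp
  have h3 := h.cH
  refine ⟨isOpen_univ, fun X _ => (ha X.2).const_add (s X.1), fun X _ => (h.d1 X.1).add_const (a X.2),
    fun X _ => h.d2 X.1, ?_, ?_, ?_, ?_⟩ <;> exact Continuous.continuousOn (by fun_prop)

theorem exists_bump (n : ℕ) : ∃ (ψ : En n → ℝ) (p : En n → En n) (H : En n → (En n →L[ℝ] En n)) (C : ℝ),
    C2x ψ p H ∧ 0 < C ∧ (∀ x, 0 ≤ ψ x ∧ ψ x ≤ 1) ∧ (∀ x, ‖x‖ ≤ 1/2 → ψ x = 1) ∧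
    (∀ x, 1 ≤ ‖x‖ → ψ x = 0) ∧ (∀ x, ‖p x‖ ≤ C) ∧ (∀ x, ‖H x‖ ≤ C) ∧ (∀ x, ‖x‖ < 1/2 → p x = 0) := by
  let f : ContDiffBump (0 : En n) := ⟨1/2, 1, by norm_num, by norm_num⟩
  obtain ⟨p, H, h⟩ := exists_C2x (s := f) f.contDiff
  have hsupp : ∀ x, 1 ≤ ‖x‖ → f x = 0 := fun x hx => f.zero_of_le_dist (by simpa using hx)
  have hpe : ∀ U : Set (En n), IsOpen U → ∀ c : ℝ, (∀ x ∈ U, f x = c) → ∀ x ∈ U, p x = 0 := by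
    intro U hU c hc x hx
    have h1 : HasFDerivAt f (0 : En n →L[ℝ] ℝ) x := by
      refine (hasFDerivAt_const c x).congr_of_eventuallyEq ?_
      filter_upwards [hU.mem_nhds hx] with y hy using hc y hy
    have h2 := (h.d1 x).unique h1
    refine ext_inner_right ℝ fun v => ?_
    have := congrArg (fun g => g v) h2
    simpa using this
  have hp1 : ∀ x, 1 < ‖x‖ → p x = 0 := by
    refine hpe {x | 1 < ‖x‖} (isOpen_lt continuous_const continuous_norm) 0 ?_
    intro x hx
    exact hsupp x (le_of_lt hx)
  have hH1 : ∀ x, 1 < ‖x‖ → H x = 0 := by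
    intro x hx
    have h1 : HasFDerivAt p (0 : En n →L[ℝ] En n) x := by
      refine (hasFDerivAt_const (0 : En n) x).congr_of_eventuallyEq ?_
      filter_upwards [(isOpen_lt continuous_const continuous_norm).mem_nhds hx] with y hy using hp1 y hy
    exact (h.d2 x).unique h1
  obtain ⟨C1, hC1⟩ := (isCompact_closedBall (0 : En n) 1).exists_bound_of_continuousOn h.cp.continuousOn
  obtain ⟨C2, hC2⟩ := (isCompact_closedBall (0 : En n) 1).exists_bound_of_continuousOn h.cH.continuousOn
  have hmax : ∀ x : En n, 1 < ‖x‖ ∨ x ∈ closedBall (0 : En n) 1 := by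
    intro x
    rcases lt_or_ge 1 ‖x‖ with h | h
    · exact Or.inl h
    · right; simpa using h
  have hb1 : ∀ x, ‖p x‖ ≤ max 1 (max C1 C2) := by
    intro x
    rcases hmax x with hx | hx
    · rw [hp1 x hx]; simp
    · exact (hC1 x hx).trans ((le_max_left _ _).trans (le_max_right _ _))
  have hb2 : ∀ x, ‖H x‖ ≤ max 1 (max C1 C2) := by
    intro x
    rcases hmax x with hx | hx
    · rw [hH1 x hx]; simp
    · exact (hC2 x hx).trans ((le_max_right _ _).trans (le_max_right _ _))
  refine ⟨f, p, H, max 1 (max C1 C2), h, lt_of_lt_of_le one_pos (le_max_left _ _),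
    fun x => ⟨f.nonneg, f.le_one⟩, fun x hx => f.one_of_mem_closedBall (by rw [mem_closedBall_zero_iff]; exact hx), hsupp, hb1, hb2, ?_⟩
  refine hpe {x | ‖x‖ < 1/2} (isOpen_lt continuous_norm continuous_const) 1 ?_
  intro x hx
  refine f.one_of_mem_closedBall ?_
  have : ‖x‖ < 1/2 := hx
  rw [mem_closedBall_zero_iff]
  exact this.le

theorem shell_pigeon {n : ℕ} (k : En n → ℝ) (x1 : En n) {R S : ℝ} (hR : 0 < R) (hS : 0 ≤ S)
    (hm : mass k (ball x1 R) ≤ ENNReal.ofReal S) (K : ℕ) (hK : 0 < K) :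
    ∃ j < K, mass k (ball x1 (R / 2 ^ j) \ ball x1 (R / 2 ^ (j + 1))) ≤ ENNReal.ofReal (S / K) := by
  by_contra hcon
  push Not at hcon
  set A : ℕ → Set (En n) := fun i => ball x1 (R / 2 ^ i) \ ball x1 (R / 2 ^ (i + 1)) with hA
  have hAm : ∀ i, MeasurableSet (A i) := fun i => measurableSet_ball.diff measurableSet_ball
  have hmono : ∀ i j : ℕ, i ≤ j → R / 2 ^ j ≤ R / 2 ^ i := by
    intro i j hij
    have : (2:ℝ) ^ i ≤ 2 ^ j := pow_le_pow_right₀ (by norm_num) hij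
    gcongr
  have hdisj : (Finset.range K : Set ℕ).PairwiseDisjoint A := by
    intro i _ j _ hij
    rw [Function.onFun, Set.disjoint_left]
    rintro q ⟨h1, h2⟩ ⟨h3, h4⟩
    simp only [mem_ball, not_lt] at h1 h2 h3 h4
    rcases lt_or_gt_of_ne hij with h | h
    · have := hmono (i+1) j h; linarith
    · have := hmono (j+1) i h; linarith
  have hsub : (⋃ i ∈ Finset.range K, A i) ⊆ ball x1 R := by
    intro q hq
    simp only [mem_iUnion] at hq
    obtain ⟨i, _, h1, _⟩ := hq
    have := hmono 0 i (Nat.zero_le _)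
    simp only [mem_ball] at h1 ⊢
    simp at this
    linarith
  have hK0 : (0:ℝ) < K := by exact_mod_cast hK
  have h1 : ∑ i ∈ Finset.range K, ENNReal.ofReal (S / K) < ∑ i ∈ Finset.range K, mass k (A i) :=
    ENNReal.sum_lt_sum_of_nonempty (by simpa using hK.ne') fun i hi => hcon i (Finset.mem_range.1 hi)
  have h2 : ∑ i ∈ Finset.range K, mass k (A i) = mass k (⋃ i ∈ Finset.range K, A i) :=
    (lintegral_biUnion_finset hdisj (fun i _ => hAm i) _).symm
  have h3 : ∑ i ∈ Finset.range K, ENNReal.ofReal (S / K) = ENNReal.ofReal S := by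
    rw [Finset.sum_const, Finset.card_range, nsmul_eq_mul, ← ENNReal.ofReal_natCast,
      ← ENNReal.ofReal_mul hK0.le]
    congr 1
    field_simp
  rw [h2, h3] at h1
  exact absurd ((mass_mono k hsub).trans hm) (not_le.2 h1)

/-- positive part of `z` on `G`, zero off `G` -/
def posx {n : ℕ} (G : Set (En n × ℝ)) (z : En n × ℝ → ℝ) : En n × ℝ → ℝ :=
  Set.indicator G (fun X => max (z X) 0)

theorem posx_nonneg {n : ℕ} (G : Set (En n × ℝ)) (z : En n × ℝ → ℝ) (X : En n × ℝ) :
    0 ≤ posx G z X := Set.indicator_nonneg (fun _ _ => le_max_right _ _) X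

theorem posx_pos {n : ℕ} {G : Set (En n × ℝ)} {z : En n × ℝ → ℝ} {X : En n × ℝ}
    (h : 0 < posx G z X) : X ∈ G ∧ 0 < z X ∧ posx G z X = z X := by
  by_cases hX : X ∈ G
  · have e : posx G z X = max (z X) 0 := Set.indicator_of_mem hX _
    rw [e] at h
    have hz : 0 < z X := by
      by_contra hc
      rw [max_eq_right (not_lt.1 hc)] at h
      exact lt_irrefl _ h
    exact ⟨hX, hz, by rw [e, max_eq_left hz.le]⟩
  · exfalso
    have e : posx G z X = 0 := Set.indicator_of_notMem hX _
    linarith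

theorem posx_of {n : ℕ} {G : Set (En n × ℝ)} {z : En n × ℝ → ℝ} {X : En n × ℝ}
    (hX : X ∈ G) (hz : 0 ≤ z X) : posx G z X = z X := by
  have e : posx G z X = max (z X) 0 := Set.indicator_of_mem hX _
  rw [e, max_eq_left hz]

theorem gl1_aux {m ρ τ q : ℝ} (hm : 0 < m) (hρ : 0 < ρ) (h : 0 ≤ τ + q) :
    m * (1 / ρ ^ 2) ≤ m * (ρ⁻¹ * ρ⁻¹ * τ) + (q + 1) * m / ρ ^ 2 := by
  have : m * (ρ⁻¹ * ρ⁻¹ * τ) + (q + 1) * m / ρ ^ 2 - m * (1 / ρ ^ 2) = m / ρ ^ 2 * (τ + q) := by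
    field_simp; ring
  have h5 : 0 ≤ m / ρ ^ 2 * (τ + q) := mul_nonneg (by positivity) h
  linarith

set_option maxHeartbeats 1600000 in
theorem gl1 {n : ℕ} (hn : 0 < n) {ν : ℝ} (hν : 1 ≤ ν) (S : ℝ) (hS : 0 ≤ S) :
    ∃ δ : ℝ, 0 < δ ∧ ∀ (z θ : En n × ℝ → ℝ) (p : En n × ℝ → En n)
    (H : En n × ℝ → (En n →L[ℝ] En n)) (G : Set (En n × ℝ)) (x1 : En n) (R t1 m : ℝ)
    (k : En n → ℝ), C21 z θ p H G → 0 < R → 0 < m → (∀ x, 0 ≤ k x) → Measurable k →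
    mass k (ball x1 R) ≤ ENNReal.ofReal S →
    (∀ᵐ x, ∀ t, x ∈ ball x1 R → t ∈ Icc (t1 - R ^ 2) t1 → (x, t) ∈ G → 0 < z (x, t) → ∃ A, Adm ν A ∧
      θ (x, t) ≤ trc A (H (x, t)) + k x * ‖p (x, t)‖) →
    (∀ X ∈ closedBall x1 R ×ˢ Icc (t1 - R ^ 2) t1, X ∈ G → z X ≤ m) →
    ContinuousOn (posx G z) (closedBall x1 R ×ˢ Icc (t1 - R ^ 2) t1) →
    volume {X | X ∈ closedBall x1 R ×ˢ Icc (t1 - R ^ 2) t1 ∧ X ∈ G ∧ 0 < z X} ≤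
      ENNReal.ofReal (δ * R ^ (n + 2)) →
    (x1, t1) ∈ G → z (x1, t1) ≤ m / 2 := by
  obtain ⟨ε0, hε0, habp⟩ := abp hn hν S hS
  obtain ⟨ψ, pψ, Hψ, C, hψ, hC, hψ01, hψ1, hψ0, hpC, hHC, hp0⟩ := exists_bump n
  have hν0 : 0 < ν := by linarith
  obtain ⟨K, hK⟩ := exists_nat_gt ((2 * C) ^ n * S / ε0)
  have hK0 : (0:ℝ) < K := lt_of_le_of_lt (by positivity) hK
  have hK0' : 0 < K := by exact_mod_cast hK0
  have hKS : (2 * C) ^ n * S / K ≤ ε0 := by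
    rw [div_lt_iff₀ hε0] at hK
    rw [div_le_iff₀ hK0]
    linarith
  set C' : ℝ := n * ν * C + 1 with hC'
  have hC'0 : 0 < C' := by positivity
  set δ : ℝ := ε0 / ((2 * C') ^ (n + 1) * (2 ^ K) ^ (n + 2)) with hδ
  have hδ0 : 0 < δ := by positivity
  refine ⟨δ, hδ0, ?_⟩
  intro z θ p H G x1 R t1 m k hz hR hm hk hkm hkS hpde hzm hcont hvol hX1
  obtain ⟨j, hjK, hj⟩ := shell_pigeon k x1 hR hS hkS K hK0'
  set ρ : ℝ := R / 2 ^ j with hρ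
  have hρ0 : 0 < ρ := by positivity
  have hρR : ρ ≤ R := div_le_self hR.le (one_le_pow₀ (by norm_num))
  have hRρ : R ≤ 2 ^ K * ρ := by
    have : (2:ℝ) ^ j ≤ 2 ^ K := pow_le_pow_right₀ (by norm_num) hjK.le
    have h2 : R = 2 ^ j * ρ := by rw [hρ]; field_simp
    rw [h2]
    gcongr
  have hρ2 : R / 2 ^ (j + 1) = ρ / 2 := by rw [hρ, pow_succ]; field_simp
  rw [hρ2] at hj
  -- the cylinder
  have hsub : closedBall x1 ρ ×ˢ Icc (t1 - ρ ^ 2) t1 ⊆ closedBall x1 R ×ˢ Icc (t1 - R ^ 2) t1 := by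
    refine Set.prod_mono (closedBall_subset_closedBall hρR) (Icc_subset_Icc_left ?_)
    have := pow_le_pow_left₀ hρ0.le hρR 2
    linarith
  have hΨ := (hψ.scale ρ⁻¹ x1).add_time (a := fun t => (t - t1) / ρ ^ 2 - 1) (a' := fun _ => 1 / ρ ^ 2)
    (fun t => (((hasDerivAt_id t).sub_const t1).div_const _).sub_const 1) continuous_const
  set b : En n × ℝ → ℝ := fun X => ψ (ρ⁻¹ • (X.1 - x1)) + ((X.2 - t1) / ρ ^ 2 - 1) with hb
  have hbc : Continuous b := by
    have := hΨ.cw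
    rwa [continuousOn_univ] at this
  set W : En n × ℝ → ℝ := fun X => max (posx G z X + m * b X) 0 with hW
  set GW : Set (En n × ℝ) := {X | X ∈ G ∧ 0 < min (z X) (z X + m * b X)} with hGW
  have hGWo : IsOpen GW := by
    have : ContinuousOn (fun X => min (z X) (z X + m * b X)) G :=
      hz.cw.inf (hz.cw.add (continuousOn_const.mul hbc.continuousOn))
    exact this.isOpen_inter_preimage hz.op isOpen_Ioi
  have hGWsub : GW ⊆ G := fun X hX => hX.1
  have hWeq : ∀ X ∈ GW, W X = z X + m * b X := by
    intro X hX
    have h1 := (lt_min_iff.1 hX.2)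
    simp only [hW]
    rw [posx_of hX.1 h1.1.le, max_eq_left h1.2.le]
  have hWC : C21 W _ _ _ GW := ((hz.mono hGWo hGWsub).add
    ((hΨ.const_smul m).mono hGWo (subset_univ _))).congr hWeq
  have hzm' : ∀ X ∈ closedBall x1 ρ ×ˢ Icc (t1 - ρ ^ 2) t1, posx G z X ≤ m := by
    intro X hX
    by_cases h : 0 < posx G z X
    · have h' := posx_pos h
      rw [h'.2.2]
      exact hzm X (hsub hX) h'.1
    · exact (not_lt.1 h).trans hm.le
  have hnorm : ∀ x : En n, ‖ρ⁻¹ • (x - x1)‖ = dist x x1 / ρ := by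
    intro x
    rw [norm_smul, norm_inv, Real.norm_of_nonneg hρ0.le, dist_eq_norm]
    field_simp
  have hb0 : ∀ X ∈ closedBall x1 ρ ×ˢ Icc (t1 - ρ ^ 2) t1, b X ≤ 0 := by
    intro X hX
    have h1 := (hψ01 (ρ⁻¹ • (X.1 - x1))).2
    have h2 : (X.2 - t1) / ρ ^ 2 ≤ 0 := div_nonpos_of_nonpos_of_nonneg (by linarith [hX.2.2]) (by positivity)
    simp only [hb]; linarith
  have hWpos : ∀ X ∈ closedBall x1 ρ ×ˢ Icc (t1 - ρ ^ 2) t1, 0 < W X → X ∈ GW := by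
    intro X hX h
    have h1 : 0 < posx G z X + m * b X := by
      by_contra hc
      simp only [hW] at h
      rw [max_eq_right (not_lt.1 hc)] at h
      exact lt_irrefl _ h
    have h2 := mul_nonpos_of_nonneg_of_nonpos hm.le (hb0 X hX)
    have h3 := posx_pos (show 0 < posx G z X by linarith)
    rw [h3.2.2] at h1
    exact ⟨h3.1, lt_min h3.2.1 h1⟩
  set sh : Set (En n) := ball x1 ρ \ ball x1 (ρ / 2) with hsh
  have hshm : MeasurableSet sh := measurableSet_ball.diff measurableSet_ball
  set ℓ : En n → ℝ := sh.indicator (fun x => m * C / ρ * k x) with hℓ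
  have key := habp W _ _ _ GW x1 ρ (t1 - ρ ^ 2) t1 (m / 2) (C' * m / ρ ^ 2) k ℓ hWC hρ0 (by positivity)
    (by positivity) hk ?_ hkm ((hkm.const_mul _).indicator hshm) ?_ ?_ hWpos ?_ ?_ ?_ ?_ ?_ ?_ (x1, t1) ?_
  · have hb1 : b (x1, t1) = 0 := by
      simp only [hb, sub_self, smul_zero, zero_div]
      rw [hψ1 0 (by simp)]; norm_num
    simp only [hW, hb1, mul_zero, add_zero] at key
    have h1 := le_max_left (posx G z (x1, t1)) 0
    have h2 : z (x1, t1) ≤ posx G z (x1, t1) := by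
      have e : posx G z (x1, t1) = max (z (x1, t1)) 0 := Set.indicator_of_mem hX1 _
      rw [e]; exact le_max_left _ _
    linarith
  · exact fun x => Set.indicator_nonneg (fun y _ => mul_nonneg (by positivity) (hk y)) x
  · exact ((hcont.mono hsub).add (continuousOn_const.mul hbc.continuousOn)).sup continuousOn_const
  · intro x hx
    have hX : (x, t1 - ρ ^ 2) ∈ closedBall x1 ρ ×ˢ Icc (t1 - ρ ^ 2) t1 :=
      ⟨hx, le_refl _, by nlinarith⟩
    have h1 := hzm' _ hX
    have h2 : b (x, t1 - ρ ^ 2) ≤ -1 := by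
      have h1 := (hψ01 (ρ⁻¹ • (x - x1))).2
      have : (t1 - ρ ^ 2 - t1) / ρ ^ 2 = -1 := by field_simp; ring
      simp only [hb, this]; linarith
    exact max_eq_right (by nlinarith)
  · intro X hX h
    by_contra hc
    have hd : ρ ≤ dist X.1 x1 := not_lt.1 hc
    have h0 : ψ (ρ⁻¹ • (X.1 - x1)) = 0 := hψ0 _ (by rw [hnorm, le_div_iff₀ hρ0]; linarith)
    have h2 : (X.2 - t1) / ρ ^ 2 ≤ 0 := div_nonpos_of_nonpos_of_nonneg (by linarith [hX.2.2]) (by positivity)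
    have hbm : b X ≤ -1 := by simp only [hb, h0]; linarith
    have h3 := hzm' X hX
    have : W X = 0 := max_eq_right (by nlinarith)
    linarith
  · exact fun X _ => le_max_right _ _
  · filter_upwards [hpde] with x hx t hxb ht hG _
    have hh : ((x, t) : En n × ℝ) ∈ closedBall x1 R ×ˢ Icc (t1 - R ^ 2) t1 :=
      hsub (mk_mem_prod (ball_subset_closedBall hxb) ht)
    obtain ⟨A, hA, hle⟩ := hx t (ball_subset_ball hρR hxb) hh.2
      (hGWsub hG) (lt_min_iff.1 hG.2).1
    refine ⟨A, hA, ?_⟩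
    simp only [trc_add, trc_smul]
    have e1 : |trc A (Hψ (ρ⁻¹ • (x - x1)))| ≤ n * (ν * C) := by
      refine (trc_abs_le _ _).trans ?_
      gcongr
      · exact hA.2
      · exact hHC _
    have e1' := (abs_le.1 e1).1
    have e2 := gl1_aux (τ := trc A (Hψ (ρ⁻¹ • (x - x1)))) (q := n * (ν * C)) hm hρ0 (by linarith)
    have e2' : C' * m / ρ ^ 2 = (n * (ν * C) + 1) * m / ρ ^ 2 := by rw [hC', mul_assoc]
    have e3 : k x * ‖p (x, t)‖ ≤ k x * ‖p (x, t) + m • ρ⁻¹ • pψ (ρ⁻¹ • (x - x1))‖ + ℓ x := by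
      by_cases hin : dist x x1 < ρ / 2
      · rw [hp0 _ (by rw [hnorm, div_lt_iff₀ hρ0]; linarith)]
        have : 0 ≤ ℓ x := Set.indicator_nonneg (fun y _ => mul_nonneg (by positivity) (hk y)) x
        simp only [smul_zero, add_zero]
        linarith
      · have hl : ℓ x = m * C / ρ * k x := Set.indicator_of_mem (show x ∈ sh from ⟨hxb, hin⟩) _
        rw [hl]
        have h6 : ‖p (x, t)‖ ≤ ‖p (x, t) + m • ρ⁻¹ • pψ (ρ⁻¹ • (x - x1))‖ + m * C / ρ := by
          have h7 := norm_sub_le (p (x, t) + m • ρ⁻¹ • pψ (ρ⁻¹ • (x - x1))) (m • ρ⁻¹ • pψ (ρ⁻¹ • (x - x1)))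
          rw [add_sub_cancel_right] at h7
          have h8 : ‖m • ρ⁻¹ • pψ (ρ⁻¹ • (x - x1))‖ ≤ m * C / ρ := by
            rw [norm_smul, norm_smul, norm_inv, Real.norm_of_nonneg hρ0.le, Real.norm_of_nonneg hm.le]
            rw [div_eq_mul_inv, mul_assoc, mul_comm C]
            gcongr
            exact hpC _
          linarith
        have h9 := mul_le_mul_of_nonneg_left h6 (hk x)
        rw [mul_add] at h9
        linarith
    rw [e2']
    generalize trc A (Hψ (ρ⁻¹ • (x - x1))) = τ at *
    generalize k x * ‖p (x, t) + m • ρ⁻¹ • pψ (ρ⁻¹ • (x - x1))‖ = kk at *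
    generalize trc A (H (x, t)) = τ' at *
    linarith
  · exact (mass_mono k (ball_subset_ball hρR)).trans hkS
  · have h1 : mass ℓ (ball x1 ρ) ≤ ENNReal.ofReal ((m * C / ρ) ^ n) * mass k sh := by
      unfold mass
      rw [← lintegral_const_mul' _ _ ENNReal.ofReal_ne_top, ← lintegral_indicator hshm,
        ← lintegral_indicator measurableSet_ball]
      refine lintegral_mono fun x => ?_
      by_cases hx : x ∈ sh
      · rw [Set.indicator_of_mem hx, Set.indicator_of_mem hx.1]
        have hl : ℓ x = m * C / ρ * k x := Set.indicator_of_mem hx _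
        rw [hl, mul_pow, ENNReal.ofReal_mul (by positivity)]
      · have hl : ℓ x = 0 := Set.indicator_of_notMem hx _
        have : (ball x1 ρ).indicator (fun x => ENNReal.ofReal (ℓ x ^ n)) x = 0 := by
          by_cases hx2 : x ∈ ball x1 ρ
          · rw [Set.indicator_of_mem hx2, hl]; simp [hn.ne']
          · rw [Set.indicator_of_notMem hx2]
        rw [this]; exact zero_le
    refine h1.trans ?_
    refine (mul_le_mul_right hj _).trans ?_
    rw [← ENNReal.ofReal_mul (by positivity)]
    refine ENNReal.ofReal_le_ofReal ?_
    have : (m * C / ρ) ^ n * (S / K) = (m / 2 / ρ) ^ n * ((2 * C) ^ n * S / K) := by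
      rw [show m * C / ρ = (m / 2 / ρ) * (2 * C) by field_simp, mul_pow]; ring
    rw [this, mul_comm ε0]
    gcongr
  · have hv : volume {X | X ∈ closedBall x1 ρ ×ˢ Icc (t1 - ρ ^ 2) t1 ∧ 0 < W X} ≤
        ENNReal.ofReal (δ * R ^ (n + 2)) := by
      refine (measure_mono ?_).trans hvol
      rintro X ⟨hX, h⟩
      have := hWpos X hX h
      exact ⟨hsub hX, this.1, (lt_min_iff.1 this.2).1⟩
    refine (mul_le_mul_right hv _).trans ?_
    rw [← ENNReal.ofReal_mul (by positivity)]
    refine ENNReal.ofReal_le_ofReal ?_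
    calc (C' * m / ρ ^ 2) ^ (n + 1) * (δ * R ^ (n + 2))
        ≤ (C' * m / ρ ^ 2) ^ (n + 1) * (δ * (2 ^ K * ρ) ^ (n + 2)) := by gcongr
      _ = ε0 * ((m / 2) ^ (n + 1) / ρ ^ n) := by
        rw [hδ]
        simp only [div_pow, mul_pow]
        rw [show (ρ ^ 2) ^ (n + 1) = ρ ^ n * ρ ^ (n + 2) by ring]
        field_simp
  · exact ⟨mem_closedBall_self hρ0.le, by nlinarith, le_refl _⟩

/-- nonnegative solutions of uniformly parabolic equations, drift bounded by `k` -/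
structure Sol {n : ℕ} (ν S T : ℝ) (Ω : Set (En n)) (u θ : En n × ℝ → ℝ) (p : En n × ℝ → En n)
    (H : En n × ℝ → (En n →L[ℝ] En n)) (k : En n → ℝ) : Prop where
  c21 : C21 u θ p H (Ω ×ˢ Ioo 0 T)
  op : IsOpen Ω
  nn : ∀ X ∈ Ω ×ˢ Ioo (0:ℝ) T, 0 ≤ u X
  km : Measurable k
  k0 : ∀ x, 0 ≤ k x
  ms : mass k univ ≤ ENNReal.ofReal S
  pde : ∀ᵐ x, ∀ t, (x, t) ∈ Ω ×ˢ Ioo (0:ℝ) T → ∃ A, Adm ν A ∧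
      |θ (x, t) - trc A (H (x, t))| ≤ k x * ‖p (x, t)‖

theorem Sol.smul {n : ℕ} {ν S T : ℝ} {Ω : Set (En n)} {u θ : En n × ℝ → ℝ} {p : En n × ℝ → En n}
    {H : En n × ℝ → (En n →L[ℝ] En n)} {k : En n → ℝ} (h : Sol ν S T Ω u θ p H k) {c : ℝ} (hc : 0 < c) :
    Sol ν S T Ω (fun X => c * u X) (fun X => c * θ X) (fun X => c • p X) (fun X => c • H X) k := by
  refine ⟨h.c21.const_smul c, h.op, fun X hX => mul_nonneg hc.le (h.nn X hX), h.km, h.k0, h.ms, ?_⟩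
  filter_upwards [h.pde] with x hx t ht
  obtain ⟨A, hA, hle⟩ := hx t ht
  refine ⟨A, hA, ?_⟩
  rw [trc_smul, ← mul_sub, abs_mul, norm_smul, Real.norm_eq_abs]
  calc |c| * |θ (x, t) - trc A (H (x, t))| ≤ |c| * (k x * ‖p (x, t)‖) := by gcongr
    _ = _ := by ring

theorem Sol.mass_le {n : ℕ} {ν S T : ℝ} {Ω : Set (En n)} {u θ : En n × ℝ → ℝ} {p : En n × ℝ → En n}
    {H : En n × ℝ → (En n →L[ℝ] En n)} {k : En n → ℝ} (h : Sol ν S T Ω u θ p H k) (U : Set (En n)) :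
    mass k U ≤ ENNReal.ofReal S := (mass_mono k (subset_univ U)).trans h.ms

/-- dual growth lemma: if `u ≥ a` on most of an interior cylinder, then `u ≥ a/2` at its top -/
theorem gl1_dual {n : ℕ} (hn : 0 < n) {ν : ℝ} (hν : 1 ≤ ν) (S : ℝ) (hS : 0 ≤ S) :
    ∃ δ : ℝ, 0 < δ ∧ ∀ (T : ℝ) (Ω : Set (En n)) (u θ : En n × ℝ → ℝ) (p : En n × ℝ → En n)
    (H : En n × ℝ → (En n →L[ℝ] En n)) (k : En n → ℝ) (x1 : En n) (R t1 a : ℝ),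
    Sol ν S T Ω u θ p H k → 0 < R → 0 < a →
    closedBall x1 R ⊆ Ω → 0 < t1 - R ^ 2 → t1 < T →
    volume {X | X ∈ closedBall x1 R ×ˢ Icc (t1 - R ^ 2) t1 ∧ u X < a} ≤
      ENNReal.ofReal (δ * R ^ (n + 2)) → a / 2 ≤ u (x1, t1) := by
  obtain ⟨δ, hδ, h⟩ := gl1 hn hν S hS
  refine ⟨δ, hδ, ?_⟩
  intro T Ω u θ p H k x1 R t1 a hu hR ha hb h0 h1 hv
  have hsub : closedBall x1 R ×ˢ Icc (t1 - R ^ 2) t1 ⊆ Ω ×ˢ Ioo 0 T :=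
    Set.prod_mono hb fun t ht => ⟨by linarith [ht.1], by linarith [ht.2]⟩
  have hz := (hu.c21.const_smul (-1)).const_add a
  have hX1 : ((x1, t1) : En n × ℝ) ∈ closedBall x1 R ×ˢ Icc (t1 - R ^ 2) t1 :=
    ⟨mem_closedBall_self hR.le, by nlinarith, le_refl _⟩
  have key := h _ _ _ _ _ x1 R t1 a k hz hR ha hu.k0 hu.km (hu.mass_le _) ?_ ?_ ?_ ?_ (hsub hX1)
  · linarith
  · filter_upwards [hu.pde] with x hx t _ _ hG _
    obtain ⟨A, hA, hle⟩ := hx t hG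
    refine ⟨A, hA, ?_⟩
    rw [trc_smul, norm_smul, norm_neg, norm_one, one_mul]
    have := (abs_le.1 hle).1
    linarith
  · intro X hX hG
    have := hu.nn X hG
    linarith
  · have : ContinuousOn (fun X => max (a + -1 * u X) 0) (closedBall x1 R ×ˢ Icc (t1 - R ^ 2) t1) :=
      (hz.cw.mono hsub).sup continuousOn_const
    refine this.congr fun X hX => ?_
    exact Set.indicator_of_mem (hsub hX) _
  · refine (measure_mono ?_).trans hv
    rintro X ⟨hX, _, h2⟩
    exact ⟨hX, by linarith⟩

theorem trc_rank1 {n : ℕ} (A : En n →L[ℝ] En n) (v : En n) :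
    trc A ((innerSL ℝ v).smulRight v) = ⟪A v, v⟫ := by
  rw [trc_eq_sum (EuclideanSpace.basisFun (Fin n) ℝ)]
  rw [← OrthonormalBasis.sum_inner_mul_inner (EuclideanSpace.basisFun (Fin n) ℝ) (A v) v]
  refine Finset.sum_congr rfl fun i _ => ?_
  simp [real_inner_comm, mul_comm, inner_smul_right]

theorem C2x.barrier {n : ℕ} {s : En n → ℝ} {ps : En n → En n} {Hs : En n → (En n →L[ℝ] En n)}
    (h : C2x s ps Hs) {a a' e e' : ℝ → ℝ} (ha : ∀ t, HasDerivAt a (a' t) t) (ha' : Continuous a')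
    (he : ∀ t, HasDerivAt e (e' t) t) (he' : Continuous e') :
    C21 (fun X => e X.2 * (a X.2 - s X.1) ^ 2)
      (fun X => e' X.2 * (a X.2 - s X.1) ^ 2 + e X.2 * (2 * (a X.2 - s X.1) * a' X.2))
      (fun X => (-(2 * e X.2 * (a X.2 - s X.1))) • ps X.1)
      (fun X => (-(2 * e X.2 * (a X.2 - s X.1))) • Hs X.1 +
        (2 * e X.2) • (innerSL ℝ (ps X.1)).smulRight (ps X.1)) univ := by
  have hac : Continuous a := continuous_iff_continuousAt.2 fun x => (ha x).continuousAt
  have hec : Continuous e := continuous_iff_continuousAt.2 fun x => (he x).continuousAt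
  have h1 := h.cs
  have h2 := h.cp
  have h3 := h.cH
  refine ⟨isOpen_univ, fun X _ => ?_, fun X _ => ?_, fun X _ => ?_, ?_, ?_, ?_, ?_⟩
  · have := (he X.2).mul (((ha X.2).sub_const (s X.1)).pow 2)
    simp only [Nat.cast_ofNat, Nat.add_one_sub_one, pow_one] at this
    exact this
  · have := (((h.d1 X.1).const_sub (a X.2)).pow 2).const_mul (e X.2)
    have e1 : innerSL ℝ ((-(2 * e X.2 * (a X.2 - s X.1))) • ps X.1) =
        e X.2 • ((2 * (a X.2 - s X.1) ^ (2 - 1)) • -(innerSL ℝ (ps X.1))) := by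
      ext v
      simp [inner_smul_left]
      ring
    rw [e1]
    simp only [nsmul_eq_mul] at this
    exact this
  · have hc : HasFDerivAt (fun x => -(2 * e X.2 * (a X.2 - s x)))
        ((2 * e X.2) • innerSL ℝ (ps X.1)) X.1 := by
      have := (((h.d1 X.1).const_sub (a X.2)).const_mul (2 * e X.2)).neg
      have e1 : (2 * e X.2) • innerSL ℝ (ps X.1) = -((2 * e X.2) • -(innerSL ℝ (ps X.1))) := by
        ext v; simp
      rw [e1]; exact this
    have := hc.smul (h.d2 X.1)
    have e1 : (-(2 * e X.2 * (a X.2 - s X.1))) • Hs X.1 +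
        (2 * e X.2) • (innerSL ℝ (ps X.1)).smulRight (ps X.1) =
        (-(2 * e X.2 * (a X.2 - s X.1))) • Hs X.1 +
        ((2 * e X.2) • innerSL ℝ (ps X.1)).smulRight (ps X.1) := by
      congr 1
      ext1 v; simp [mul_smul]
    rw [e1]; exact this
  · exact Continuous.continuousOn (by fun_prop)
  · exact Continuous.continuousOn (by fun_prop)
  · exact Continuous.continuousOn (by fun_prop)
  · refine Continuous.continuousOn ?_
    have h4 : Continuous fun X : En n × ℝ => (innerSL ℝ (ps X.1)).smulRight (ps X.1) := by
      have h5 : Continuous fun X : En n × ℝ => innerSL ℝ (ps X.1) := by fun_prop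
      exact ((ContinuousLinearMap.smulRightL ℝ (En n) (En n)).continuous.comp h5).clm_apply
        (h2.comp continuous_fst)
    fun_prop

theorem barrier_alg {g σ a0 a1 c B C1 l q L : ℝ} (hg : 0 < g) (hgL : g ≤ L) (hσ : 0 ≤ σ) (ha0 : 0 < a0)
    (hgs : a0 ≤ g + σ) (hc : 0 < c) (hB : c * σ ≤ B) (ha1 : 0 ≤ a1) (hC1 : 0 ≤ C1) (hl : 0 ≤ l)
    (hq : 4 * (a1 + C1) / a0 + (a1 + C1) ^ 2 / (c * a0) ≤ q) :
    - q * g ^ 2 + 2 * g * a1 + 2 * g * (C1 + l) - 2 * B ≤ 2 * L * l := by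
  set C2 := a1 + C1 with hC2
  have hC20 : 0 ≤ C2 := by positivity
  have h1 : 2 * g * l ≤ 2 * L * l := by gcongr
  have h3 : 0 ≤ C2 ^ 2 / (c * a0) := by positivity
  have h4 : 0 ≤ 4 * C2 / a0 := by positivity
  have h2 : - q * g ^ 2 + 2 * g * C2 - 2 * B ≤ 0 := by
    rcases le_total (a0 / 2) σ with h | h
    · have e1 : C2 ^ 2 / (c * a0) * g ^ 2 ≤ q * g ^ 2 := by gcongr; linarith
      have e2 : c * a0 ≤ 2 * B := by nlinarith
      have e3 : 2 * g * C2 ≤ C2 ^ 2 / (c * a0) * g ^ 2 + c * a0 := by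
        have : C2 ^ 2 / (c * a0) * g ^ 2 + c * a0 - 2 * g * C2 = (C2 * g - c * a0) ^ 2 / (c * a0) := by
          field_simp; ring
        have : 0 ≤ (C2 * g - c * a0) ^ 2 / (c * a0) := by positivity
        linarith
      linarith
    · have e1 : 4 * C2 / a0 * g ^ 2 ≤ q * g ^ 2 := by gcongr; linarith
      have e2 : 0 ≤ B := le_trans (by positivity) hB
      have e3 : 2 * g * C2 ≤ 4 * C2 / a0 * g ^ 2 := by
        have : 4 * C2 / a0 * g ^ 2 = 4 * C2 * g * (g / a0) := by field_simp
        rw [this]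
        have : 1 / 2 ≤ g / a0 := by rw [le_div_iff₀ ha0]; linarith
        have h5 : 0 ≤ 4 * C2 * g := by positivity
        nlinarith
      linarith
  have : 2 * g * a1 + 2 * g * (C1 + l) = 2 * g * C2 + 2 * g * l := by rw [hC2]; ring
  linarith

set_option maxHeartbeats 1600000 in
theorem step_core {n : ℕ} (hn : 0 < n) {ν : ℝ} (hν : 1 ≤ ν) (S : ℝ) (hS : 0 ≤ S) (Λ C1 : ℝ)
    (hΛ : 1 ≤ Λ) (hC1 : 0 ≤ C1) :
    ∃ κ c : ℝ, 0 < κ ∧ 0 < c ∧ ∀ (T : ℝ) (Ω : Set (En n)) (u θ : En n × ℝ → ℝ) (p : En n × ℝ → En n)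
    (H : En n × ℝ → (En n →L[ℝ] En n)) (k : En n → ℝ) (x0 : En n) (ρ t0 : ℝ) (σ : En n → ℝ)
    (pσ : En n → En n) (Hσ : En n → (En n →L[ℝ] En n)) (ℓ0 : En n → ℝ),
    Sol ν S T Ω u θ p H k → 0 < ρ → closedBall x0 (4 * Λ ^ 2 * ρ) ⊆ Ω → 0 < t0 → t0 + ρ ^ 2 < T →
    (∀ x ∈ ball x0 ρ, 1 ≤ u (x, t0)) → C2x σ pσ Hσ → Measurable ℓ0 → (∀ x, 0 ≤ ℓ0 x) →
    (∀ x, ‖x - x0‖ ^ 2 ≤ Λ ^ 2 * ρ ^ 2 * σ x) → (∀ x, ρ ^ 2 * σ x ≤ Λ ^ 2 * ‖x - x0‖ ^ 2) →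
    (∀ x, 4 * σ x ≤ Λ ^ 2 * ρ ^ 2 * ‖pσ x‖ ^ 2) →
    (∀ᵐ x, x ∈ ball x0 (4 * Λ ^ 2 * ρ) → ∀ A, Adm ν A →
      ρ ^ 2 * (trc A (Hσ x) + k x * ‖pσ x‖) ≤ C1 + ℓ0 x) →
    mass ℓ0 (ball x0 (4 * Λ ^ 2 * ρ)) ≤ ENNReal.ofReal (κ * ρ ^ n) →
    ∀ x ∈ ball x0 (2 * ρ), c ≤ u (x, t0 + ρ ^ 2) := by
  obtain ⟨ε0, hε0, habp⟩ := abp hn hν S hS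
  have hν0 : 0 < ν := by linarith
  have hΛ0 : 0 < Λ := by linarith
  have hΛ2 : 1 ≤ Λ ^ 2 := one_le_pow₀ hΛ
  set a0 : ℝ := 1 / Λ ^ 2 with ha0
  have ha00 : 0 < a0 := by positivity
  have ha01 : a0 ≤ 1 := by rw [ha0, div_le_one (by positivity)]; exact hΛ2
  set a1 : ℝ := 9 * Λ ^ 2 - a0 with ha1
  have ha10 : 0 ≤ a1 := by linarith
  set c0 : ℝ := 4 / (ν * Λ ^ 2) with hc0
  have hc00 : 0 < c0 := by positivity
  set q : ℝ := 4 * (a1 + C1) / a0 + (a1 + C1) ^ 2 / (c0 * a0) with hq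
  have hq0 : 0 ≤ q := by positivity
  set M : ℝ := Real.exp (-q) with hM
  have hM0 : 0 < M := Real.exp_pos _
  set κ : ℝ := ε0 * (M / (72 * Λ ^ 4)) ^ n with hκ
  refine ⟨κ, M, by positivity, hM0, ?_⟩
  intro T Ω u θ p H k x0 ρ t0 σ pσ Hσ ℓ0 hu hρ hb ht0 htT hu1 hσC hℓm hℓ0 hσl hσu hσp hop hmass x hx
  set R : ℝ := 4 * Λ ^ 2 * ρ with hR
  have hR0 : 0 < R := by positivity
  set a : ℝ → ℝ := fun t => a0 + a1 * ((t - t0) / ρ ^ 2) with ha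
  set e : ℝ → ℝ := fun t => Real.exp (-q * ((t - t0) / ρ ^ 2)) with he
  have hda : ∀ t, HasDerivAt a (a1 * (1 / ρ ^ 2)) t := fun t =>
    ((((hasDerivAt_id t).sub_const t0).div_const _).const_mul a1).const_add a0
  have hde : ∀ t, HasDerivAt e (e t * (-q * (1 / ρ ^ 2))) t := fun t =>
    ((((hasDerivAt_id t).sub_const t0).div_const _).const_mul (-q)).exp
  have hec : Continuous e := continuous_iff_continuousAt.2 fun x => (hde x).continuousAt
  have hac : Continuous a := continuous_iff_continuousAt.2 fun x => (hda x).continuousAt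
  have hψ := hσC.barrier hda continuous_const hde (by fun_prop)
  have hσc := hσC.cs
  have he0 : ∀ t, 0 < e t := fun t => Real.exp_pos _
  set W : En n × ℝ → ℝ := fun X => max (e X.2 * (max (a X.2 - σ X.1) 0) ^ 2 - u X) 0 with hW
  set G : Set (En n × ℝ) := {X | X ∈ Ω ×ˢ Ioo 0 T ∧
    0 < min (a X.2 - σ X.1) (e X.2 * (a X.2 - σ X.1) ^ 2 - u X)} with hG
  have hGo : IsOpen G := by
    have : ContinuousOn (fun X : En n × ℝ => min (a X.2 - σ X.1) (e X.2 * (a X.2 - σ X.1) ^ 2 - u X))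
        (Ω ×ˢ Ioo 0 T) := by
      have h1 : Continuous fun X : En n × ℝ => a X.2 - σ X.1 := by fun_prop
      have h2 : Continuous fun X : En n × ℝ => e X.2 * (a X.2 - σ X.1) ^ 2 := by fun_prop
      exact h1.continuousOn.inf (h2.continuousOn.sub hu.c21.cw)
    exact this.isOpen_inter_preimage hu.c21.op isOpen_Ioi
  have hGsub : G ⊆ Ω ×ˢ Ioo 0 T := fun X hX => hX.1
  have hWeq : ∀ X ∈ G, W X = e X.2 * (a X.2 - σ X.1) ^ 2 + -1 * u X := by
    intro X hX
    have h1 := lt_min_iff.1 hX.2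
    simp only [hW]
    rw [max_eq_left h1.1.le, max_eq_left h1.2.le]
    ring
  have hWC : C21 W _ _ _ G := ((hψ.mono hGo (subset_univ _)).add
    ((hu.c21.const_smul (-1)).mono hGo hGsub)).congr hWeq
  have hsub : closedBall x0 R ×ˢ Icc t0 (t0 + ρ ^ 2) ⊆ Ω ×ˢ Ioo 0 T :=
    Set.prod_mono hb fun t ht => ⟨by linarith [ht.1], by linarith [ht.2]⟩
  have hWpos : ∀ X ∈ closedBall x0 R ×ˢ Icc t0 (t0 + ρ ^ 2), 0 < W X → X ∈ G := by
    intro X hX h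
    have hu0 := hu.nn X (hsub hX)
    have h1 : 0 < e X.2 * (max (a X.2 - σ X.1) 0) ^ 2 - u X := by
      by_contra hc
      simp only [hW] at h
      rw [max_eq_right (not_lt.1 hc)] at h
      exact lt_irrefl _ h
    have h2 : 0 < a X.2 - σ X.1 := by
      by_contra hc
      rw [max_eq_right (not_lt.1 hc)] at h1
      simp at h1
      linarith
    rw [max_eq_left h2.le] at h1
    exact ⟨hsub hX, lt_min h2 h1⟩
  have hσ0 : ∀ x, 0 ≤ σ x := by
    intro x
    by_contra hc
    have h1 := hσl x
    have h2 : Λ ^ 2 * ρ ^ 2 * σ x < 0 := mul_neg_of_pos_of_neg (by positivity) (not_le.1 hc)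
    have := sq_nonneg ‖x - x0‖
    linarith
  have hτ : ∀ t ∈ Icc t0 (t0 + ρ ^ 2), 0 ≤ (t - t0) / ρ ^ 2 ∧ (t - t0) / ρ ^ 2 ≤ 1 := by
    intro t ht
    have : 0 < ρ ^ 2 := by positivity
    exact ⟨div_nonneg (by linarith [ht.1]) this.le, (div_le_one this).2 (by linarith [ht.2])⟩
  have haL : ∀ t ∈ Icc t0 (t0 + ρ ^ 2), a0 ≤ a t ∧ a t ≤ 9 * Λ ^ 2 := by
    intro t ht
    have h1 := hτ t ht
    have h2 : 0 ≤ a1 * ((t - t0) / ρ ^ 2) := mul_nonneg ha10 h1.1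
    have h3 : a1 * ((t - t0) / ρ ^ 2) ≤ a1 := mul_le_of_le_one_right ha10 h1.2
    simp only [ha]
    exact ⟨by linarith, by linarith⟩
  have hxx : x ∈ closedBall x0 R := by
    have : dist x x0 < 2 * ρ := hx
    show dist x x0 ≤ R
    nlinarith
  have htt : t0 + ρ ^ 2 ∈ Icc t0 (t0 + ρ ^ 2) := ⟨by nlinarith, le_refl _⟩
  have key := habp W _ _ _ G x0 R t0 (t0 + ρ ^ 2) M 0 k (fun x => 18 * Λ ^ 2 / ρ ^ 2 * ℓ0 x) hWC hR0 hM0 (le_refl _)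
    hu.k0 ?_ hu.km (hℓm.const_mul _) ?_ ?_ hWpos ?_ ?_ ?_ (hu.mass_le _) ?_ ?_ (x, t0 + ρ ^ 2) (mk_mem_prod hxx htt)
  · have h1 := le_max_left (e (t0 + ρ ^ 2) * (max (a (t0 + ρ ^ 2) - σ x) 0) ^ 2 - u (x, t0 + ρ ^ 2)) 0
    have h2 : e (t0 + ρ ^ 2) = M := by
      simp only [he, hM]
      congr 1
      field_simp
      ring
    have h3 : a (t0 + ρ ^ 2) = 9 * Λ ^ 2 := by
      simp only [ha]
      have : (t0 + ρ ^ 2 - t0) / ρ ^ 2 = 1 := by field_simp; ring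
      rw [this, ha1]; ring
    have h4 : σ x ≤ 4 * Λ ^ 2 := by
      have h5 := hσu x
      have h6 : ‖x - x0‖ < 2 * ρ := by rw [← dist_eq_norm]; exact hx
      have h7 : ‖x - x0‖ ^ 2 ≤ (2 * ρ) ^ 2 := by gcongr
      have h8 : Λ ^ 2 * ‖x - x0‖ ^ 2 ≤ Λ ^ 2 * (2 * ρ) ^ 2 := by gcongr
      have h9 : ρ ^ 2 * σ x ≤ ρ ^ 2 * (4 * Λ ^ 2) := by linarith
      exact le_of_mul_le_mul_left h9 (by positivity)
    rw [h2, h3] at h1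
    have h5 : 5 ≤ max (9 * Λ ^ 2 - σ x) 0 := le_max_of_le_left (by nlinarith)
    have h6 : (5:ℝ) ^ 2 ≤ (max (9 * Λ ^ 2 - σ x) 0) ^ 2 := by gcongr
    have h7 : M * 5 ^ 2 ≤ M * (max (9 * Λ ^ 2 - σ x) 0) ^ 2 := by gcongr
    have h8 : W (x, t0 + ρ ^ 2) = max (e (t0 + ρ ^ 2) * (max (a (t0 + ρ ^ 2) - σ x) 0) ^ 2 - u (x, t0 + ρ ^ 2)) 0 := rfl
    rw [h8, h2, h3] at key
    linarith
  · exact fun x => mul_nonneg (by positivity) (hℓ0 x)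
  · have h1 : Continuous fun X : En n × ℝ => e X.2 * (max (a X.2 - σ X.1) 0) ^ 2 := by fun_prop
    exact (h1.continuousOn.sub (hu.c21.cw.mono hsub)).sup continuousOn_const
  · intro y hy
    have ht : t0 ∈ Icc t0 (t0 + ρ ^ 2) := ⟨le_refl _, by nlinarith⟩
    refine max_eq_right ?_
    have e1 : a t0 = a0 := by simp [ha]
    have e2 : e t0 = 1 := by simp [he]
    simp only [e1, e2, one_mul]
    have hu0 := hu.nn (y, t0) (hsub (mk_mem_prod hy ht))
    rcases le_or_gt (a0 - σ y) 0 with h | h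
    · rw [max_eq_right h]; simp; exact hu0
    · rw [max_eq_left h.le]
      have h1 := hσl y
      have h2 : ‖y - x0‖ ^ 2 < ρ ^ 2 := by
        have h3 : Λ ^ 2 * ρ ^ 2 * σ y < Λ ^ 2 * ρ ^ 2 * a0 := by
          have : σ y < a0 := by linarith
          gcongr
        have : Λ ^ 2 * ρ ^ 2 * a0 = ρ ^ 2 := by rw [ha0]; field_simp
        linarith
      have h3 : ‖y - x0‖ < ρ := lt_of_pow_lt_pow_left₀ 2 hρ.le h2
      have h4 := hu1 y (by rw [mem_ball, dist_eq_norm]; exact h3)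
      have h5 := hσ0 y
      nlinarith
  · intro X hX h
    have h1 := (lt_min_iff.1 (hWpos X hX h).2).1
    have h2 := (haL X.2 hX.2).2
    have h3 := hσl X.1
    have h4 : ‖X.1 - x0‖ ^ 2 < R ^ 2 := by
      have h5 : Λ ^ 2 * ρ ^ 2 * σ X.1 < Λ ^ 2 * ρ ^ 2 * (9 * Λ ^ 2) := by
        have : σ X.1 < 9 * Λ ^ 2 := by linarith
        gcongr
      have h6 : Λ ^ 2 * ρ ^ 2 * (9 * Λ ^ 2) ≤ R ^ 2 := by
        rw [hR]
        have : 0 ≤ Λ ^ 4 * ρ ^ 2 := by positivity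
        nlinarith
      linarith
    rw [mem_ball, dist_eq_norm]
    exact lt_of_pow_lt_pow_left₀ 2 hR0.le h4
  · exact fun X _ => le_max_right _ _
  · filter_upwards [hu.pde, hop] with y hy1 hy2 t hyb ht hyG _
    obtain ⟨A, hA, hle⟩ := hy1 t (hGsub hyG)
    refine ⟨A, hA, ?_⟩
    have hle' := (abs_le.1 hle).1
    have h2 := hy2 hyb A hA
    have h1 := lt_min_iff.1 hyG.2
    have h3 := (haL t ht)
    have hB : c0 * σ y ≤ ρ ^ 2 * ⟪A (pσ y), pσ y⟫ := by
      have e1 := hA.1 (pσ y)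
      have e2 := hσp y
      calc c0 * σ y = ν⁻¹ / Λ ^ 2 * (4 * σ y) := by rw [hc0]; field_simp
        _ ≤ ν⁻¹ / Λ ^ 2 * (Λ ^ 2 * ρ ^ 2 * ‖pσ y‖ ^ 2) := by gcongr
        _ = ρ ^ 2 * (ν⁻¹ * ‖pσ y‖ ^ 2) := by field_simp
        _ ≤ _ := by gcongr
    have halg := barrier_alg (g := a t - σ y) (σ := σ y) (a0 := a0) (a1 := a1) (c := c0)
      (B := ρ ^ 2 * ⟪A (pσ y), pσ y⟫) (C1 := C1) (l := ℓ0 y) (q := q) (L := 9 * Λ ^ 2) h1.1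
      (by linarith [h3.2, hσ0 y]) (hσ0 y) ha00 (by linarith [h3.1]) hc00 hB ha10 hC1 (hℓ0 y) (le_refl _)
    simp only [trc_add, trc_smul, trc_rank1]
    have hg := h1.1
    have het := he0 t
    have het1 : e t ≤ 1 := by
      simp only [he]
      rw [Real.exp_le_one_iff]
      have := (hτ t ht).1
      nlinarith
    have hkp : k y * ‖p (y, t)‖ ≤ k y * ‖(-(2 * e t * (a t - σ y))) • pσ y + (-1:ℝ) • p (y, t)‖ +
        2 * e t * (a t - σ y) * (k y * ‖pσ y‖) := by
      have e1 : ‖p (y, t)‖ ≤ ‖(-(2 * e t * (a t - σ y))) • pσ y + (-1:ℝ) • p (y, t)‖ +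
          2 * e t * (a t - σ y) * ‖pσ y‖ := by
        have e2 : p (y, t) = -((-(2 * e t * (a t - σ y))) • pσ y + (-1:ℝ) • p (y, t)) +
          (-(2 * e t * (a t - σ y))) • pσ y := by module
        have e3 := norm_add_le (-((-(2 * e t * (a t - σ y))) • pσ y + (-1:ℝ) • p (y, t)))
          ((-(2 * e t * (a t - σ y))) • pσ y)
        rw [← e2, norm_neg, norm_smul, norm_neg, Real.norm_of_nonneg (by positivity)] at e3
        exact e3
      have e2 := mul_le_mul_of_nonneg_left e1 (hu.k0 y)
      linarith
    have hfin : e t * (-q * (1 / ρ ^ 2)) * (a t - σ y) ^ 2 + e t * (2 * (a t - σ y) * (a1 * (1 / ρ ^ 2)))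
        + 2 * e t * (a t - σ y) * (trc A (Hσ y) + k y * ‖pσ y‖) - 2 * e t * ⟪A (pσ y), pσ y⟫
        ≤ 18 * Λ ^ 2 / ρ ^ 2 * ℓ0 y := by
      have e1 : e t * (-q * (1 / ρ ^ 2)) * (a t - σ y) ^ 2 + e t * (2 * (a t - σ y) * (a1 * (1 / ρ ^ 2)))
        + 2 * e t * (a t - σ y) * (trc A (Hσ y) + k y * ‖pσ y‖) - 2 * e t * ⟪A (pσ y), pσ y⟫ =
        e t / ρ ^ 2 * (-q * (a t - σ y) ^ 2 + 2 * (a t - σ y) * a1 + 2 * (a t - σ y) *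
          (ρ ^ 2 * (trc A (Hσ y) + k y * ‖pσ y‖)) - 2 * (ρ ^ 2 * ⟪A (pσ y), pσ y⟫)) := by
        field_simp
      have e2 : 2 * (a t - σ y) * (ρ ^ 2 * (trc A (Hσ y) + k y * ‖pσ y‖)) ≤ 2 * (a t - σ y) * (C1 + ℓ0 y) := by
        gcongr
      rw [e1]
      have hl := hℓ0 y
      calc _ ≤ e t / ρ ^ 2 * (2 * (9 * Λ ^ 2) * ℓ0 y) := by gcongr; linarith
        _ ≤ 1 / ρ ^ 2 * (2 * (9 * Λ ^ 2) * ℓ0 y) := by gcongr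
        _ = _ := by ring
    linarith
  · unfold mass at hmass ⊢
    have : ∀ x, ENNReal.ofReal ((18 * Λ ^ 2 / ρ ^ 2 * ℓ0 x) ^ n) =
        ENNReal.ofReal ((18 * Λ ^ 2 / ρ ^ 2) ^ n) * ENNReal.ofReal (ℓ0 x ^ n) := by
      intro x
      rw [mul_pow, ENNReal.ofReal_mul (by positivity)]
    simp only [this]
    rw [lintegral_const_mul' _ _ ENNReal.ofReal_ne_top]
    refine (mul_le_mul_right hmass _).trans ?_
    rw [← ENNReal.ofReal_mul (by positivity)]
    refine ENNReal.ofReal_le_ofReal (le_of_eq ?_)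
    rw [hκ, hR, show (18 * Λ ^ 2 / ρ ^ 2) ^ n * (ε0 * (M / (72 * Λ ^ 4)) ^ n * ρ ^ n) =
      ε0 * ((18 * Λ ^ 2 / ρ ^ 2) * (M / (72 * Λ ^ 4)) * ρ) ^ n by rw [mul_pow, mul_pow]; ring]
    congr 2
    field_simp
    ring
  · simp

theorem C2x.ofLine {n : ℕ} {h h' h'' : ℝ → ℝ} (d1 : ∀ y, HasDerivAt h (h' y) y)
    (d2 : ∀ y, HasDerivAt h' (h'' y) y) (hc : Continuous h'') (e x0 : En n) :
    C2x (fun x => h ⟪e, x - x0⟫) (fun x => h' ⟪e, x - x0⟫ • e)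
      (fun x => h'' ⟪e, x - x0⟫ • (innerSL ℝ e).smulRight e) := by
  have hl : ∀ x : En n, HasFDerivAt (fun x => ⟪e, x - x0⟫) (innerSL ℝ e) x := fun x =>
    (innerSL ℝ e).hasFDerivAt.comp x ((hasFDerivAt_id x).sub_const x0)
  refine ⟨fun x => ?_, fun x => ?_, by fun_prop⟩
  · have := (d1 _).comp_hasFDerivAt x (hl x)
    rw [map_smul]
    exact this
  · have := ((d2 _).comp_hasFDerivAt x (hl x)).smul_const e
    have e1 : h'' ⟪e, x - x0⟫ • (innerSL ℝ e).smulRight e = (h'' ⟪e, x - x0⟫ • (innerSL ℝ e)).smulRight e := by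
      ext1 v; simp [mul_smul]
    rw [e1]
    exact this

theorem C2x.sq {n : ℕ} : C2x (fun x : En n => ‖x‖ ^ 2) (fun x => (2:ℝ) • x)
    (fun _ => (2:ℝ) • ContinuousLinearMap.id ℝ (En n)) := by
  refine ⟨fun x => ?_, fun x => ?_, continuous_const⟩
  · have := (hasStrictFDerivAt_norm_sq x).hasFDerivAt
    have e : innerSL ℝ ((2:ℝ) • x) = 2 • innerSL ℝ x := by
      ext v; simp [inner_smul_left]
    rw [e]; exact this
  · exact (hasFDerivAt_id x).const_smul (2:ℝ)

theorem mass_ofReal_mul {n : ℕ} (k : En n → ℝ) (U : Set (En n)) {c : ℝ} (hc : 0 ≤ c) :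
    mass (fun x => c * k x) U = ENNReal.ofReal (c ^ n) * mass k U := by
  unfold mass
  rw [← lintegral_const_mul' _ _ ENNReal.ofReal_ne_top]
  refine lintegral_congr fun x => ?_
  rw [mul_pow, ENNReal.ofReal_mul (by positivity)]

/-- conclusion of the basic step -/
def StepProp (n : ℕ) (ν S K κ c : ℝ) : Prop :=
  ∀ (T : ℝ) (Ω : Set (En n)) (u θ : En n × ℝ → ℝ) (p : En n × ℝ → En n)
    (H : En n × ℝ → (En n →L[ℝ] En n)) (k : En n → ℝ) (x0 : En n) (ρ t0 : ℝ),
    Sol ν S T Ω u θ p H k → 0 < ρ → closedBall x0 (K * ρ) ⊆ Ω → 0 < t0 → t0 + ρ ^ 2 < T →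
    mass k (ball x0 (K * ρ)) ≤ ENNReal.ofReal κ → (∀ x ∈ ball x0 ρ, 1 ≤ u (x, t0)) →
    ∀ x ∈ ball x0 (2 * ρ), c ≤ u (x, t0 + ρ ^ 2)

theorem step_ge2 {n : ℕ} (hn : 0 < n) {ν : ℝ} (hν : 1 ≤ ν) (S : ℝ) (hS : 0 ≤ S) :
    ∃ κ c : ℝ, 0 < κ ∧ 0 < c ∧ StepProp n ν S 4 κ c := by
  obtain ⟨κ, c, hκ, hc, h⟩ := step_core hn hν S hS 1 (n * (ν * 2)) (le_refl _) (by positivity)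
  refine ⟨κ / 8 ^ n, c, by positivity, hc, ?_⟩
  intro T Ω u θ p H k x0 ρ t0 hu hρ hb ht0 htT hmass hu1
  have h41 : 4 * (1:ℝ) ^ 2 * ρ = 4 * ρ := by ring
  have hno : ∀ x : En n, ‖ρ⁻¹ • (x - x0)‖ = ‖x - x0‖ / ρ := by
    intro x
    rw [norm_smul, norm_inv, Real.norm_of_nonneg hρ.le]; field_simp
  refine h T Ω u θ p H k x0 ρ t0 _ _ _ (fun x => 8 * ρ * k x) hu hρ (by rw [h41]; exact hb) ht0 htT hu1
    (C2x.sq.scale ρ⁻¹ x0) (hu.km.const_mul _) (fun x => mul_nonneg (by positivity) (hu.k0 x)) ?_ ?_ ?_ ?_ ?_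
  · intro x
    simp only [hno]
    apply le_of_eq; field_simp
  · intro x
    simp only [hno]
    apply le_of_eq; field_simp
  · intro x
    rw [hno, norm_smul, norm_smul, hno, norm_inv, Real.norm_of_nonneg hρ.le, Real.norm_of_nonneg (by norm_num : (0:ℝ) ≤ 2)]
    apply le_of_eq; field_simp; ring
  · refine Filter.Eventually.of_forall fun x hx A hA => ?_
    rw [h41, mem_ball, dist_eq_norm] at hx
    rw [norm_smul, norm_smul, hno, norm_inv, Real.norm_of_nonneg hρ.le, Real.norm_of_nonneg (by norm_num : (0:ℝ) ≤ 2),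
      trc_smul]
    have h1 : trc A ((2:ℝ) • ContinuousLinearMap.id ℝ (En n)) ≤ n * (ν * 2) := by
      refine (le_abs_self _).trans ((trc_abs_le _ _).trans ?_)
      gcongr
      · exact hA.2
      · rw [norm_smul, Real.norm_of_nonneg (by norm_num : (0:ℝ) ≤ 2)]
        have := ContinuousLinearMap.norm_id_le (𝕜 := ℝ) (E := En n)
        linarith
    have h2 : k x * ‖x - x0‖ ≤ k x * (4 * ρ) := mul_le_mul_of_nonneg_left hx.le (hu.k0 x)
    have h3 : ρ ^ 2 * (ρ⁻¹ * ρ⁻¹ * trc A ((2:ℝ) • ContinuousLinearMap.id ℝ (En n)) + k x * (ρ⁻¹ * (2 * (‖x - x0‖ / ρ))))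
      = trc A ((2:ℝ) • ContinuousLinearMap.id ℝ (En n)) + 2 * (k x * ‖x - x0‖) := by
      generalize trc A ((2:ℝ) • ContinuousLinearMap.id ℝ (En n)) = τ
      field_simp
    rw [h3]
    linarith
  · rw [h41, mass_ofReal_mul _ _ (by positivity)]
    refine (mul_le_mul_right hmass _).trans ?_
    rw [← ENNReal.ofReal_mul (by positivity)]
    refine ENNReal.ofReal_le_ofReal (le_of_eq ?_)
    rw [mul_pow]; field_simp

/-- one-dimensional coordinate change -/
theorem line_fun (m : ℝ → ℝ) (hm : Continuous m) (hi : Integrable m) {ν B : ℝ} (hν : 0 ≤ ν)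
    (hB : ∫ y, ‖m y‖ ≤ B) :
    ∃ f E : ℝ → ℝ, (∀ y, HasDerivAt f (E y) y) ∧ (∀ y, HasDerivAt E (-(ν * m y) * E y) y) ∧
      Continuous E ∧ (∀ y, (Real.exp (ν * B))⁻¹ ≤ E y ∧ E y ≤ Real.exp (ν * B)) ∧
      (∀ y, 0 ≤ y → 0 ≤ f y) ∧ (∀ y, y ≤ 0 → f y ≤ 0) ∧
      (∀ y, (Real.exp (ν * B))⁻¹ * |y| ≤ |f y| ∧ |f y| ≤ Real.exp (ν * B) * |y|) := by
  set Kc : ℝ → ℝ := fun y => ∫ s in (0:ℝ)..y, m s with hKc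
  have hdK : ∀ y, HasDerivAt Kc (m y) y := fun y => (hm.integral_hasStrictDerivAt 0 y).hasDerivAt
  set E : ℝ → ℝ := fun y => Real.exp (-(ν * Kc y)) with hE
  have hdE : ∀ y, HasDerivAt E (-(ν * m y) * E y) y := by
    intro y
    have := (((hdK y).const_mul ν).neg).exp
    rw [mul_comm]
    exact this
  have hEc : Continuous E := continuous_iff_continuousAt.2 fun x => (hdE x).continuousAt
  set f : ℝ → ℝ := fun y => ∫ s in (0:ℝ)..y, E s with hf
  have hdf : ∀ y, HasDerivAt f (E y) y := fun y => (hEc.integral_hasStrictDerivAt 0 y).hasDerivAt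
  have hKb : ∀ y, |Kc y| ≤ B := by
    intro y
    have h1 : ‖Kc y‖ ≤ ∫ s in uIoc 0 y, ‖m s‖ := intervalIntegral.norm_integral_le_integral_norm_uIoc
    refine h1.trans (le_trans ?_ hB)
    exact setIntegral_le_integral hi.norm (Filter.Eventually.of_forall fun x => norm_nonneg _)
  have hEb : ∀ y, (Real.exp (ν * B))⁻¹ ≤ E y ∧ E y ≤ Real.exp (ν * B) := by
    intro y
    have h1 := abs_le.1 (hKb y)
    rw [← Real.exp_neg]
    refine ⟨Real.exp_le_exp.2 ?_, Real.exp_le_exp.2 ?_⟩ <;> nlinarith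
  have hf0 : f 0 = 0 := by simp [hf]
  set Λ := Real.exp (ν * B) with hΛ
  have hΛ0 : 0 < Λ := Real.exp_pos _
  have m1 : Monotone fun y => f y - Λ⁻¹ * y := by
    refine monotone_of_hasDerivAt_nonneg (f' := fun y => E y - Λ⁻¹ * 1) (fun y => (hdf y).sub ((hasDerivAt_id y).const_mul _)) ?_
    intro y
    have := (hEb y).1
    simp only [Pi.zero_apply]
    linarith
  have m2 : Monotone fun y => Λ * y - f y := by
    refine monotone_of_hasDerivAt_nonneg (f' := fun y => Λ * 1 - E y) (fun y => ((hasDerivAt_id y).const_mul _).sub (hdf y)) ?_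
    intro y
    have := (hEb y).2
    simp only [Pi.zero_apply]
    linarith
  have p1 : ∀ y, 0 ≤ y → Λ⁻¹ * y ≤ f y ∧ f y ≤ Λ * y := by
    intro y hy
    have h1 := m1 hy
    have h2 := m2 hy
    simp only [hf0] at h1 h2
    exact ⟨by linarith, by linarith⟩
  have p2 : ∀ y, y ≤ 0 → f y ≤ Λ⁻¹ * y ∧ Λ * y ≤ f y := by
    intro y hy
    have h1 := m1 hy
    have h2 := m2 hy
    simp only [hf0] at h1 h2
    exact ⟨by linarith, by linarith⟩
  have hi0 : 0 < Λ⁻¹ := by positivity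
  refine ⟨f, E, hdf, hdE, hEc, hEb, fun y hy => ?_, fun y hy => ?_, fun y => ?_⟩
  · exact le_trans (by positivity) (p1 y hy).1
  · exact (p2 y hy).1.trans (mul_nonpos_of_nonneg_of_nonpos hi0.le hy)
  · rcases le_total 0 y with hy | hy
    · have h := p1 y hy
      rw [abs_of_nonneg hy, abs_of_nonneg (le_trans (by positivity) h.1)]
      exact h
    · have h := p2 y hy
      rw [abs_of_nonpos hy, abs_of_nonpos (h.1.trans (mul_nonpos_of_nonneg_of_nonpos hi0.le hy))]
      exact ⟨by linarith, by linarith⟩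

set_option maxHeartbeats 800000 in
theorem step_one {ν : ℝ} (hν : 1 ≤ ν) (S : ℝ) (hS : 0 ≤ S) :
    ∃ K c : ℝ, 4 ≤ K ∧ 0 < c ∧ StepProp 1 ν S K (S + 1) c := by
  have hν0 : 0 < ν := by linarith
  set Λ : ℝ := Real.exp (ν * (S + 1)) with hΛ
  have hΛ1 : 1 ≤ Λ := Real.one_le_exp (by positivity)
  have hΛ0 : 0 < Λ := by linarith
  obtain ⟨κ, c, hκ, hc, h⟩ := step_core one_pos hν S hS Λ (2 * ν * Λ ^ 2) hΛ1 (by positivity)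
  refine ⟨4 * Λ ^ 2, c, by nlinarith, hc, ?_⟩
  intro T Ω u θ p H k x0 ρ t0 hu hρ hb ht0 htT _ hu1
  set e : En 1 := EuclideanSpace.single 0 1 with he
  have hen : ‖e‖ = 1 := by simp [he]
  set L : ℝ ≃ₗᵢ[ℝ] En 1 := (LinearIsometry.toSpanSingleton ℝ (En 1) hen).toLinearIsometryEquiv (by simp) with hL
  have hLe : ∀ y, L y = y • e := fun y => rfl
  have hLs : ∀ x : En 1, x = ⟪e, x⟫ • e := by
    intro x
    obtain ⟨y, rfl⟩ := L.surjective x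
    rw [hLe, inner_smul_right, real_inner_self_eq_norm_sq, hen]; simp
  have hcoord : ∀ x : En 1, x0 + L ⟪e, x - x0⟫ = x := by
    intro x; rw [hLe, ← hLs]; abel
  have hnx : ∀ x : En 1, ‖x - x0‖ = |⟪e, x - x0⟫| := by
    intro x
    conv_lhs => rw [hLs (x - x0)]
    rw [norm_smul, hen, mul_one, Real.norm_eq_abs]
  have hmp : MeasurePreserving (fun y : ℝ => x0 + L y) volume volume :=
    (measurePreserving_add_left volume x0).comp L.measurePreserving
  have hmi : Measurable (fun y : ℝ => x0 + L y) := hmp.measurable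
  set m : ℝ → ℝ := fun y => if 0 ≤ y then k (x0 + L y) else - k (x0 + L y) with hm
  have hmm : Measurable m := by
    refine Measurable.ite measurableSet_Ici (hu.km.comp hmi) (hu.km.comp hmi).neg
  have hmabs : ∀ y, ‖m y‖ = k (x0 + L y) := by
    intro y
    simp only [hm]
    have := hu.k0 (x0 + L y)
    split_ifs
    · rw [Real.norm_of_nonneg this]
    · rw [norm_neg, Real.norm_of_nonneg this]
  have hlint : ∫⁻ y, ENNReal.ofReal ‖m y‖ ≤ ENNReal.ofReal S := by
    have h1 := hu.ms
    unfold mass at h1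
    simp only [pow_one, Measure.restrict_univ] at h1
    rw [← hmp.lintegral_comp (hu.km.ennreal_ofReal)] at h1
    simp only [hmabs]
    exact h1
  have hmint : Integrable m := by
    refine ⟨hmm.aestronglyMeasurable, ?_⟩
    rw [hasFiniteIntegral_iff_norm]
    exact hlint.trans_lt ENNReal.ofReal_lt_top
  have hmS : ∫ y, ‖m y‖ ≤ S := by
    rw [integral_eq_lintegral_of_nonneg_ae (Filter.Eventually.of_forall fun _ => norm_nonneg _) hmm.norm.aestronglyMeasurable]
    exact ENNReal.toReal_le_of_le_ofReal hS hlint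
  set ε : ℝ := min 1 (κ / (8 * ν ^ 2 * Λ ^ 4)) with hε
  have hε0 : 0 < ε := lt_min one_pos (by positivity)
  obtain ⟨g, _, hg1, hgc, hgi⟩ := hmint.exists_hasCompactSupport_integral_sub_le hε0
  have hgB : ∫ y, ‖g y‖ ≤ S + 1 := by
    have h1 : ∫ y, ‖g y‖ ≤ ∫ y, (‖m y‖ + ‖m y - g y‖) := by
      refine integral_mono hgi.norm (hmint.norm.add (hmint.sub hgi).norm) fun y => ?_
      have := norm_sub_le (m y) (m y - g y)
      rw [show m y - (m y - g y) = g y by ring] at this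
      exact this
    have hmg : Integrable (fun y => ‖m y - g y‖) := (hmint.sub hgi).norm
    rw [integral_add hmint.norm hmg] at h1
    have := min_le_left 1 (κ / (8 * ν ^ 2 * Λ ^ 4))
    linarith
  obtain ⟨f, E, hdf, hdE, hEc, hEb, hfp, hfn, hfb⟩ := line_fun g hgc hgi hν0.le hgB
  rw [← hΛ] at hEb hfb
  have hfc : Continuous f := continuous_iff_continuousAt.2 fun x => (hdf x).continuousAt
  have hE0 : ∀ y, 0 < E y := fun y => lt_of_lt_of_le (by positivity) (hEb y).1
  have d1 : ∀ y, HasDerivAt (fun y => (ρ ^ 2)⁻¹ * f y ^ 2) ((ρ ^ 2)⁻¹ * (2 * f y * E y)) y := by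
    intro y
    have := ((hdf y).pow 2).const_mul (ρ ^ 2)⁻¹
    simp only [Nat.cast_ofNat, Nat.add_one_sub_one, pow_one] at this
    exact this
  have d2 : ∀ y, HasDerivAt (fun y => (ρ ^ 2)⁻¹ * (2 * f y * E y))
      ((ρ ^ 2)⁻¹ * (2 * E y * E y + 2 * f y * (-(ν * g y) * E y))) y := fun y =>
    ((((hdf y).const_mul 2).mul (hdE y)).const_mul _)
  have hC := C2x.ofLine d1 d2 (by fun_prop) e x0
  have hnp : ∀ x : En 1, ‖((ρ ^ 2)⁻¹ * (2 * f ⟪e, x - x0⟫ * E ⟪e, x - x0⟫)) • e‖ =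
      (ρ ^ 2)⁻¹ * (2 * |f ⟪e, x - x0⟫| * E ⟪e, x - x0⟫) := by
    intro x
    rw [norm_smul, hen, mul_one, Real.norm_eq_abs, abs_mul, abs_mul, abs_mul, abs_of_pos (hE0 _)]
    rw [abs_of_pos (by positivity : (0:ℝ) < (ρ ^ 2)⁻¹), abs_two]
  refine h T Ω u θ p H k x0 ρ t0 _ _ _ (fun x => 8 * ν ^ 2 * Λ ^ 4 * ρ * |m ⟪e, x - x0⟫ - g ⟪e, x - x0⟫|)
    hu hρ hb ht0 htT hu1 hC ?_ (fun x => by positivity) ?_ ?_ ?_ ?_ ?_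
  · have : Measurable fun x : En 1 => ⟪e, x - x0⟫ := by fun_prop
    exact (((hmm.comp this).sub (hgc.measurable.comp this)).norm).const_mul _
  · intro x
    have h1 := (hfb ⟪e, x - x0⟫).1
    rw [inv_mul_le_iff₀ hΛ0] at h1
    rw [hnx]
    have h2 : |⟪e, x - x0⟫| ^ 2 ≤ (Λ * |f ⟪e, x - x0⟫|) ^ 2 := by gcongr
    rw [mul_pow, sq_abs (f _)] at h2
    refine h2.trans (le_of_eq ?_)
    field_simp
  · intro x
    have h1 := (hfb ⟪e, x - x0⟫).2
    rw [hnx]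
    have h2 : |f ⟪e, x - x0⟫| ^ 2 ≤ (Λ * |⟪e, x - x0⟫|) ^ 2 := by gcongr
    rw [mul_pow, sq_abs (f _)] at h2
    refine le_trans (le_of_eq ?_) h2
    field_simp
  · intro x
    rw [hnp]
    have h1 := (hEb ⟪e, x - x0⟫).1
    rw [inv_le_iff_one_le_mul₀ hΛ0] at h1
    have h2 : 1 ≤ (Λ * E ⟪e, x - x0⟫) ^ 2 := one_le_pow₀ (by linarith)
    have h3 : Λ ^ 2 * ρ ^ 2 * ((ρ ^ 2)⁻¹ * (2 * |f ⟪e, x - x0⟫| * E ⟪e, x - x0⟫)) ^ 2 =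
      4 * ((ρ ^ 2)⁻¹ * f ⟪e, x - x0⟫ ^ 2) * (Λ * E ⟪e, x - x0⟫) ^ 2 := by
      rw [mul_pow, mul_pow, mul_pow, sq_abs]; field_simp; ring
    rw [h3]
    exact le_mul_of_one_le_right (by positivity) h2
  · refine Filter.Eventually.of_forall fun x hx A hA => ?_
    rw [mem_ball, dist_eq_norm, hnx] at hx
    rw [trc_smul, trc_rank1, hnp]
    have hkm : k x * |f ⟪e, x - x0⟫| = m ⟪e, x - x0⟫ * f ⟪e, x - x0⟫ := by
      simp only [hm, hcoord]
      split_ifs with h0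
      · rw [abs_of_nonneg (hfp _ h0)]
      · rw [abs_of_nonpos (hfn _ (not_le.1 h0).le)]; ring
    have hkf : 0 ≤ m ⟪e, x - x0⟫ * f ⟪e, x - x0⟫ := by
      rw [← hkm]; exact mul_nonneg (hu.k0 x) (abs_nonneg _)
    have ha1 : ν⁻¹ ≤ ⟪A e, e⟫ := by
      have := hA.1 e
      rw [hen] at this; linarith
    have ha2 : ⟪A e, e⟫ ≤ ν := by
      have h1 := real_inner_le_norm (A e) e
      have h2 := A.le_opNorm e
      rw [hen, mul_one] at h1 h2
      exact h1.trans (h2.trans hA.2)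
    have hf2 := (hfb ⟪e, x - x0⟫).2
    have hE1 := hE0 ⟪e, x - x0⟫
    have hE2 := (hEb ⟪e, x - x0⟫).2
    generalize ⟪A e, e⟫ = α at *
    generalize ⟪e, x - x0⟫ = y at *
    have ha0 : 0 < α := lt_of_lt_of_le (by positivity) ha1
    have hav : 1 ≤ α * ν := by
      rw [inv_le_iff_one_le_mul₀ hν0] at ha1; linarith
    have e1 : ρ ^ 2 * ((ρ ^ 2)⁻¹ * (2 * E y * E y + 2 * f y * (-(ν * g y) * E y)) * α +
        k x * ((ρ ^ 2)⁻¹ * (2 * |f y| * E y))) =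
        2 * α * E y ^ 2 + 2 * E y * (k x * |f y| - α * ν * (g y * f y)) := by
      field_simp; ring
    rw [e1, hkm]
    have e2 : 2 * α * E y ^ 2 ≤ 2 * ν * Λ ^ 2 := by gcongr
    have e3 : m y * f y - α * ν * (g y * f y) ≤ ν * ν * (|m y - g y| * (Λ * (4 * Λ ^ 2 * ρ))) := by
      have e4 : m y * f y - α * ν * (g y * f y) ≤ α * ν * ((m y - g y) * f y) := by nlinarith
      have e5 : (m y - g y) * f y ≤ |m y - g y| * (Λ * (4 * Λ ^ 2 * ρ)) := by
        refine (le_abs_self _).trans ?_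
        rw [abs_mul]
        gcongr
        exact hf2.trans (by gcongr)
      refine e4.trans ?_
      calc α * ν * ((m y - g y) * f y) ≤ α * ν * (|m y - g y| * (Λ * (4 * Λ ^ 2 * ρ))) := by gcongr
        _ ≤ _ := by gcongr
    have e6 : 2 * E y * (m y * f y - α * ν * (g y * f y)) ≤ 2 * Λ * (ν * ν * (|m y - g y| * (Λ * (4 * Λ ^ 2 * ρ)))) := by
      calc _ ≤ 2 * E y * (ν * ν * (|m y - g y| * (Λ * (4 * Λ ^ 2 * ρ)))) := by gcongr
        _ ≤ _ := by gcongr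
    refine (add_le_add e2 e6).trans (le_of_eq ?_)
    ring
  · refine (mass_mono _ (subset_univ _)).trans ?_
    rw [mass_ofReal_mul _ _ (by positivity)]
    have h1 : mass (fun x => |m ⟪e, x - x0⟫ - g ⟪e, x - x0⟫|) univ ≤ ENNReal.ofReal ε := by
      unfold mass
      simp only [pow_one, Measure.restrict_univ]
      have hme : Measurable fun x : En 1 => ENNReal.ofReal |m ⟪e, x - x0⟫ - g ⟪e, x - x0⟫| := by
        have : Measurable fun x : En 1 => ⟪e, x - x0⟫ := by fun_prop
        exact (((hmm.comp this).sub (hgc.measurable.comp this)).norm).ennreal_ofReal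
      rw [← hmp.lintegral_comp hme]
      have : ∀ y, ⟪e, x0 + L y - x0⟫ = y := by
        intro y
        rw [add_sub_cancel_left, hLe, inner_smul_right, real_inner_self_eq_norm_sq, hen]; simp
      simp only [this]
      have hmg : Integrable (fun y => |m y - g y|) := (hmint.sub hgi).norm
      rw [← ofReal_integral_eq_lintegral_ofReal hmg (Filter.Eventually.of_forall fun _ => abs_nonneg _)]
      exact ENNReal.ofReal_le_ofReal hg1
    refine (mul_le_mul_right h1 _).trans ?_
    rw [← ENNReal.ofReal_mul (by positivity)]
    refine ENNReal.ofReal_le_ofReal ?_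
    rw [pow_one, pow_one]
    have : ε ≤ κ / (8 * ν ^ 2 * Λ ^ 4) := min_le_right _ _
    rw [le_div_iff₀ (by positivity)] at this
    nlinarith

theorem step {n : ℕ} (hn : 0 < n) {ν : ℝ} (hν : 1 ≤ ν) (S : ℝ) (hS : 0 ≤ S) :
    ∃ K κ c : ℝ, 4 ≤ K ∧ 0 < κ ∧ 0 < c ∧ (n = 1 → S ≤ κ) ∧ StepProp n ν S K κ c := by
  by_cases h1 : n = 1
  · subst h1
    obtain ⟨K, c, hK, hc, h⟩ := step_one hν S hS
    exact ⟨K, S + 1, c, hK, by positivity, hc, fun _ => by linarith, h⟩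
  · obtain ⟨κ, c, hκ, hc, h⟩ := step_ge2 hn hν S hS
    exact ⟨4, κ, c, le_refl _, hκ, hc, fun h => absurd h h1, h⟩

theorem StepProp.scaled {n : ℕ} {ν S K κ c : ℝ} (h : StepProp n ν S K κ c) {T : ℝ} {Ω : Set (En n)}
    {u θ : En n × ℝ → ℝ} {p : En n × ℝ → En n}
    {H : En n × ℝ → (En n →L[ℝ] En n)} {k : En n → ℝ} {x0 : En n} {ρ t0 a : ℝ}
    (hu : Sol ν S T Ω u θ p H k) (hρ : 0 < ρ) (ha : 0 < a) (hb : closedBall x0 (K * ρ) ⊆ Ω) (ht0 : 0 < t0)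
    (htT : t0 + ρ ^ 2 < T) (hm : mass k (ball x0 (K * ρ)) ≤ ENNReal.ofReal κ)
    (hu1 : ∀ x ∈ ball x0 ρ, a ≤ u (x, t0)) :
    ∀ x ∈ ball x0 (2 * ρ), c * a ≤ u (x, t0 + ρ ^ 2) := by
  intro x hx
  have := h T Ω _ _ _ _ k x0 ρ t0 (hu.smul (inv_pos.2 ha)) hρ hb ht0 htT hm ?_ x hx
  · rw [inv_mul_eq_div, le_div_iff₀ ha] at this
    exact this
  · intro y hy
    rw [inv_mul_eq_div, le_div_iff₀ ha, one_mul]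
    exact hu1 y hy

theorem chain {n : ℕ} {ν S K κ c : ℝ} (h : StepProp n ν S K κ c) (hc : 0 < c) {T : ℝ} {Ω : Set (En n)}
    {u θ : En n × ℝ → ℝ} {p : En n × ℝ → En n}
    {H : En n × ℝ → (En n →L[ℝ] En n)} {k : En n → ℝ} {w : ℕ → En n} {ε t0 : ℝ} {m : ℕ}
    (hu : Sol ν S T Ω u θ p H k) (hε : 0 < ε) (ht0 : 0 < t0) (htT : t0 + m * ε ^ 2 < T)
    (hb : ∀ j < m, closedBall (w j) (K * ε) ⊆ Ω)
    (hm : ∀ j < m, mass k (ball (w j) (K * ε)) ≤ ENNReal.ofReal κ)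
    (hd : ∀ j < m, dist (w (j + 1)) (w j) ≤ ε)
    (hu1 : ∀ x ∈ ball (w 0) ε, 1 ≤ u (x, t0)) :
    ∀ j ≤ m, ∀ x ∈ ball (w j) ε, c ^ j ≤ u (x, t0 + j * ε ^ 2) := by
  intro j
  induction j with
  | zero =>
    intro _ x hx
    simpa using hu1 x hx
  | succ j ih =>
    intro hj x hx
    have hj' : j < m := hj
    have h1 := ih hj'.le
    have hjm : ((j:ℝ) + 1) ≤ m := by exact_mod_cast hj
    have hjm2 : ((j:ℝ) + 1) * ε ^ 2 ≤ m * ε ^ 2 := by gcongr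
    have h2 := h.scaled hu hε (a := c ^ j) (t0 := t0 + j * ε ^ 2) (by positivity) (hb j hj') (by positivity)
      (by linarith) (hm j hj') h1 x ?_
    · rw [pow_succ, mul_comm]
      convert h2 using 3
      push_cast; ring
    · have h3 := hd j hj'
      have h4 := dist_triangle x (w (j + 1)) (w j)
      have h5 : dist x (w (j + 1)) < ε := hx
      rw [mem_ball]; linarith

theorem fubini_mass {n : ℕ} {k : En n → ℝ} (hk : Measurable k) (v : En n) (a : ℝ) :
    Measurable (fun z => mass k (ball (z + v) a)) ∧
    ∫⁻ z, mass k (ball (z + v) a) ≤ volume (ball (0 : En n) a) * mass k univ := by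
  have hf : Measurable fun x => ENNReal.ofReal (k x ^ n) := (hk.pow_const n).ennreal_ofReal
  set F : En n × En n → ℝ≥0∞ := ({q : En n × En n | dist q.2 (q.1 + v) < a}).indicator
    (fun q => ENNReal.ofReal (k q.2 ^ n)) with hF
  have hFm : Measurable F := by
    refine (hf.comp measurable_snd).indicator ?_
    exact (isOpen_lt (by fun_prop) continuous_const).measurableSet
  have he : ∀ z, mass k (ball (z + v) a) = ∫⁻ x, F (z, x) := by
    intro z
    unfold mass
    rw [← lintegral_indicator measurableSet_ball]
    rfl
  constructor
  · simp only [he]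
    exact hFm.lintegral_prod_right'
  · simp only [he]
    rw [lintegral_lintegral_swap (f := fun z x => F (z, x)) hFm.aemeasurable]
    unfold mass
    rw [Measure.restrict_univ, ← lintegral_const_mul _ hf]
    refine lintegral_mono fun x => ?_
    have h1 : ∀ z, F (z, x) = (ball (x - v) a).indicator (fun _ => ENNReal.ofReal (k x ^ n)) z := by
      intro z
      have : (z, x) ∈ {q : En n × En n | dist q.2 (q.1 + v) < a} ↔ z ∈ ball (x - v) a := by
        simp only [mem_setOf_eq, mem_ball]
        rw [dist_comm z, dist_eq_norm, dist_eq_norm]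
        rw [show x - (z + v) = x - v - z by abel]
      by_cases hz : z ∈ ball (x - v) a
      · rw [Set.indicator_of_mem hz]; exact Set.indicator_of_mem (this.2 hz) _
      · rw [Set.indicator_of_notMem hz]; exact Set.indicator_of_notMem (fun h => hz (this.1 h)) _
    simp only [h1]
    rw [lintegral_indicator measurableSet_ball, setLIntegral_const, mul_comm]
    rw [Measure.addHaar_ball_center volume (x - v) a]

theorem bad_meas {n : ℕ} {k : En n → ℝ} (hk : Measurable k) {S κ : ℝ} (hS : 0 ≤ S) (hκ : 0 < κ)
    (hm : mass k univ ≤ ENNReal.ofReal S) (v : En n) {a : ℝ} (ha : 0 < a) :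
    volume {z | ENNReal.ofReal κ < mass k (ball (z + v) a)} ≤
      ENNReal.ofReal (a ^ n * (volume (ball (0 : En n) 1)).toReal * S / κ) := by
  obtain ⟨h1, h2⟩ := fubini_mass hk v a
  have h3 := meas_ge_le_lintegral_div (μ := volume) h1.aemeasurable (ε := ENNReal.ofReal κ)
    (by simpa using hκ) ENNReal.ofReal_ne_top
  have hV : volume (ball (0 : En n) a) = ENNReal.ofReal (a ^ n * (volume (ball (0 : En n) 1)).toReal) := by
    rw [Measure.addHaar_ball_of_pos volume 0 ha, ENNReal.ofReal_mul (by positivity),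
      ENNReal.ofReal_toReal measure_ball_lt_top.ne]
    simp
  calc volume {z | ENNReal.ofReal κ < mass k (ball (z + v) a)}
      ≤ volume {z | ENNReal.ofReal κ ≤ mass k (ball (z + v) a)} := measure_mono (by intro z hz; simp only [mem_setOf_eq] at *; exact hz.le)
    _ ≤ _ := h3
    _ ≤ (volume (ball (0 : En n) a) * ENNReal.ofReal S) / ENNReal.ofReal κ := by
      gcongr
      exact h2.trans (by gcongr)
    _ = _ := by
      rw [hV, ← ENNReal.ofReal_mul (by positivity), ENNReal.ofReal_div_of_pos hκ]

def MoveProp (n : ℕ) (ν S D β c : ℝ) : Prop :=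
  ∀ (T : ℝ) (Ω : Set (En n)) (u θ : En n × ℝ → ℝ) (p : En n × ℝ → En n)
    (H : En n × ℝ → (En n →L[ℝ] En n)) (k : En n → ℝ) (x0 x1 : En n) (ρ t0 t1 a : ℝ),
    Sol ν S T Ω u θ p H k → 0 < ρ → 0 < a → (∀ z ∈ segment ℝ x0 x1, ball z (4 * ρ) ⊆ Ω) →
    dist x1 x0 ≤ D * ρ → 0 < t0 → t1 < T → ρ ^ 2 ≤ t1 - t0 → t1 - t0 ≤ β * ρ ^ 2 →
    (∀ x ∈ ball x0 ρ, a ≤ u (x, t0)) →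
    ∀ x ∈ ball x1 (2 * ρ), c * a ≤ u (x, t1)

set_option maxHeartbeats 1600000 in
theorem move {n : ℕ} (hn : 0 < n) {ν : ℝ} (hν : 1 ≤ ν) (S : ℝ) (hS : 0 ≤ S) (D β : ℝ) (hD : 0 ≤ D) (hβ : 1 ≤ β) :
    ∃ c, 0 < c ∧ MoveProp n ν S D β c := by
  obtain ⟨δ, hδ, hgl⟩ := gl1_dual hn hν S hS
  obtain ⟨K, κ, c, hK, hκ, hc, hn1, hstep⟩ := step hn hν S hS
  set K' : ℝ := K * β + D + 2 with hK'
  have hK'0 : 0 < K' := by positivity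
  set ω : ℝ := (volume (ball (0 : En n) 1)).toReal with hω
  have hω0 : 0 ≤ ω := ENNReal.toReal_nonneg
  -- choice of the number of subdivisions
  obtain ⟨I, hI⟩ := exists_nat_gt (max (max (2 * (D + 2)) (K * β)) (K' ^ n * ω * S / κ * 2 ^ n / δ))
  have hI1 : 2 * (D + 2) < I := lt_of_le_of_lt (le_trans (le_max_left _ _) (le_max_left _ _)) hI
  have hI2 : K * β < I := lt_of_le_of_lt (le_trans (le_max_right _ _) (le_max_left _ _)) hI
  have hI3 : K' ^ n * ω * S / κ * 2 ^ n / δ < I := lt_of_le_of_lt (le_max_right _ _) hI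
  have hI0 : (0:ℝ) < I := by linarith
  have hI0' : 0 < I := by exact_mod_cast hI0
  refine ⟨c ^ (I * I) / 2, by positivity, ?_⟩
  -- reduce to a = 1
  intro T Ω u' θ' p' H' k x0 x1 ρ t0 t1 a hu' hρ ha hseg hd ht0 htT ht1 ht2 hu1' x1' hx1'
  have hu := hu'.smul (inv_pos.2 ha)
  have hu1 : ∀ x ∈ ball x0 ρ, 1 ≤ a⁻¹ * u' (x, t0) := by
    intro y hy
    rw [inv_mul_eq_div, le_div_iff₀ ha, one_mul]
    exact hu1' y hy
  suffices hsuff : c ^ (I * I) / 2 ≤ a⁻¹ * u' (x1', t1) by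
    rw [inv_mul_eq_div, le_div_iff₀ ha] at hsuff
    exact hsuff
  set u : En n × ℝ → ℝ := fun X => a⁻¹ * u' X with hudef
  have hx1'' : dist x1' x1 < 2 * ρ := hx1'
  set vv : En n := x1' - x0 with hvv
  have hvn : ‖vv‖ ≤ (D + 2) * ρ := by
    rw [hvv, ← dist_eq_norm]
    have := dist_triangle x1' x1 x0
    linarith
  set γ : En n → ℝ → En n := fun z s => z + ((s - 1) • vv) with hγ
  have hγΩ : ∀ z ∈ closedBall x1' (ρ / 2), ∀ s ∈ Icc (0:ℝ) 1, closedBall (γ z s) (5 / 4 * ρ) ⊆ Ω := by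
    intro z hz s hs
    have hmem : x0 + s • (x1 - x0) ∈ segment ℝ x0 x1 := by
      rw [segment_eq_image']
      exact ⟨s, hs, rfl⟩
    refine subset_trans ?_ (hseg _ hmem)
    intro q hq
    have h1 : dist (γ z s) (x0 + s • (x1 - x0)) < 5 / 2 * ρ := by
      rw [dist_eq_norm]
      have e1 : γ z s - (x0 + s • (x1 - x0)) = (z - x1') + s • (x1' - x1) := by
        simp only [hγ, hvv]; module
      rw [e1]
      have h2 : ‖z - x1'‖ ≤ ρ / 2 := by rw [← dist_eq_norm]; exact hz
      have h3 : ‖s • (x1' - x1)‖ ≤ 1 * ‖x1' - x1‖ := by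
        rw [norm_smul, Real.norm_of_nonneg hs.1]; gcongr; exact hs.2
      rw [← dist_eq_norm] at h3
      have h4 := norm_add_le (z - x1') (s • (x1' - x1))
      linarith
    have h2 : dist q (γ z s) ≤ 5 / 4 * ρ := hq
    have := dist_triangle q (γ z s) (x0 + s • (x1 - x0))
    rw [mem_ball]; linarith
  set good : En n → Prop := fun z => ∀ i < I, mass k (ball (γ z ((i:ℝ) / I)) (K' * ρ / I)) ≤ ENNReal.ofReal κ with hgood
  have hgoodu : ∀ z ∈ closedBall x1' (ρ / 2), good z → ∀ τ ∈ Icc (t1 - (ρ / 2) ^ 2) t1, c ^ (I * I) ≤ u (z, τ) := by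
    intro z hz hg τ hτ
    have hτ0 : 0 < τ - t0 := by nlinarith [hτ.1]
    set ε : ℝ := Real.sqrt (τ - t0) / I with hε
    have hsq : Real.sqrt (τ - t0) ^ 2 = τ - t0 := Real.sq_sqrt hτ0.le
    have hs1 : ρ / 2 ≤ Real.sqrt (τ - t0) := by
      apply Real.le_sqrt_of_sq_le; nlinarith [hτ.1]
    have hs2 : Real.sqrt (τ - t0) ≤ β * ρ := by
      apply Real.sqrt_le_iff.2
      refine ⟨by positivity, ?_⟩
      have : β * ρ ^ 2 ≤ (β * ρ) ^ 2 := by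
        rw [mul_pow]; gcongr; nlinarith
      linarith [hτ.2]
    have hε0 : 0 < ε := div_pos (by linarith) hI0
    have hεK : K * ε ≤ K * β * ρ / I := by
      rw [hε]
      rw [← mul_div_assoc, mul_assoc K β]
      gcongr
    have hεK' : K * ε ≤ 5 / 4 * ρ := by
      refine hεK.trans ?_
      rw [div_le_iff₀ hI0]
      nlinarith
    have hII : ((I * I : ℕ) : ℝ) = (I:ℝ) * I := by push_cast; ring
    have hfrac : ∀ j < I * I, (j:ℝ) / (I * I) ∈ Icc (0:ℝ) 1 := by
      intro j hj
      refine ⟨by positivity, (div_le_one (by positivity)).2 ?_⟩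
      rw [← hII]; exact_mod_cast hj.le
    have htot : t0 + ((I * I : ℕ) : ℝ) * ε ^ 2 = τ := by
      rw [hII, hε, div_pow, hsq]; field_simp; ring
    have key := chain hstep hc (w := fun j => γ z ((j:ℝ) / (I * I))) (m := I * I) (t0 := t0) hu hε0 ht0
      (by rw [htot]; linarith [hτ.2]) ?_ ?_ ?_ ?_ (I * I) (le_refl _) z ?_
    · rw [htot] at key; exact key
    · intro j hj
      exact (closedBall_subset_closedBall hεK').trans (hγΩ z hz _ (hfrac j hj))
    · intro j hj
      have hi : j / I < I := Nat.div_lt_of_lt_mul hj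
      refine le_trans (mass_mono k ?_) (hg (j / I) hi)
      refine ball_subset_ball' ?_
      have h1 : dist (γ z ((j:ℝ) / (I * I))) (γ z (((j / I : ℕ):ℝ) / I)) ≤ (D + 2) * ρ / I := by
        rw [dist_eq_norm]
        have e1 : γ z ((j:ℝ) / (I * I)) - γ z (((j / I : ℕ):ℝ) / I) =
          ((j:ℝ) / (I * I) - ((j / I : ℕ):ℝ) / I) • vv := by simp only [hγ]; module
        rw [e1, norm_smul, Real.norm_eq_abs]
        have h2 : |(j:ℝ) / (I * I) - ((j / I : ℕ):ℝ) / I| ≤ 1 / I := by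
          have h3 : ((I * (j / I) : ℕ) : ℝ) ≤ j := by exact_mod_cast Nat.mul_div_le j I
          have h4 : (j : ℝ) < ((I * (j / I) + I : ℕ) : ℝ) := by
            exact_mod_cast (by have := Nat.div_add_mod j I; have := Nat.mod_lt j hI0'; omega)
          push_cast at h3 h4
          have e2 : (j:ℝ) / (I * I) - ((j / I : ℕ):ℝ) / I = (j - I * ((j / I : ℕ):ℝ)) / (I * I) := by
            field_simp
          rw [e2, abs_of_nonneg (div_nonneg (by push_cast; linarith) (by positivity))]
          rw [div_le_div_iff₀ (by positivity) hI0]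
          push_cast
          nlinarith
        calc _ ≤ 1 / (I:ℝ) * ((D + 2) * ρ) := by gcongr
          _ = _ := by ring
      have : K' * ρ / I = K * β * ρ / I + (D + 2) * ρ / I := by rw [hK']; ring
      rw [this]
      linarith
    · intro j hj
      rw [dist_eq_norm]
      have e1 : γ z (((j + 1 : ℕ):ℝ) / (I * I)) - γ z ((j:ℝ) / (I * I)) = (1 / ((I:ℝ) * I)) • vv := by
        simp only [hγ]
        rw [add_sub_add_left_eq_sub, ← sub_smul]
        congr 1
        push_cast; ring
      rw [e1, norm_smul, Real.norm_of_nonneg (by positivity), hε]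
      calc 1 / ((I:ℝ) * I) * ‖vv‖ ≤ 1 / ((I:ℝ) * I) * ((D + 2) * ρ) := by gcongr
        _ = ((D + 2) * ρ / I) / I := by field_simp
        _ ≤ _ := by
          gcongr
          refine le_trans ?_ hs1
          rw [div_le_iff₀ hI0]; nlinarith
    · intro x hx
      refine hu1 x ?_
      have h1 : dist x (γ z (((0:ℕ):ℝ) / (I * I))) < ε := hx
      have h2 : dist (γ z (((0:ℕ):ℝ) / (I * I))) x0 ≤ ρ / 2 := by
        rw [dist_eq_norm]
        have : γ z (((0:ℕ):ℝ) / (I * I)) - x0 = z - x1' := by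
          simp only [hγ, hvv, Nat.cast_zero, zero_div]; module
        rw [this, ← dist_eq_norm]; exact hz
      have h3 := dist_triangle x (γ z (((0:ℕ):ℝ) / (I * I))) x0
      rw [mem_ball]
      nlinarith
    · have : γ z (((I * I : ℕ):ℝ) / (I * I)) = z := by
        simp only [hγ, hII]
        rw [div_self (by positivity)]; simp
      rw [this]; exact mem_ball_self hε0
  -- measure of the bad set
  have hbad : volume {z | ¬ good z} ≤ ENNReal.ofReal (δ * (ρ / 2) ^ n) := by
    by_cases h1 : n = 1
    · have : {z | ¬ good z} = ∅ := by
        ext z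
        simp only [mem_setOf_eq, mem_empty_iff_false, iff_false, not_not]
        intro i _
        exact (hu.mass_le _).trans (ENNReal.ofReal_le_ofReal (hn1 h1))
      rw [this]; simp
    · have hn2 : 2 ≤ n := by omega
      have hsub : {z | ¬ good z} ⊆ ⋃ i ∈ Finset.range I,
          {z | ENNReal.ofReal κ < mass k (ball (z + (((i:ℝ) / I - 1) • vv)) (K' * ρ / I))} := by
        intro z hz
        simp only [hgood, mem_setOf_eq] at hz
        push Not at hz
        obtain ⟨i, hi, h⟩ := hz
        simp only [mem_iUnion]
        exact ⟨i, Finset.mem_range.2 hi, h⟩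
      refine (measure_mono hsub).trans ((measure_biUnion_finset_le _ _).trans ?_)
      refine (Finset.sum_le_sum fun i _ => bad_meas hu.km hS hκ hu.ms _ (by positivity : 0 < K' * ρ / I)).trans ?_
      rw [Finset.sum_const, Finset.card_range, nsmul_eq_mul, ← ENNReal.ofReal_natCast,
        ← ENNReal.ofReal_mul hI0.le]
      refine ENNReal.ofReal_le_ofReal ?_
      rw [← hω]
      obtain ⟨l, rfl⟩ : ∃ l, n = l + 2 := ⟨n - 2, by omega⟩
      have hIge : (1:ℝ) ≤ I := by linarith
      have hIp : (1:ℝ) ≤ (I:ℝ) ^ l := one_le_pow₀ hIge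
      rw [div_lt_iff₀ hδ] at hI3
      have e1 : (I:ℝ) * ((K' * ρ / I) ^ (l + 2) * ω * S / κ) =
        (K' ^ (l + 2) * ω * S / κ * 2 ^ (l + 2)) * (ρ / 2) ^ (l + 2) / (I ^ l * I) := by
        rw [div_pow, div_pow, mul_pow, pow_succ (I:ℝ) (l + 1), pow_succ (I:ℝ) l]; field_simp
      rw [e1, div_le_iff₀ (by positivity)]
      calc (K' ^ (l + 2) * ω * S / κ * 2 ^ (l + 2)) * (ρ / 2) ^ (l + 2)
          ≤ (I * δ) * (ρ / 2) ^ (l + 2) := by gcongr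
        _ = δ * (ρ / 2) ^ (l + 2) * (1 * I) := by ring
        _ ≤ _ := by gcongr
  have hself : x1' ∈ closedBall x1' (ρ / 2) := mem_closedBall_self (by positivity)
  refine hgl T Ω u _ _ _ k x1' (ρ / 2) t1 (c ^ (I * I)) hu (by positivity) (by positivity) ?_ ?_ htT ?_
  · have := hγΩ x1' hself 1 ⟨by norm_num, le_refl _⟩
    have e1 : γ x1' 1 = x1' := by simp [hγ]
    rw [e1] at this
    exact (closedBall_subset_closedBall (by linarith)).trans this
  · nlinarith
  · have hsub : {X : En n × ℝ | X ∈ closedBall x1' (ρ / 2) ×ˢ Icc (t1 - (ρ / 2) ^ 2) t1 ∧ u X < c ^ (I * I)} ⊆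
        {z | ¬ good z} ×ˢ Icc (t1 - (ρ / 2) ^ 2) t1 := by
      rintro X ⟨hX, hlt⟩
      refine ⟨fun hg => ?_, hX.2⟩
      exact absurd (hgoodu X.1 hX.1 hg X.2 hX.2) (not_le.2 hlt)
    refine (measure_mono hsub).trans ?_
    rw [Measure.volume_eq_prod, Measure.prod_prod, Real.volume_Icc]
    refine (mul_le_mul_left hbad _).trans ?_
    rw [← ENNReal.ofReal_mul (by positivity)]
    refine ENNReal.ofReal_le_ofReal (le_of_eq ?_)
    ring

theorem vol_cyl {n : ℕ} (x : En n) {r : ℝ} (hr : 0 ≤ r) (t1 t2 : ℝ) :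
    volume (closedBall x r ×ˢ Icc t1 t2 : Set (En n × ℝ)) =
      ENNReal.ofReal (r ^ n * (volume (ball (0 : En n) 1)).toReal * (t2 - t1)) := by
  have hω : 0 ≤ (volume (ball (0 : En n) 1)).toReal := ENNReal.toReal_nonneg
  rw [Measure.volume_eq_prod, Measure.prod_prod, Real.volume_Icc, Measure.addHaar_closedBall volume x hr,
    ENNReal.ofReal_mul (by positivity), ENNReal.ofReal_mul (by positivity),
    ENNReal.ofReal_toReal measure_ball_lt_top.ne]
  simp

theorem nat_switch {P : ℕ → Prop} {N : ℕ} (h0 : P 0) (hN : ¬ P N) : ∃ i < N, P i ∧ ¬ P (i + 1) := by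
  by_contra hc
  push Not at hc
  have : ∀ i ≤ N, P i := by
    intro i
    induction i with
    | zero => intro _; exact h0
    | succ i ih => intro hi; exact hc i hi (ih (by omega))
  exact hN (this N le_rfl)

/-- dense cylinder gives a lower bound on the top ball -/
def DenseProp (n : ℕ) (ν S δ : ℝ) : Prop :=
  ∀ (T : ℝ) (Ω : Set (En n)) (u θ : En n × ℝ → ℝ) (p : En n × ℝ → En n)
    (H : En n × ℝ → (En n →L[ℝ] En n)) (k : En n → ℝ) (x : En n) (r t a : ℝ),
    Sol ν S T Ω u θ p H k → 0 < r → 0 < a →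
    closedBall x r ⊆ Ω → 0 < t - r ^ 2 → t < T →
    volume ((closedBall x r ×ˢ Icc (t - r ^ 2) t) \ {X | X ∈ Ω ×ˢ Ioo (0:ℝ) T ∧ a < u X}) ≤
      ENNReal.ofReal (δ * r ^ (n + 2)) → ∀ y ∈ ball x (r / 2), a / 2 ≤ u (y, t)

theorem dense_prop {n : ℕ} (hn : 0 < n) {ν : ℝ} (hν : 1 ≤ ν) (S : ℝ) (hS : 0 ≤ S) :
    ∃ δ, 0 < δ ∧ DenseProp n ν S δ := by
  obtain ⟨δ, hδ, hgl⟩ := gl1_dual hn hν S hS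
  refine ⟨δ / 2 ^ (n + 2), by positivity, ?_⟩
  intro T Ω u θ p H k x r t a hu hr ha hb ht htT hv y hy
  have hy' : dist y x < r / 2 := hy
  have hsub : closedBall y (r / 2) ⊆ closedBall x r := closedBall_subset_closedBall' (by linarith)
  have hr2 : (r / 2) ^ 2 ≤ r ^ 2 := by gcongr; linarith
  refine hgl T Ω u θ p H k y (r / 2) t a hu (by positivity) ha (hsub.trans hb) (by linarith) htT ?_
  have e1 : δ * (r / 2) ^ (n + 2) = δ / 2 ^ (n + 2) * r ^ (n + 2) := by rw [div_pow]; ring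
  rw [e1]
  refine le_trans (measure_mono ?_) hv
  rintro ⟨z, τ⟩ ⟨hX, hlt⟩
  have h1 : z ∈ closedBall y (r / 2) := hX.1
  have h2 : τ ∈ Icc (t - (r / 2) ^ 2) t := hX.2
  refine ⟨mk_mem_prod (hsub h1) ⟨by linarith [h2.1], h2.2⟩, ?_⟩
  rintro ⟨-, h3⟩
  exact absurd hlt (not_lt.2 h3.le)

def SpotStep (n : ℕ) (ν S c ε : ℝ) : Prop :=
  ∀ (T : ℝ) (Ω : Set (En n)) (u θ : En n × ℝ → ℝ) (p : En n × ℝ → En n)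
    (H : En n × ℝ → (En n →L[ℝ] En n)) (k : En n → ℝ) (r a : ℝ) (E : Set (En n × ℝ)),
    Sol ν S T Ω u θ p H k → 0 < r → 0 < a →
    (∀ X ∈ E, a < u X ∧ ball X.1 (4 * r) ⊆ Ω ∧ 0 < X.2 ∧ X.2 + 3 * r ^ 2 < T) →
    (∀ X ∈ E, ∀ t, X.2 ≤ t → t ≤ X.2 + 3 * r ^ 2 → ∃ x ∈ ball X.1 (r / 2), u (x, t) < a / 2) →
    volume E + ENNReal.ofReal ε * volume E ≤
      volume {X : En n × ℝ | c * a < u X ∧ ∃ X0 ∈ E, dist X.1 X0.1 ≤ r ∧ X0.2 ≤ X.2 ∧ X.2 ≤ X0.2 + 3 * r ^ 2}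

/-- the stopped cylinder -/
theorem spot_cyl {n : ℕ} {ν S δ c : ℝ} (hD : DenseProp n ν S δ) (hM : MoveProp n ν S 4 32 c) (hδ : 0 < δ)
    (hc : 0 < c)
    {T : ℝ} {Ω : Set (En n)} {u θ : En n × ℝ → ℝ} {p : En n × ℝ → En n}
    {H : En n × ℝ → (En n →L[ℝ] En n)} {k : En n → ℝ} {r a : ℝ}
    (hu : Sol ν S T Ω u θ p H k) (hr : 0 < r) (ha : 0 < a) {X : En n × ℝ} (hXa : a < u X)
    (hXb : ball X.1 (4 * r) ⊆ Ω) (hX0 : 0 < X.2) (hXT : X.2 + 3 * r ^ 2 < T)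
    (hno : ∀ t, X.2 ≤ t → t ≤ X.2 + 3 * r ^ 2 → ∃ x ∈ ball X.1 (r / 2), u (x, t) < a / 2) :
    ∃ r' t' : ℝ, 0 < r' ∧ r' ≤ r ∧ t' ≤ X.2 + 3 * r' ^ 2 ∧ X.2 ≤ t' - r' ^ 2 ∧
      (∀ Z ∈ closedBall X.1 r' ×ˢ Icc (t' - r' ^ 2) t', c / 4 * a < u Z) ∧
      ENNReal.ofReal (δ * r' ^ (n + 2)) ≤ volume ((closedBall X.1 r' ×ˢ Icc (t' - r' ^ 2) t') \
        {X | X ∈ Ω ×ˢ Ioo (0:ℝ) T ∧ a < u X}) := by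
  obtain ⟨x, t0⟩ := X
  simp only at hXb hX0 hXT hno ⊢
  set U : Set (En n × ℝ) := {X | X ∈ Ω ×ˢ Ioo (0:ℝ) T ∧ a < u X} with hU
  have hxΩ : x ∈ Ω := hXb (mem_ball_self (by positivity))
  have hr2 : 0 < r ^ 2 := by positivity
  have hUo : IsOpen U := hu.c21.cw.isOpen_inter_preimage hu.c21.op isOpen_Ioi
  have hXU : (x, t0) ∈ U := ⟨mk_mem_prod hxΩ ⟨hX0, by linarith⟩, hXa⟩
  obtain ⟨ε, hε, hball⟩ := Metric.isOpen_iff.1 hUo _ hXU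
  -- tiny scale
  obtain ⟨N, hN⟩ : ∃ N : ℕ, r / 2 ^ N < min (ε / 2) (min 1 (t0 / 2)) := by
    have h1 : Filter.Tendsto (fun N : ℕ => r * (1 / 2 : ℝ) ^ N) Filter.atTop (nhds (r * 0)) :=
      (_root_.tendsto_pow_atTop_nhds_zero_of_lt_one (by norm_num) (by norm_num)).const_mul r
    rw [mul_zero] at h1
    obtain ⟨N, hN⟩ := (h1.eventually (gt_mem_nhds (show 0 < min (ε / 2) (min 1 (t0 / 2)) by positivity))).exists
    exact ⟨N, by simpa [div_eq_mul_inv] using hN⟩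
  set r0 := r / 2 ^ N with hr0
  have hr0p : 0 < r0 := by positivity
  have hr0a : r0 < ε / 2 := lt_of_lt_of_le hN (min_le_left _ _)
  have hr0b : r0 < 1 := lt_of_lt_of_le hN ((min_le_right _ _).trans (min_le_left _ _))
  have hr0c : r0 < t0 / 2 := lt_of_lt_of_le hN ((min_le_right _ _).trans (min_le_right _ _))
  have hr0sq : r0 ^ 2 ≤ r0 := by nlinarith
  set ri : ℕ → ℝ := fun i => 2 ^ i * r0 with hri
  set ti : ℕ → ℝ := fun i => t0 + 8 / 3 * (ri i ^ 2 - r0 ^ 2) with hti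
  have hrip : ∀ i, 0 < ri i := fun i => by simp only [hri]; positivity
  have hris : ∀ i, ri (i + 1) = 2 * ri i := fun i => by simp only [hri]; ring
  have hri0 : ri 0 = r0 := by simp [hri]
  have hriN : ri N = r := by simp only [hri, hr0]; field_simp
  have hril : ∀ i, r0 ≤ ri i := fun i => by
    simp only [hri]
    have : (1:ℝ) ≤ 2 ^ i := one_le_pow₀ (by norm_num)
    nlinarith
  have hriu : ∀ i ≤ N, ri i ≤ r := fun i hi => by
    rw [← hriN]; simp only [hri]
    gcongr; norm_num
  have htis : ∀ i, ti (i + 1) = ti i + 8 * ri i ^ 2 := fun i => by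
    simp only [hti, hris]; ring
  have hti0 : ∀ i, t0 ≤ ti i := fun i => by
    have := pow_le_pow_left₀ hr0p.le (hril i) 2
    simp only [hti]; linarith
  have htiu : ∀ i, ti i ≤ t0 + 8 / 3 * ri i ^ 2 := fun i => by
    simp only [hti]; nlinarith
  have htir : ∀ i ≤ N, ti i < T := fun i hi => by
    have := pow_le_pow_left₀ (hrip i).le (hriu i hi) 2
    have := htiu i
    linarith
  have htb : ∀ i, 0 < ti i - ri i ^ 2 := by
    intro i
    rcases i with _ | i
    · simp only [hti, hri0]; linarith
    · have := hti0 i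
      rw [htis, hris]
      nlinarith [hrip i]
  set P : ℕ → Prop := fun i => volume ((closedBall x (ri i) ×ˢ Icc (ti i - ri i ^ 2) (ti i)) \ U) ≤
    ENNReal.ofReal (δ * ri i ^ (n + 2)) with hP
  have hP0 : P 0 := by
    have : (closedBall x (ri 0) ×ˢ Icc (ti 0 - ri 0 ^ 2) (ti 0)) \ U = ∅ := by
      rw [diff_eq_empty]
      rintro ⟨z, τ⟩ hz
      have hz1 : z ∈ closedBall x (ri 0) := hz.1
      have hz2 : τ ∈ Icc (ti 0 - ri 0 ^ 2) (ti 0) := hz.2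
      have e : ti 0 = t0 := by simp [hti, hri0]
      rw [e, hri0] at hz2
      rw [hri0, mem_closedBall] at hz1
      apply hball
      rw [mem_ball, Prod.dist_eq, max_lt_iff]
      refine ⟨by simp only; linarith, ?_⟩
      simp only [Real.dist_eq, abs_lt]
      constructor <;> linarith [hz2.1, hz2.2]
    simp only [hP, this, measure_empty]; exact zero_le
  have hcl : ∀ i ≤ N, closedBall x (ri i) ⊆ Ω := fun i hi =>
    (closedBall_subset_ball (by linarith [hriu i hi])).trans hXb
  have hdense : ∀ i ≤ N, P i → ∀ y ∈ ball x (ri i / 2), a / 2 ≤ u (y, ti i) := by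
    intro i hi hPi
    exact hD T Ω u θ p H k x (ri i) (ti i) a hu (hrip i) ha (hcl i hi) (htb i) (htir i hi) hPi
  have hPN : ¬ P N := by
    intro h
    obtain ⟨z, hz, hz2⟩ := hno (ti N) (hti0 N) (by have := htiu N; rw [hriN] at this; linarith)
    have := hdense N le_rfl h z (by rw [hriN]; exact hz)
    linarith
  obtain ⟨i, hi, hPi, hPi1⟩ := nat_switch hP0 hPN
  have hd := hdense i hi.le hPi
  refine ⟨ri (i + 1), ti (i + 1), hrip _, hriu _ hi, ?_, ?_, ?_, (not_le.1 hPi1).le⟩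
  · have := htiu (i + 1); nlinarith [hrip (i + 1)]
  · have := hti0 i
    rw [htis, hris]; nlinarith [hrip i]
  · rintro ⟨z, τ⟩ hz
    have hz1 : z ∈ closedBall x (ri (i + 1)) := hz.1
    have hz2 : τ ∈ Icc (ti (i + 1) - ri (i + 1) ^ 2) (ti (i + 1)) := hz.2
    rw [htis, hris] at hz2
    rw [hris, mem_closedBall] at hz1
    have hri1 := hriu (i + 1) hi
    rw [hris] at hri1
    have hτT : τ < T := lt_of_le_of_lt (by rw [htis]; exact hz2.2) (htir (i + 1) hi)
    have := hM T Ω u θ p H k x z (ri i / 2) (ti i) τ (a / 2) hu (by have := hrip i; positivity) (by positivity)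
      ?_ (by linarith) (by linarith [hti0 i]) hτT (by nlinarith [hz2.1, hrip i]) (by nlinarith [hz2.2, hrip i])
      hd z (mem_ball_self (by have := hrip i; positivity))
    · have h3 : 0 < c * a := by positivity
      linarith
    · intro w hw
      have h4 : w ∈ closedBall x (2 * ri i) :=
        (convex_closedBall x (2 * ri i)).segment_subset (mem_closedBall_self (by have := hrip i; positivity)) hz1 hw
      rw [mem_closedBall] at h4
      exact (ball_subset_ball' (by linarith)).trans hXb

theorem spot_step {n : ℕ} (hn : 0 < n) {ν : ℝ} (hν : 1 ≤ ν) (S : ℝ) (hS : 0 ≤ S) :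
    ∃ c ε, 0 < c ∧ c < 1 ∧ 0 < ε ∧ SpotStep n ν S c ε := by
  obtain ⟨δ, hδ, hD⟩ := dense_prop hn hν S hS
  obtain ⟨c0, hc0, hM⟩ := move hn hν S hS 4 32 (by norm_num) (by norm_num)
  set ω : ℝ := (volume (ball (0 : En n) 1)).toReal with hω
  have hω0 : 0 < ω := ENNReal.toReal_pos (measure_ball_pos _ _ one_pos).ne' measure_ball_lt_top.ne
  set CC : ℝ := 4 ^ n * ω * 34 with hCC
  have hCC0 : 0 < CC := by positivity
  refine ⟨min (c0 / 4) (1 / 2), δ / CC, by positivity, lt_of_le_of_lt (min_le_right _ _) (by norm_num),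
    by positivity, ?_⟩
  intro T Ω u θ p H k r a E hu hr ha hE hno
  set U : Set (En n × ℝ) := {X | X ∈ Ω ×ˢ Ioo (0:ℝ) T ∧ a < u X} with hU
  have hUo : IsOpen U := hu.c21.cw.isOpen_inter_preimage hu.c21.op isOpen_Ioi
  have hcyl := fun (X : En n × ℝ) (hX : X ∈ E) => spot_cyl hD hM hδ hc0 hu hr ha (hE X hX).1 (hE X hX).2.1
    (hE X hX).2.2.1 (hE X hX).2.2.2 (hno X hX)
  choose! r' t' h1 h2 h3 h4 h5 h6 using hcyl
  set B : En n × ℝ → Set (En n × ℝ) := fun X => closedBall X.1 (r' X) ×ˢ Icc (t' X - r' X ^ 2) (t' X) with hB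
  obtain ⟨V, hVE, hVd, hVc⟩ := Vitali.exists_disjoint_subfamily_covering_enlargement B E r' 2 (by norm_num)
    (fun X hX => (h1 X hX).le) r (fun X hX => h2 X hX) (fun X hX => ⟨(X.1, t' X), mk_mem_prod
      (mem_closedBall_self (h1 X hX).le) ⟨by nlinarith [h1 X hX], le_rfl⟩⟩)
  have hVcount : V.Countable := by
    refine hVd.countable_of_nonempty_interior fun X hX => ?_
    have hr' := h1 X (hVE hX)
    simp only [hB, interior_prod_eq, interior_Icc]
    refine ⟨(X.1, t' X - r' X ^ 2 / 2), mk_mem_prod ?_ ⟨by nlinarith, by nlinarith⟩⟩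
    exact ball_subset_interior_closedBall (mem_ball_self hr')
  set D : Set (En n × ℝ) := ⋃ X ∈ V, (B X \ U) with hDdef
  have hBm : ∀ X, MeasurableSet (B X \ U) := fun X =>
    ((isClosed_closedBall.prod isClosed_Icc).measurableSet).diff hUo.measurableSet
  have hDm : MeasurableSet D := MeasurableSet.biUnion hVcount fun X _ => hBm X
  have hDvol : volume D = ∑' X : V, volume (B X \ U) :=
    measure_biUnion hVcount (hVd.mono fun X => diff_subset) (fun X _ => hBm X)
  have hEU : E ⊆ U := fun X hX => by
    obtain ⟨q1, q2, q3, q4⟩ := hE X hX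
    exact ⟨⟨q2 (mem_ball_self (by positivity)), q3, by nlinarith⟩, q1⟩
  have hdisj : Disjoint E D := by
    rw [Set.disjoint_left]
    intro X hX hXD
    simp only [hDdef, mem_iUnion] at hXD
    obtain ⟨Y, _, hY⟩ := hXD
    exact hY.2 (hEU hX)
  -- covering
  have hcov : E ⊆ ⋃ X ∈ V, closedBall X.1 (4 * r' X) ×ˢ Icc (t' X - 17 * r' X ^ 2) (t' X + 17 * r' X ^ 2) := by
    intro X hX
    obtain ⟨Y, hY, ⟨⟨z, τ⟩, hz1, hz2⟩, hle⟩ := hVc X hX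
    simp only [mem_iUnion]
    refine ⟨Y, hY, ?_⟩
    have a1 : z ∈ closedBall X.1 (r' X) := hz1.1
    have a2 : τ ∈ Icc (t' X - r' X ^ 2) (t' X) := hz1.2
    have b1 : z ∈ closedBall Y.1 (r' Y) := hz2.1
    have b2 : τ ∈ Icc (t' Y - r' Y ^ 2) (t' Y) := hz2.2
    rw [mem_closedBall] at a1 b1
    have hXX := h1 X hX
    have hYY := h1 Y (hVE hY)
    have hsq : r' X ^ 2 ≤ 4 * r' Y ^ 2 := by nlinarith
    have e3 := h3 X hX
    have e4 := h4 X hX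
    refine mk_mem_prod ?_ ⟨?_, ?_⟩
    · rw [mem_closedBall]
      have := dist_triangle_left X.1 Y.1 z
      linarith
    · nlinarith [a2.1, a2.2, b2.1, b2.2]
    · nlinarith [a2.1, a2.2, b2.1, b2.2]
  have hEvol : ENNReal.ofReal (δ / CC) * volume E ≤ volume D := by
    calc ENNReal.ofReal (δ / CC) * volume E ≤ ENNReal.ofReal (δ / CC) *
          ∑' X : V, volume (closedBall X.1.1 (4 * r' X) ×ˢ Icc (t' X - 17 * r' X ^ 2) (t' X + 17 * r' X ^ 2)) := by
          refine mul_le_mul_right ((measure_mono hcov).trans ?_) _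
          exact measure_biUnion_le volume hVcount _
      _ = ∑' X : V, ENNReal.ofReal (δ / CC) *
          volume (closedBall X.1.1 (4 * r' X) ×ˢ Icc (t' X - 17 * r' X ^ 2) (t' X + 17 * r' X ^ 2)) :=
          ENNReal.tsum_mul_left.symm
      _ ≤ ∑' X : V, volume (B X \ U) := by
          refine ENNReal.tsum_le_tsum fun X => ?_
          have hXX := h1 X.1 (hVE X.2)
          refine le_trans (le_of_eq ?_) (h6 X.1 (hVE X.2))
          rw [vol_cyl _ (by positivity), ← ENNReal.ofReal_mul (by positivity)]
          congr 1
          rw [← hω, hCC]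
          field_simp
          ring
      _ = volume D := hDvol.symm
  calc volume E + ENNReal.ofReal (δ / CC) * volume E ≤ volume E + volume D := by gcongr
    _ = volume (E ∪ D) := (measure_union hdisj hDm).symm
    _ ≤ _ := by
      refine measure_mono ?_
      rintro X (hX | hX)
      · refine ⟨?_, X, hX, by simpa using hr.le, le_rfl, by nlinarith⟩
        have := (hE X hX).1
        have h7 : min (c0 / 4) (1 / 2) ≤ 1 / 2 := min_le_right _ _
        nlinarith
      · simp only [hDdef, mem_iUnion] at hX
        obtain ⟨Y, hY, hX⟩ := hX
        have hYE := hVE hY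
        have b0 := hX.1
        have b1 : X.1 ∈ closedBall Y.1 (r' Y) := hX.1.1
        have b2 : X.2 ∈ Icc (t' Y - r' Y ^ 2) (t' Y) := hX.1.2
        have hYY := h1 Y hYE
        have e2 := h2 Y hYE
        have hsq : r' Y ^ 2 ≤ r ^ 2 := by gcongr
        refine ⟨?_, Y, hYE, (mem_closedBall.1 b1).trans e2, (h4 Y hYE).trans b2.1, ?_⟩
        · refine lt_of_le_of_lt ?_ (h5 Y hYE X b0)
          gcongr
          exact min_le_left _ _
        · exact b2.2.trans ((h3 Y hYE).trans (by linarith))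

def SpotProp (n : ℕ) (ν S κ δ ε c : ℝ) : Prop :=
  ∀ (T : ℝ) (Ω : Set (En n)) (u θ : En n × ℝ → ℝ) (p : En n × ℝ → En n)
    (H : En n × ℝ → (En n →L[ℝ] En n)) (k : En n → ℝ) (x0 : En n) (t0 ρ a : ℝ) (E : Set (En n × ℝ)),
    Sol ν S T Ω u θ p H k → 0 < ρ → 0 < a → E ⊆ closedBall x0 ρ ×ˢ Icc (t0 - ρ ^ 2) t0 →
    (∀ X ∈ E, a < u X ∧ ball X.1 (κ * ρ) ⊆ Ω ∧ 0 < X.2 ∧ X.2 + ρ ^ 2 < T) →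
    ENNReal.ofReal (δ * ρ ^ (n + 2)) ≤ volume E →
    ∃ (x' : En n) (t' : ℝ), ball x' (κ / 2 * ρ) ⊆ Ω ∧ dist x' x0 ≤ 2 * ρ ∧ 0 < t' ∧ t0 - ρ ^ 2 ≤ t' ∧
      t' ≤ t0 + ρ ^ 2 ∧ ∀ x ∈ ball x' (ε * ρ), c * a ≤ u (x, t')

theorem spot {n : ℕ} (hn : 0 < n) {ν : ℝ} (hν : 1 ≤ ν) (S : ℝ) (hS : 0 ≤ S) (κ δ : ℝ) (hκ : 0 < κ)
    (hκ1 : κ ≤ 1) (hδ : 0 < δ) :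
    ∃ ε c, 0 < ε ∧ 0 < c ∧ c < 1 ∧ SpotProp n ν S κ δ ε c := by
  obtain ⟨c1, ε1, hc1, hc1', hε1, hst⟩ := spot_step hn hν S hS
  set ω : ℝ := (volume (ball (0 : En n) 1)).toReal with hω
  have hω0 : 0 < ω := ENNReal.toReal_pos (measure_ball_pos _ _ one_pos).ne' measure_ball_lt_top.ne
  obtain ⟨K, hK⟩ : ∃ K : ℕ, 2 ^ n * ω * 2 < δ * (1 + ε1) ^ K := by
    obtain ⟨K, hK⟩ := pow_unbounded_of_one_lt (2 ^ n * ω * 2 / δ) (show 1 < 1 + ε1 by linarith)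
    exact ⟨K, by rw [div_lt_iff₀ hδ] at hK; linarith⟩
  set q : ℝ := κ / (8 * (K + 1)) with hq
  have hq0 : 0 < q := by positivity
  have hqK : q * (K + 1) = κ / 8 := by rw [hq]; field_simp
  have hq8 : q ≤ κ / 8 := by
    have : (0:ℝ) ≤ K := Nat.cast_nonneg K
    nlinarith
  refine ⟨q / 2, c1 ^ (K + 1) / 2, by positivity, by positivity, ?_, ?_⟩
  · have : c1 ^ (K + 1) ≤ 1 := pow_le_one₀ hc1.le hc1'.le
    linarith
  intro T Ω u θ p H k x0 t0 ρ a E hu hρ ha hE hEu hvol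
  by_contra hcon
  set r := q * ρ with hr
  have hr0 : 0 < r := by positivity
  have hρ2 : 0 < ρ ^ 2 := by positivity
  -- the sets
  set F : ℕ → Set (En n × ℝ) := fun j => {X | c1 ^ j * a < u X ∧ ∃ X0 ∈ E, dist X.1 X0.1 ≤ j * r ∧ X0.2 ≤ X.2 ∧
    X.2 ≤ X0.2 + j * (3 * r ^ 2)} with hF
  have hjr : ∀ j : ℕ, j ≤ K → j * r + r ≤ κ / 8 * ρ := by
    intro j hj
    have hj' : (j:ℝ) ≤ K := by exact_mod_cast hj
    have : (j * r + r) ≤ (q * (K + 1)) * ρ := by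
      rw [hr]; have : 0 < q * ρ := hr0
      nlinarith
    rwa [hqK] at this
  have hjr2 : ∀ j : ℕ, j ≤ K → j * (3 * r ^ 2) + 3 * r ^ 2 ≤ ρ ^ 2 / 2 := by
    intro j hj
    have h1 := hjr j hj
    have h2 : r ≤ 1 / 8 * ρ := by rw [hr]; gcongr; linarith
    have h3 : κ / 8 * ρ ≤ 1 / 8 * ρ := by gcongr
    have h4 : j * r + r ≤ 1 / 8 * ρ := h1.trans h3
    have h5 : (j * r + r) * r ≤ (1 / 8 * ρ) * (1 / 8 * ρ) := by gcongr
    nlinarith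
  have hFprop : ∀ j ≤ K, ∀ X ∈ F j, ball X.1 (4 * r) ⊆ Ω ∧ ball X.1 (κ / 2 * ρ) ⊆ Ω ∧ 0 < X.2 ∧ X.2 + 3 * r ^ 2 < T ∧
      dist X.1 x0 ≤ 2 * ρ ∧ t0 - ρ ^ 2 ≤ X.2 ∧ X.2 + 3 * r ^ 2 ≤ t0 + ρ ^ 2 := by
    rintro j hj X ⟨-, X0, hX0, hd, ht1, ht2⟩
    obtain ⟨-, e2, e3, e4⟩ := hEu X0 hX0
    have m1 : X0.1 ∈ closedBall x0 ρ := (hE hX0).1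
    have m2 : X0.2 ∈ Icc (t0 - ρ ^ 2) t0 := (hE hX0).2
    have h1 := hjr j hj
    have h2 := hjr2 j hj
    have h4 : r ≤ κ / 8 * ρ := by rw [hr]; gcongr
    have h5 : 0 ≤ (j:ℝ) * r := by positivity
    have hκρ : κ * ρ ≤ ρ := by nlinarith
    refine ⟨(ball_subset_ball' ?_).trans e2, (ball_subset_ball' ?_).trans e2, by linarith, by linarith, ?_,
      by linarith [m2.1], by linarith [m2.2]⟩
    · linarith
    · linarith
    · have := dist_triangle X.1 X0.1 x0
      rw [mem_closedBall] at m1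
      linarith
  have hgrow : ∀ j ≤ K, volume (F j) + ENNReal.ofReal ε1 * volume (F j) ≤ volume (F (j + 1)) := by
    intro j hj
    refine (hst T Ω u θ p H k r (c1 ^ j * a) (F j) hu hr0 (by positivity) ?_ ?_).trans (measure_mono ?_)
    · intro X hX
      obtain ⟨g1, g2, g3, g4, -⟩ := hFprop j hj X hX
      exact ⟨hX.1, g1, g3, g4⟩
    · intro X hX t ht1 ht2
      by_contra hc
      push Not at hc
      obtain ⟨g1, g2, g3, g4, g5, g6, g7⟩ := hFprop j hj X hX
      refine hcon ⟨X.1, t, g2, g5, by linarith, by linarith, by linarith, ?_⟩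
      intro x hx
      refine le_trans ?_ (hc x (by rw [hr]; rwa [div_mul_eq_mul_div] at hx))
      have : c1 ^ (K + 1) ≤ c1 ^ j := pow_le_pow_of_le_one hc1.le hc1'.le (by omega)
      nlinarith
    · rintro X ⟨q1, Y, ⟨-, X0, hX0, d1, d2, d3⟩, f1, f2, f3⟩
      refine ⟨by rw [pow_succ']; linarith, X0, hX0, ?_, by linarith, ?_⟩
      · push_cast
        have := dist_triangle X.1 Y.1 X0.1
        linarith
      · push_cast; linarith
  have hgrow2 : ∀ j ≤ K, ENNReal.ofReal ((1 + ε1) ^ j * (δ * ρ ^ (n + 2))) ≤ volume (F j) := by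
    intro j
    induction j with
    | zero =>
      intro _
      rw [pow_zero, one_mul]
      refine hvol.trans (measure_mono ?_)
      intro X hX
      refine ⟨by simpa using (hEu X hX).1, X, hX, by simp, le_rfl, by simp⟩
    | succ j ih =>
      intro hj
      have h1 := hgrow j (by omega)
      have h2 := ih (by omega)
      refine le_trans ?_ h1
      have e1 : (1 + ε1) ^ (j + 1) * (δ * ρ ^ (n + 2)) = (1 + ε1) ^ j * (δ * ρ ^ (n + 2)) +
        ε1 * ((1 + ε1) ^ j * (δ * ρ ^ (n + 2))) := by ring
      rw [e1, ENNReal.ofReal_add (by positivity) (by positivity), ENNReal.ofReal_mul hε1.le]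
      gcongr
  have hfin := hgrow2 K le_rfl
  have hub : volume (F K) ≤ volume (closedBall x0 (2 * ρ) ×ˢ Icc (t0 - ρ ^ 2) (t0 + ρ ^ 2) : Set (En n × ℝ)) := by
    refine measure_mono fun X hX => ?_
    obtain ⟨g1, g2, g3, g4, g5, g6, g7⟩ := hFprop K le_rfl X hX
    exact mk_mem_prod (mem_closedBall.2 g5) ⟨g6, by nlinarith⟩
  rw [vol_cyl _ (by positivity)] at hub
  have h9 := (ENNReal.ofReal_le_ofReal_iff (by rw [← hω]; nlinarith [show 0 ≤ (2 * ρ) ^ n * ω * ρ ^ 2 by positivity])).1 (hfin.trans hub)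
  rw [← hω] at h9
  have e2 : (2 * ρ) ^ n * ω * (t0 + ρ ^ 2 - (t0 - ρ ^ 2)) = 2 ^ n * ω * 2 * ρ ^ (n + 2) := by
    rw [mul_pow]; ring
  rw [e2, ← mul_assoc] at h9
  have h10 := le_of_mul_le_mul_right h9 (by positivity)
  linarith

def eta {n : ℕ} (y e : En n) (φ : En n → ℝ) (x : En n) : ℝ := ⟪x - y, e⟫ - φ ((x - y) - ⟪x - y, e⟫ • e)

structure Chart {n : ℕ} (Ω : Set (En n)) (R m : ℝ) (y e : En n) (φ : En n → ℝ) : Prop where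
  m0 : 0 ≤ m
  ne : ‖e‖ = 1
  lip : LipschitzWith (Real.toNNReal m) φ
  z : φ 0 = 0
  iff : ∀ x, x ∈ Ω ∩ ball y R ↔ dist x y < R ∧ φ ((x - y) - ⟪x - y, e⟫ • e) < ⟪x - y, e⟫

namespace Chart
variable {n : ℕ} {Ω : Set (En n)} {R m : ℝ} {y e : En n} {φ : En n → ℝ}

theorem mem (h : Chart Ω R m y e φ) {x : En n} (hx : dist x y < R) : x ∈ Ω ↔ 0 < eta y e φ x := by
  have := h.iff x
  constructor
  · intro hΩ
    have := (this.1 ⟨hΩ, hx⟩).2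
    unfold eta; linarith
  · intro h0
    unfold eta at h0
    exact (this.2 ⟨hx, by linarith⟩).1

theorem eta_self (h : Chart Ω R m y e φ) : eta y e φ y = 0 := by
  unfold eta; simp [h.z]

theorem eta_shift (h : Chart Ω R m y e φ) (x : En n) (q : ℝ) : eta y e φ (x + q • e) = eta y e φ x + q := by
  unfold eta
  have e1 : ⟪x + q • e - y, e⟫ = ⟪x - y, e⟫ + q := by
    rw [show x + q • e - y = (x - y) + q • e by abel, inner_add_left, inner_smul_left, real_inner_self_eq_norm_sq, h.ne]
    simp
  rw [e1]
  have e2 : x + q • e - y - (⟪x - y, e⟫ + q) • e = x - y - ⟪x - y, e⟫ • e := by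
    rw [add_smul]; abel
  rw [e2]; ring

theorem eta_lip (h : Chart Ω R m y e φ) (x x' : En n) : eta y e φ x - eta y e φ x' ≤ (1 + m) * dist x x' := by
  unfold eta
  have h1 := h.lip.dist_le_mul ((x - y) - ⟪x - y, e⟫ • e) ((x' - y) - ⟪x' - y, e⟫ • e)
  rw [Real.coe_toNNReal _ h.m0] at h1
  have e2 : ((x - y) - ⟪x - y, e⟫ • e) - ((x' - y) - ⟪x' - y, e⟫ • e) = (x - x') - ⟪x - x', e⟫ • e := by
    rw [show x - x' = (x - y) - (x' - y) by abel, inner_sub_left (x - y), sub_smul]; abel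
  have e3 : ‖(x - x') - ⟪x - x', e⟫ • e‖ ≤ ‖x - x'‖ := by
    have h2 : ‖(x - x') - ⟪x - x', e⟫ • e‖ ^ 2 ≤ ‖x - x'‖ ^ 2 := by
      rw [@norm_sub_sq_real, inner_smul_right, norm_smul, h.ne]
      rw [mul_one, Real.norm_eq_abs, sq_abs]
      nlinarith [sq_nonneg (⟪x - x', e⟫)]
    exact (pow_le_pow_iff_left₀ (norm_nonneg _) (norm_nonneg _) (by norm_num)).1 h2
  rw [dist_eq_norm ((x - y) - _), e2, Real.dist_eq] at h1
  have h3 : m * ‖(x - x') - ⟪x - x', e⟫ • e‖ ≤ m * ‖x - x'‖ := mul_le_mul_of_nonneg_left e3 h.m0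
  have h4 : ⟪x - y, e⟫ - ⟪x' - y, e⟫ ≤ ‖x - x'‖ := by
    rw [← inner_sub_left, show x - y - (x' - y) = x - x' by abel]
    have := real_inner_le_norm (x - x') e
    rwa [h.ne, mul_one] at this
  rw [dist_eq_norm]
  have h5 := neg_abs_le (φ ((x - y) - ⟪x - y, e⟫ • e) - φ ((x' - y) - ⟪x' - y, e⟫ • e))
  linarith

theorem cont (h : Chart Ω R m y e φ) : Continuous (eta y e φ) := by
  unfold eta
  have := h.lip.continuous
  fun_prop

theorem dist_shift (h : Chart Ω R m y e φ) (x z : En n) {q : ℝ} (hq : 0 ≤ q) : dist (x + q • e) z ≤ dist x z + q := by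
  have := dist_triangle (x + q • e) x z
  have h2 : dist (x + q • e) x = q := by rw [dist_eq_norm]; simp [norm_smul, h.ne, abs_of_nonneg hq]
  linarith

theorem shift (h : Chart Ω R m y e φ) {x : En n} (hx : x ∈ Ω) {q : ℝ} (hq : 0 ≤ q)
    (hd : dist x y + q < R) : x + q • e ∈ Ω := by
  have h1 := h.dist_shift x y hq
  rw [h.mem (by linarith), h.eta_shift]
  have := (h.mem (by linarith)).1 hx
  linarith

theorem ball_sub (h : Chart Ω R m y e φ) {x : En n} {q : ℝ} (hq : 0 < q) (hx : q ≤ eta y e φ x)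
    (hd : dist x y + q / (1 + m) ≤ R) : ball x (q / (1 + m)) ⊆ Ω := by
  intro w hw
  have h1 : dist w x < q / (1 + m) := hw
  have := dist_triangle w x y
  rw [h.mem (by linarith)]
  have h2 := h.eta_lip x w
  have hm := h.m0
  rw [lt_div_iff₀ (by linarith), dist_comm] at h1
  linarith

/-- points of the domain get deep after a shift -/
theorem ball_shift (h : Chart Ω R m y e φ) {x : En n} (hx : x ∈ Ω) {q : ℝ} (hq : 0 < q)
    (hd : dist x y + q + q / (1 + m) < R) : ball (x + q • e) (q / (1 + m)) ⊆ Ω := by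
  have hm := h.m0
  have hp : 0 < q / (1 + m) := by positivity
  refine h.ball_sub hq ?_ ?_
  · rw [h.eta_shift]
    have := (h.mem (by linarith)).1 hx
    linarith
  · have := h.dist_shift x y hq.le
    linarith

/-- balls in the domain remain in the domain when shifted up -/
theorem ball_up (h : Chart Ω R m y e φ) {x : En n} {d : ℝ} (hx : ball x d ⊆ Ω) {q : ℝ} (hq : 0 ≤ q)
    (hd : dist x y + d + q ≤ R) : ball (x + q • e) d ⊆ Ω := by
  intro w hw
  have h1 : dist w (x + q • e) < d := hw
  have h2 : w - q • e ∈ ball x d := by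
    rw [mem_ball]
    rw [dist_eq_norm] at h1 ⊢
    rwa [show w - q • e - x = w - (x + q • e) by abel]
  have h3 := dist_triangle (w - q • e) x y
  have h4 : dist (w - q • e) x < d := h2
  have := h.shift (hx h2) hq (by linarith)
  rwa [sub_add_cancel] at this

theorem seg_mem {x e z : En n} {q : ℝ} (hq : 0 ≤ q) (hz : z ∈ segment ℝ x (x + q • e)) :
    ∃ σ, 0 ≤ σ ∧ σ ≤ q ∧ z = x + σ • e := by
  rw [segment_eq_image'] at hz
  obtain ⟨θ, hθ, rfl⟩ := hz
  refine ⟨θ * q, mul_nonneg hθ.1 hq, by nlinarith [hθ.2], ?_⟩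
  simp only [add_sub_cancel_left, smul_smul]

theorem strip (h : Chart Ω R m y e φ) (x0 : En n) {ρ : ℝ} (hρ : 0 < ρ) {M : ℕ} (hM : 0 < M) :
    volume {x | x ∈ closedBall x0 ρ ∧ 0 ≤ eta y e φ x ∧ eta y e φ x < ρ / M} ≤
      ENNReal.ofReal ((2 * ρ) ^ n * (volume (ball (0 : En n) 1)).toReal / M) := by
  have hM' : (0:ℝ) < M := by exact_mod_cast hM
  set Z : Set (En n) := {x | x ∈ closedBall x0 ρ ∧ 0 ≤ eta y e φ x ∧ eta y e φ x < ρ / M} with hZ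
  have hc := h.cont
  have hZm : MeasurableSet Z := by
    refine isClosed_closedBall.measurableSet.inter (MeasurableSet.inter ?_ ?_)
    · exact (isClosed_le continuous_const hc).measurableSet
    · exact (isOpen_lt hc continuous_const).measurableSet
  set W : ℕ → Set (En n) := fun i => (fun x => x + (-((i:ℝ) * (ρ / M)) • e)) ⁻¹' Z with hW
  have hWv : ∀ i, volume (W i) = volume Z := fun i => measure_preimage_add_right volume _ Z
  have hWm : ∀ i, MeasurableSet (W i) := fun i => (measurable_add_const _) hZm
  have hWe : ∀ i, ∀ x ∈ W i, (i:ℝ) * (ρ / M) ≤ eta y e φ x ∧ eta y e φ x < ((i:ℝ) + 1) * (ρ / M) := by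
    intro i x hx
    have hx' : x + (-((i:ℝ) * (ρ / M)) • e) ∈ Z := hx
    obtain ⟨-, h1, h2⟩ := hx'
    rw [h.eta_shift] at h1 h2
    constructor <;> linarith
  have hρM : 0 < ρ / M := by positivity
  have hdis : Pairwise (Function.onFun Disjoint W) := by
    intro i j hij
    rw [Function.onFun, Set.disjoint_left]
    intro x hi hj
    obtain ⟨a1, a2⟩ := hWe i x hi
    obtain ⟨b1, b2⟩ := hWe j x hj
    have c1 : (i:ℝ) < j + 1 := lt_of_mul_lt_mul_right (a1.trans_lt b2) hρM.le
    have c2 : (j:ℝ) < i + 1 := lt_of_mul_lt_mul_right (b1.trans_lt a2) hρM.le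
    have c3 : i < j + 1 := by exact_mod_cast c1
    have c4 : j < i + 1 := by exact_mod_cast c2
    omega
  have h1 : ∑ i ∈ Finset.range M, volume (W i) = volume (⋃ i ∈ Finset.range M, W i) :=
    (measure_biUnion_finset (fun i _ j _ hij => hdis hij) (fun i _ => hWm i)).symm
  have h2 : (⋃ i ∈ Finset.range M, W i) ⊆ closedBall x0 (2 * ρ) := by
    intro x hx
    simp only [mem_iUnion, Finset.mem_range] at hx
    obtain ⟨i, hi, hx⟩ := hx
    have hx' : x + (-((i:ℝ) * (ρ / M)) • e) ∈ Z := hx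
    have h3 := mem_closedBall.1 hx'.1
    have h4 := h.dist_shift (x + (-((i:ℝ) * (ρ / M)) • e)) x0 (q := (i:ℝ) * (ρ / M)) (by positivity)
    rw [neg_smul, add_assoc, neg_add_cancel, add_zero, ← neg_smul] at h4
    have h5 : (i:ℝ) ≤ M := by exact_mod_cast hi.le
    have h6 : (i:ℝ) * (ρ / M) ≤ ρ := by
      calc (i:ℝ) * (ρ / M) ≤ M * (ρ / M) := by gcongr
        _ = ρ := by field_simp
    rw [mem_closedBall]; linarith
  simp only [hWv] at h1
  rw [Finset.sum_const, Finset.card_range, nsmul_eq_mul] at h1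
  have h3 := h1.le.trans (measure_mono h2)
  rw [Measure.addHaar_closedBall volume x0 (by positivity)] at h3
  have hω : 0 ≤ (volume (ball (0 : En n) 1)).toReal := ENNReal.toReal_nonneg
  rw [ENNReal.ofReal_div_of_pos hM', ENNReal.ofReal_mul (by positivity),
    ENNReal.ofReal_toReal measure_ball_lt_top.ne, ENNReal.le_div_iff_mul_le (by left; simpa using hM.ne') (by left; simp)]
  rw [mul_comm, ENNReal.ofReal_natCast]
  simpa using h3

end Chart

theorem frontier_cross {n : ℕ} {Ω : Set (En n)} (hΩ : IsOpen Ω) {p z : En n} (hp : p ∈ Ω) (hz : z ∉ Ω) :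
    ∃ w ∈ segment ℝ p z, w ∈ frontier Ω := by
  by_contra hc
  push Not at hc
  have hpre : IsPreconnected (segment ℝ p z) := (convex_segment p z).isPreconnected
  have hsub : segment ℝ p z ⊆ Ω ∪ (closure Ω)ᶜ := by
    intro w hw
    by_cases h1 : w ∈ Ω
    · exact Or.inl h1
    · right
      intro h2
      apply hc w hw
      rw [frontier, hΩ.interior_eq]
      exact ⟨h2, h1⟩
  obtain ⟨w, -, h1, h2⟩ := hpre Ω (closure Ω)ᶜ hΩ isClosed_closure.isOpen_compl hsub ⟨p, left_mem_segment ℝ p z, hp⟩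
    ⟨z, right_mem_segment ℝ p z, by
      rcases hsub (right_mem_segment ℝ p z) with h | h
      · exact absurd h hz
      · exact h⟩
  exact h2 (subset_closure h1)

theorem seg_back {n : ℕ} {P0 P1 z : En n} (hz : z ∈ segment ℝ P0 P1) {q : ℝ} (hq : 0 ≤ q) (hd : q < dist z P0) :
    ∃ w ∈ segment ℝ P0 P1, dist w z = q ∧ dist w P0 = dist z P0 - q := by
  have hzp : 0 < dist z P0 := lt_of_le_of_lt hq hd
  have hnorm : ‖z - P0‖ = dist z P0 := (dist_eq_norm _ _).symm
  refine ⟨P0 + (1 - q / dist z P0) • (z - P0), ?_, ?_, ?_⟩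
  · have h1 : P0 + (1 - q / dist z P0) • (z - P0) ∈ segment ℝ P0 z := by
      rw [segment_eq_image']
      refine ⟨1 - q / dist z P0, ⟨?_, ?_⟩, rfl⟩
      · rw [sub_nonneg, div_le_one hzp]; exact hd.le
      · have : 0 ≤ q / dist z P0 := by positivity
        linarith
    exact (convex_segment P0 P1).segment_subset (left_mem_segment ℝ P0 P1) hz h1
  · rw [dist_eq_norm]
    have : P0 + (1 - q / dist z P0) • (z - P0) - z = (-(q / dist z P0)) • (z - P0) := by
      rw [sub_smul, one_smul, neg_smul]; abel
    rw [this, norm_smul, hnorm, norm_neg, Real.norm_of_nonneg (by positivity)]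
    field_simp
  · rw [dist_eq_norm, add_sub_cancel_left, norm_smul, hnorm, Real.norm_of_nonneg]
    · field_simp
    · rw [sub_nonneg, div_le_one hzp]; exact hd.le

theorem seg_dist {n : ℕ} {P0 P1 z w : En n} (hz : z ∈ segment ℝ P0 P1) (hw : w ∈ segment ℝ P0 P1) :
    dist z w ≤ dist P1 P0 := by
  have h0 : P0 ∈ closedBall P0 (dist P1 P0) := mem_closedBall_self dist_nonneg
  have h1 : P1 ∈ closedBall P0 (dist P1 P0) := mem_closedBall.2 le_rfl
  have a0 : w ∈ closedBall P0 (dist P1 P0) := (convex_closedBall _ _).segment_subset h0 h1 hw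
  have h0' : P0 ∈ closedBall P1 (dist P1 P0) := mem_closedBall.2 (by rw [dist_comm])
  have h1' : P1 ∈ closedBall P1 (dist P1 P0) := mem_closedBall_self dist_nonneg
  have a1 : w ∈ closedBall P1 (dist P1 P0) := (convex_closedBall _ _).segment_subset h0' h1' hw
  have b0 : P0 ∈ closedBall w (dist P1 P0) := by rw [mem_closedBall, dist_comm]; exact a0
  have b1 : P1 ∈ closedBall w (dist P1 P0) := by rw [mem_closedBall, dist_comm]; exact a1
  exact mem_closedBall.1 ((convex_closedBall _ _).segment_subset b0 b1 hz)

theorem link_aux {n : ℕ} {ν S D β c m R L : ℝ} (hM : MoveProp n ν S D β c) (hc : 0 < c) (hc1 : c ≤ 1) (hm : 0 ≤ m)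
    {T : ℝ} {Ω : Set (En n)} {u θ : En n × ℝ → ℝ} {p : En n × ℝ → En n}
    {H : En n × ℝ → (En n →L[ℝ] En n)} {k : En n → ℝ} (hu : Sol ν S T Ω u θ p H k)
    (hch : ∀ y ∈ frontier Ω, ∃ e φ, Chart Ω R m y e φ) {ρ τ : ℝ} (hρ : 0 < ρ) (hL : L ≤ D * ρ)
    (hD : (1 + m) * 8 ≤ D) (hR : L + 12 * ρ + (1 + m) * 8 * ρ < R) (hτ : ρ ^ 2 ≤ τ) :
    ∀ i : ℕ, (2 * i + 1) * τ ≤ β * ρ ^ 2 → ∀ (P0 P1 : En n) (a t0 : ℝ), 0 < a → dist P1 P0 ≤ L →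
      ball P0 (4 * ρ) ⊆ Ω → ball P1 (4 * ρ) ⊆ Ω →
      (∀ z ∈ segment ℝ P0 P1, dist z P0 + i * (2 * ρ) ≤ dist P1 P0 → ball z (4 * ρ) ⊆ Ω) →
      0 < t0 → t0 + (2 * i + 1) * τ < T → (∀ x ∈ ball P0 ρ, a ≤ u (x, t0)) →
      ∀ x ∈ ball P1 (2 * ρ), c ^ (2 * i + 1) * a ≤ u (x, t0 + (2 * i + 1) * τ) := by
  have hτ0 : 0 < τ := lt_of_lt_of_le (by positivity) hτ
  intro i
  induction i with
  | zero =>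
    intro hβ P0 P1 a t0 ha hd hb0 hb1 hseg ht0 htT hu1
    simp only [Nat.cast_zero, mul_zero, zero_add, one_mul, zero_mul, add_zero, pow_one] at *
    refine hM T Ω u θ p H k P0 P1 ρ t0 (t0 + τ) a hu hρ ha (fun z hz => ?_) (hd.trans hL) ht0 htT (by linarith)
      (by linarith) hu1
    exact hseg z hz (seg_dist hz (left_mem_segment ℝ P0 P1))
  | succ i ih =>
    intro hβ P0 P1 a t0 ha hd hb0 hb1 hseg ht0 htT hu1
    by_cases hall : ∀ z ∈ segment ℝ P0 P1, ball z (4 * ρ) ⊆ Ω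
    · intro x hx
      have hi : (0:ℝ) ≤ ((i+1 : ℕ):ℝ) := Nat.cast_nonneg _
      have := hM T Ω u θ p H k P0 P1 ρ t0 (t0 + (2 * ((i+1 : ℕ):ℝ) + 1) * τ) a hu hρ ha hall (hd.trans hL) ht0 htT
        (by nlinarith) (by linarith) hu1 x hx
      refine le_trans ?_ this
      gcongr
      exact pow_le_of_le_one hc.le hc1 (by omega)
    push Not at hall
    obtain ⟨z, hz, hzb⟩ := hall
    rw [Set.not_subset] at hzb
    obtain ⟨w, hw, hwΩ⟩ := hzb
    have hP0Ω : P0 ∈ Ω := hb0 (mem_ball_self (by positivity))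
    have hP1Ω : P1 ∈ Ω := hb1 (mem_ball_self (by positivity))
    obtain ⟨y, hy, hyf⟩ := frontier_cross hu.op hP0Ω hwΩ
    obtain ⟨e, φ, h⟩ := hch y hyf
    -- distance bound
    have hdy : ∀ v ∈ segment ℝ P0 P1, dist v y ≤ L + 4 * ρ := by
      intro v hv
      have h1 : P0 ∈ closedBall v (L + 4 * ρ) := by
        rw [mem_closedBall]
        have := seg_dist (left_mem_segment ℝ P0 P1) hv
        linarith
      have h2 : w ∈ closedBall v (L + 4 * ρ) := by
        rw [mem_closedBall]
        have := seg_dist hz hv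
        have h3 := dist_triangle w z v
        have h4 : dist w z < 4 * ρ := hw
        linarith
      have := (convex_closedBall _ _).segment_subset h1 h2 hy
      rw [dist_comm]; exact this
    set q : ℝ := (1 + m) * 8 * ρ with hq
    have hq0 : 0 < q := by positivity
    have hqm : q / (1 + m) = 8 * ρ := by rw [hq]; field_simp
    have hup : ∀ v ∈ segment ℝ P0 P1, v ∈ Ω → ball (v + q • e) (4 * ρ) ⊆ Ω := by
      intro v hv hvΩ
      have h1 := hdy v hv
      have := h.ball_shift hvΩ hq0 (by rw [hqm]; linarith)
      rw [hqm] at this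
      exact (ball_subset_ball (by linarith)).trans this
    have hseg0 : ∀ v, v = P0 ∨ v = P1 → ∀ z ∈ segment ℝ v (v + q • e), ball z (4 * ρ) ⊆ Ω := by
      intro v hv z hz
      obtain ⟨σ, hσ0, hσ1, rfl⟩ := Chart.seg_mem hq0.le hz
      rcases hv with rfl | rfl
      · have := hdy v (left_mem_segment ℝ _ _)
        exact h.ball_up hb0 hσ0 (by linarith)
      · have := hdy v (right_mem_segment ℝ _ _)
        exact h.ball_up hb1 hσ0 (by linarith)
    have hdq : ∀ v : En n, dist (v + q • e) v ≤ D * ρ := by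
      intro v
      have := h.dist_shift v v hq0.le
      rw [dist_self] at this
      rw [hq] at this ⊢
      nlinarith
    have hi0 : (0:ℝ) ≤ i := Nat.cast_nonneg _
    push_cast at hβ htT hseg ⊢
    have hβ1 : τ ≤ β * ρ ^ 2 := by nlinarith
    have s1 := hM T Ω u θ p H k P0 (P0 + q • e) ρ t0 (t0 + τ) a hu hρ ha (hseg0 P0 (Or.inl rfl)) (hdq P0) ht0
      (by nlinarith) (by linarith) (by linarith) hu1
    have hdd : dist (P1 + q • e) (P0 + q • e) = dist P1 P0 := dist_add_right _ _ _
    have s2 := ih (by nlinarith) (P0 + q • e) (P1 + q • e) (c * a) (t0 + τ) (by positivity)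
      (by rw [hdd]; exact hd)
      (hup P0 (left_mem_segment ℝ _ _) hP0Ω) (hup P1 (right_mem_segment ℝ _ _) hP1Ω) ?_ (by linarith) (by nlinarith)
      (fun x hx => s1 x (ball_subset_ball (by linarith) hx))
    · have s3 := hM T Ω u θ p H k (P1 + q • e) P1 ρ (t0 + τ + (2 * i + 1) * τ) (t0 + (2 * (i + 1) + 1) * τ)
        (c ^ (2 * i + 1) * (c * a)) hu hρ (by positivity) (by rw [segment_symm]; exact hseg0 P1 (Or.inr rfl))
        (by rw [dist_comm]; exact hdq P1) (by nlinarith) (by linarith) (by nlinarith) (by nlinarith)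
        (fun x hx => s2 x (ball_subset_ball (by linarith) hx))
      intro x hx
      refine le_trans (le_of_eq ?_) (s3 x hx)
      ring
    · intro z' hz' hdz
      have hv : z' - q • e ∈ segment ℝ P0 P1 := by
        rw [segment_eq_image'] at hz' ⊢
        obtain ⟨σ, hσ, rfl⟩ := hz'
        refine ⟨σ, hσ, ?_⟩
        simp only [add_sub_add_right_eq_sub]
        abel
      have hzd : dist (z' - q • e) P0 = dist z' (P0 + q • e) := by
        rw [dist_eq_norm, dist_eq_norm]; congr 1; abel
      rw [hdd, ← hzd] at hdz
      rw [show z' = (z' - q • e) + q • e by abel]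
      refine hup _ hv ?_
      by_cases hnear : dist (z' - q • e) P0 ≤ 2 * ρ
      · exact hb0 (mem_ball.2 (by linarith))
      · push Not at hnear
        obtain ⟨w', hw', d1, d2⟩ := seg_back hv (by positivity : 0 ≤ 2 * ρ) hnear
        refine hseg w' hw' (by linarith) ?_
        rw [mem_ball, dist_comm]; linarith

/-- rise along the vertical direction, doubling the radius at every step -/
theorem rise {n : ℕ} {ν S D β c m R : ℝ} (hM : MoveProp n ν S D β c) (hβ : 1 ≤ β) (hc : 0 < c) (hm : 0 ≤ m)
    {T : ℝ} {Ω : Set (En n)} {u θ : En n × ℝ → ℝ} {p : En n × ℝ → En n}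
    {H : En n × ℝ → (En n →L[ℝ] En n)} {k : En n → ℝ} (hu : Sol ν S T Ω u θ p H k)
    {y e x' : En n} {φ : En n → ℝ} (h : Chart Ω R m y e φ) {ρ0 t0 a : ℝ} (hρ : 0 < ρ0) (ha : 0 < a)
    (hD : (1 + m) * 8 ≤ D) (hb : ball x' (4 * ρ0) ⊆ Ω) (ht0 : 0 < t0) (hu1 : ∀ x ∈ ball x' ρ0, a ≤ u (x, t0)) :
    ∀ N : ℕ, dist x' y + 8 * 2 ^ N * ρ0 + (1 + m) * 8 * (2 ^ N * ρ0) < R → t0 + (2 ^ N * ρ0) ^ 2 < T →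
      ∀ x ∈ ball (x' + ((1 + m) * 8 * (2 ^ N * ρ0 - ρ0)) • e) (2 ^ N * ρ0),
        c ^ N * a ≤ u (x, t0 + ((2 ^ N * ρ0) ^ 2 - ρ0 ^ 2) / 3) := by
  intro N
  induction N with
  | zero => 
    intro _ _ x hx
    simp only [pow_zero, one_mul, sub_self, mul_zero, zero_smul, add_zero, zero_div] at hx ⊢
    exact hu1 x hx
  | succ N ih =>
    intro hR hT
    set ρ := 2 ^ N * ρ0 with hρdef
    have hρp : 0 < ρ := by positivity
    have e0 : (2:ℝ) ^ (N + 1) * ρ0 = 2 * ρ := by rw [hρdef]; ring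
    have e0' : 8 * (2:ℝ) ^ (N + 1) * ρ0 = 16 * ρ := by rw [hρdef]; ring
    have e1 : 8 * (2:ℝ) ^ N * ρ0 = 8 * ρ := by rw [hρdef]; ring
    rw [e0, e0'] at hR
    rw [e0] at hT
    have hq : 0 < (1 + m) * 8 * ρ := by positivity
    have hle : ρ0 ≤ ρ := by
      have : (1:ℝ) ≤ 2 ^ N := one_le_pow₀ (by norm_num)
      rw [hρdef]; nlinarith
    have i1 := ih (by rw [e1]; linarith) (by nlinarith)
    set P0 := x' + ((1 + m) * 8 * (ρ - ρ0)) • e with hP0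
    have hP1 : x' + ((1 + m) * 8 * (2 ^ (N + 1) * ρ0 - ρ0)) • e = P0 + ((1 + m) * 8 * ρ) • e := by
      rw [e0, hP0, add_assoc, ← add_smul]; congr 2; ring
    have hx'Ω : x' ∈ Ω := hb (mem_ball_self (by positivity))
    have i2 := hM T Ω u θ p H k P0 (P0 + ((1 + m) * 8 * ρ) • e) ρ (t0 + (ρ ^ 2 - ρ0 ^ 2) / 3)
      (t0 + (ρ ^ 2 - ρ0 ^ 2) / 3 + ρ ^ 2) (c ^ N * a) hu hρp (by positivity) ?_ ?_ (by nlinarith)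
      (by nlinarith) (by linarith) (by nlinarith) i1
    · rw [hP1, e0]
      intro x hx
      have i3 := i2 x hx
      rw [show t0 + ((2 * ρ) ^ 2 - ρ0 ^ 2) / 3 = t0 + (ρ ^ 2 - ρ0 ^ 2) / 3 + ρ ^ 2 by ring]
      refine le_trans (le_of_eq ?_) i3
      ring
    · intro z hz
      obtain ⟨σ, hσ0, hσ1, rfl⟩ := Chart.seg_mem hq.le hz
      have e2 : P0 + σ • e = x' + ((1 + m) * 8 * (ρ - ρ0) + σ) • e := by
        rw [hP0, add_assoc, ← add_smul]
      rw [e2]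
      set g := (1 + m) * 8 * (ρ - ρ0) + σ with hg
      have hg0 : 0 ≤ (1 + m) * 8 * (ρ - ρ0) := mul_nonneg (by positivity) (by linarith)
      have hgu : g ≤ (1 + m) * 8 * (2 * ρ) := by
        have : 0 < (1 + m) * 8 * ρ0 := by positivity
        rw [hg]; nlinarith
      rcases Nat.eq_zero_or_pos N with hN | hN
      · have : ρ = ρ0 := by rw [hρdef, hN]; simp
        rw [this]
        rw [this] at hR hgu
        refine h.ball_up hb (by linarith) (by linarith)
      · have h2 : 2 * ρ0 ≤ ρ := by
          have : (2:ℝ) ^ 1 ≤ 2 ^ N := pow_le_pow_right₀ (by norm_num) hN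
          rw [hρdef]; nlinarith
        have hge : (1 + m) * 4 * ρ ≤ g := by nlinarith
        have e3 : (1 + m) * 4 * ρ / (1 + m) = 4 * ρ := by field_simp
        have hm' : 0 < (1 + m) * 4 * ρ := by positivity
        have hgp : 0 ≤ g := by linarith
        have h4 := h.dist_shift x' y hgp
        have h5 := h.ball_sub (x := x' + g • e) hm' (by
          rw [h.eta_shift]
          have := (h.mem (x := x') (by linarith)).1 hx'Ω
          linarith) (by rw [e3]; linarith)
        rwa [e3] at h5
    · have := h.dist_shift P0 P0 hq.le
      rw [dist_self] at this
      nlinarith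

theorem MoveProp.mono {n : ℕ} {ν S D β c c' : ℝ} (h : MoveProp n ν S D β c) (hc : c' ≤ c) : MoveProp n ν S D β c' := by
  intro T Ω u θ p H k x0 x1 ρ t0 t1 a h1 h2 h3 h4 h5 h6 h7 h8 h9 h10 x hx
  exact (mul_le_mul_of_nonneg_right hc h3.le).trans (h T Ω u θ p H k x0 x1 ρ t0 t1 a h1 h2 h3 h4 h5 h6 h7 h8 h9 h10 x hx)

theorem strip_remove {n : ℕ} {Ω : Set (En n)} {R m : ℝ} {y e : En n} {φ : En n → ℝ}
    (h : Chart Ω R m y e φ) {x0 : En n} {t0 ρ δ : ℝ} (hρ : 0 < ρ) (hδ : 0 < δ) {M : ℕ} (hM : 0 < M)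
    (hMδ : 2 ^ n * (volume (ball (0 : En n) 1)).toReal / M ≤ δ / 2) (hR : dist x0 y + ρ < R)
    {E : Set (En n × ℝ)} (hE : E ⊆ closedBall x0 ρ ×ˢ Icc (t0 - ρ ^ 2) t0) (hEΩ : ∀ X ∈ E, X.1 ∈ Ω)
    (hv : ENNReal.ofReal (δ * ρ ^ (n + 2)) ≤ volume E) :
    ENNReal.ofReal (δ / 2 * ρ ^ (n + 2)) ≤ volume (E ∩ {X | ρ / M ≤ eta y e φ X.1}) := by
  set Z : Set (En n) := {x | x ∈ closedBall x0 ρ ∧ 0 ≤ eta y e φ x ∧ eta y e φ x < ρ / M} with hZ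
  have h1 : E ⊆ (E ∩ {X | ρ / M ≤ eta y e φ X.1}) ∪ (Z ×ˢ Icc (t0 - ρ ^ 2) t0) := by
    intro X hX
    have a1 : X.1 ∈ closedBall x0 ρ := (hE hX).1
    have a2 : X.2 ∈ Icc (t0 - ρ ^ 2) t0 := (hE hX).2
    by_cases hc : ρ / M ≤ eta y e φ X.1
    · exact Or.inl ⟨hX, hc⟩
    · right
      refine ⟨⟨a1, ?_, not_le.1 hc⟩, a2⟩
      refine ((h.mem ?_).1 (hEΩ X hX)).le
      have := dist_triangle X.1 x0 y
      rw [mem_closedBall] at a1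
      linarith
  have h2 : volume (Z ×ˢ Icc (t0 - ρ ^ 2) t0 : Set (En n × ℝ)) ≤ ENNReal.ofReal (δ / 2 * ρ ^ (n + 2)) := by
    rw [Measure.volume_eq_prod, Measure.prod_prod, Real.volume_Icc]
    refine (mul_le_mul_left (h.strip x0 hρ hM) _).trans ?_
    have hω : 0 ≤ (volume (ball (0 : En n) 1)).toReal := ENNReal.toReal_nonneg
    rw [← ENNReal.ofReal_mul (by positivity)]
    refine ENNReal.ofReal_le_ofReal ?_
    calc (2 * ρ) ^ n * (volume (ball (0 : En n) 1)).toReal / M * (t0 - (t0 - ρ ^ 2))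
        = (2 ^ n * (volume (ball (0 : En n) 1)).toReal / M) * ρ ^ (n + 2) := by rw [mul_pow]; ring
      _ ≤ _ := by gcongr
  have h3 := hv.trans ((measure_mono h1).trans (measure_union_le _ _))
  have h4 : ENNReal.ofReal (δ * ρ ^ (n + 2)) = ENNReal.ofReal (δ / 2 * ρ ^ (n + 2)) + ENNReal.ofReal (δ / 2 * ρ ^ (n + 2)) := by
    rw [← ENNReal.ofReal_add (by positivity) (by positivity)]; congr 1; ring
  rw [h4] at h3
  exact (ENNReal.add_le_add_iff_right ENNReal.ofReal_ne_top).1 (h3.trans (add_le_add_right h2 _))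

def CarlProp (n : ℕ) (ν S m δ μ c : ℝ) (q : ℕ) : Prop :=
  ∀ (T : ℝ) (Ω : Set (En n)) (u θ : En n × ℝ → ℝ) (p : En n × ℝ → En n)
    (H : En n × ℝ → (En n →L[ℝ] En n)) (k : En n → ℝ) (R : ℝ) (y e : En n) (φ : En n → ℝ)
    (r s : ℝ) (x0 : En n) (t0 ρ a : ℝ),
    Sol ν S T Ω u θ p H k → (∀ y ∈ frontier Ω, ∃ e φ, Chart Ω R m y e φ) → Chart Ω R m y e φ →
    0 < r → 2 * r < R → s + 2 * r ^ 2 < T → dist x0 y ≤ 5 / 4 * r → s - 2 * r ^ 2 ≤ t0 → t0 ≤ s → 0 < t0 - ρ ^ 2 →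
    0 < ρ → ρ ≤ μ * r → 0 < a →
    ENNReal.ofReal (δ * ρ ^ (n + 2)) ≤
      volume {X : En n × ℝ | X ∈ closedBall x0 ρ ×ˢ Icc (t0 - ρ ^ 2) t0 ∧ X.1 ∈ Ω ∧ a < u X} →
    c * (ρ / r) ^ q * a ≤ u (y + r • e, s + r ^ 2)

set_option maxHeartbeats 6000000 in
theorem carl {n : ℕ} (hn : 0 < n) {ν : ℝ} (hν : 1 ≤ ν) (S : ℝ) (hS : 0 ≤ S) (m : ℝ) (hm : 0 ≤ m) (δ : ℝ) (hδ : 0 < δ) :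
    ∃ μ c q, 0 < μ ∧ μ ≤ 1 ∧ 0 < c ∧ CarlProp n ν S m δ μ c q := by
  set μ : ℝ := 1 / (200 * (1 + m)) with hμ
  have hμ0 : 0 < μ := by positivity
  have hμm : (1 + m) * μ = 1 / 200 := by rw [hμ]; field_simp
  have hμs : μ ≤ 1 / 200 := by nlinarith
  have hω0 : 0 < (volume (ball (0 : En n) 1)).toReal :=
    ENNReal.toReal_pos (measure_ball_pos _ _ one_pos).ne' measure_ball_lt_top.ne
  obtain ⟨M, hMM⟩ := exists_nat_gt (max 1 (2 ^ n * (volume (ball (0 : En n) 1)).toReal / (δ / 2)))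
  have hM1 : (1:ℝ) < M := lt_of_le_of_lt (le_max_left _ _) hMM
  have hM0 : 0 < M := by
    have : (0:ℝ) < M := by linarith
    exact_mod_cast this
  have hM2 : 2 ^ n * (volume (ball (0 : En n) 1)).toReal / M ≤ δ / 2 := by
    have := lt_of_le_of_lt (le_max_right _ _) hMM
    rw [div_lt_iff₀ (by positivity)] at this
    rw [div_le_iff₀ (by linarith)]
    linarith
  set κ : ℝ := 1 / (M * (1 + m)) with hκ
  have hκ0 : 0 < κ := by positivity
  have hκ1 : κ ≤ 1 := by rw [hκ, div_le_one (by positivity)]; nlinarith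
  obtain ⟨ε1, cs, hε1, hcs, -, hspot⟩ := spot hn hν S hS κ (δ / 2) hκ0 hκ1 (by positivity)
  set ε := min ε1 (κ / 8) with hε
  have hε0 : 0 < ε := by positivity
  have hεκ : ε ≤ κ / 8 := min_le_right _ _
  obtain ⟨cm, hcm, hmove'⟩ := move hn hν S hS (3 / 2 / μ) (4 / μ ^ 2) (by positivity) (by
    rw [le_div_iff₀ (by positivity)]; nlinarith)
  set c := min cm 1 with hc
  have hc0 : 0 < c := by positivity
  have hc1 : c ≤ 1 := min_le_right _ _
  have hmove := hmove'.mono (min_le_left cm 1)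
  rw [← hc] at hmove
  obtain ⟨q, hq⟩ : ∃ q : ℕ, (1 / 2 : ℝ) ^ q < c := exists_pow_lt_of_lt_one hc0 (by norm_num)
  set I : ℕ := ⌈3 / 4 / μ⌉₊ with hI
  have hI1 : 3 / 4 / μ ≤ I := Nat.le_ceil _
  have hI2 : (I:ℝ) < 3 / 4 / μ + 1 := Nat.ceil_lt_add_one (by positivity)
  have hIμ1 : 3 / 4 ≤ I * μ := by rwa [div_le_iff₀ hμ0] at hI1
  have hIμ2 : I * μ ≤ 3 / 4 + μ := by
    have : (3 / 4 / μ + 1) * μ = 3 / 4 + μ := by field_simp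
    nlinarith
  have hD8 : (1 + m) * 8 ≤ 3 / 2 / μ := by
    rw [le_div_iff₀ hμ0]; nlinarith
  refine ⟨μ, (ε / (2 * μ)) ^ q * cs * c ^ (2 * I + 1) * c, q, hμ0, by linarith, by positivity, ?_⟩
  clear hMM hω0 hI1 hI2 hcm
  clear hI
  clear_value I
  intro T Ω u θ p H k R y e φ r s x0 t0 ρ a hu hch h hr hrR hsT hx0 ht0l ht0u ht0p hρ hρr ha hvol
  have hr2 : 0 < r ^ 2 := by positivity
  have hρs : ρ ≤ r / 200 := by (exact hρr.trans (by have := mul_le_mul_of_nonneg_right hμs hr.le; linarith))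
  have hρ2 : ρ ^ 2 ≤ r ^ 2 / 40000 := by
    have := pow_le_pow_left₀ hρ.le hρs 2
    rw [div_pow] at this; norm_num at this; exact this
  set E : Set (En n × ℝ) := {X | X ∈ closedBall x0 ρ ×ˢ Icc (t0 - ρ ^ 2) t0 ∧ X.1 ∈ Ω ∧ a < u X} with hE
  have hv2 := strip_remove h hρ hδ hM0 hM2 (x0 := x0) (t0 := t0) (E := E) (by linarith) (fun X hX => hX.1)
    (fun X hX => hX.2.1) hvol
  have hside : ∀ X ∈ E ∩ {X | ρ / M ≤ eta y e φ X.1}, a < u X ∧ ball X.1 (κ * ρ) ⊆ Ω ∧ 0 < X.2 ∧ X.2 + ρ ^ 2 < T := by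
    rintro X ⟨⟨hXc, hXΩ, hXa⟩, hXe⟩
    have a1 : X.1 ∈ closedBall x0 ρ := hXc.1
    have a2 : X.2 ∈ Icc (t0 - ρ ^ 2) t0 := hXc.2
    have a3 : ρ / M ≤ eta y e φ X.1 := hXe
    rw [mem_closedBall] at a1
    have a4 := dist_triangle X.1 x0 y
    have e1 : κ * ρ = ρ / M / (1 + m) := by rw [hκ]; field_simp
    refine ⟨hXa, ?_, by linarith [a2.1], by linarith [a2.2]⟩
    have hκρ : κ * ρ ≤ ρ := by (exact mul_le_of_le_one_left hρ.le hκ1)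
    rw [e1] at hκρ ⊢
    exact h.ball_sub (by positivity) a3 (by linarith)
  obtain ⟨x', t', hb', hd', ht'0, ht'l, ht'u, hu'⟩ := hspot T Ω u θ p H k x0 t0 ρ a _ hu hρ ha
    (fun X hX => hX.1.1) hside hv2
  clear hv2 hvol
  -- the target scale
  set ρs := μ * r with hρsdef
  have hρs0 : 0 < ρs := by positivity
  have hρs1 : ρs ≤ r / 200 := by rw [hρsdef]; (have := mul_le_mul_of_nonneg_right hμs hr.le; linarith)
  have hmρs : (1 + m) * ρs = r / 200 := by rw [hρsdef, ← mul_assoc, hμm]; ring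
  have hερ : ε * ρ ≤ ρs := by (exact (mul_le_of_le_one_left hρ.le (by linarith)).trans hρr)
  obtain ⟨N', hN1, hN2⟩ := exists_nat_pow_near_of_lt_one (x := ε * ρ / ρs) (y := (1 / 2 : ℝ)) (by positivity)
    (by rw [div_le_one hρs0]; exact hερ) (by norm_num) (by norm_num)
  set N := N' + 1 with hN
  set ρ0 := ρs * (1 / 2) ^ N with hρ0
  have hρ0p : 0 < ρ0 := by positivity
  have h2N : 2 ^ N * ρ0 = ρs := by
    rw [hρ0, one_div, inv_pow]; field_simp
  have hρ0u : ρ0 ≤ ε * ρ := by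
    have := hN1.le
    rw [le_div_iff₀ hρs0] at this
    rw [hρ0]; linarith
  have hρ0l : ε * ρ / ρs ≤ 2 * (1 / 2) ^ N := by
    rw [hN, pow_succ]; linarith
  have hρ0h : ρ0 ≤ ρs / 2 := by
    have : (1 / 2 : ℝ) ^ N ≤ 1 / 2 := by
      rw [hN]; exact pow_le_of_le_one (by norm_num) (by norm_num) (by omega)
    rw [hρ0]; (have := mul_le_mul_of_nonneg_left this hρs0.le; linarith)
  have hε1' : ε ≤ ε1 := min_le_left _ _
  clear hN1 hN2
  have hx'y : dist x' y ≤ 1.26 * r := by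
    have := dist_triangle x' x0 y
    norm_num; linarith
  norm_num at hx'y
  have hρs2 : ρs ^ 2 ≤ r ^ 2 / 40000 := by
    have := pow_le_pow_left₀ hρs0.le hρs1 2
    rw [div_pow] at this; norm_num at this; exact this
  have hrise := rise hmove (by rw [le_div_iff₀ (by positivity)]; (have := pow_le_one₀ hμ0.le (show μ ≤ 1 by linarith) (n := 2); linarith)) hc0 hm hu h (x' := x') hρ0p
    (a := cs * a) (t0 := t') (by positivity) hD8
    ((ball_subset_ball (by (have := mul_le_mul_of_nonneg_right hεκ hρ.le; linarith))).trans hb') ht'0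
    (fun x hx => hu' x (ball_subset_ball (by (have := mul_le_mul_of_nonneg_right hε1' hρ.le; linarith)) hx)) N
  rw [mul_assoc 8, h2N] at hrise
  have hrise := hrise (by (linarith)) (by (linarith))
  set g := (1 + m) * 8 * (ρs - ρ0) with hg
  have hg0 : 0 ≤ g := mul_nonneg (by positivity) (by linarith)
  have hgu : g ≤ r / 25 := by rw [hg]; (have : 0 ≤ (1 + m) * ρ0 := (mul_pos (by linarith) hρ0p).le; linarith)
  have hgl : (1 + m) * 4 * ρs ≤ g := by rw [hg]; (have := mul_le_mul_of_nonneg_left hρ0h (show 0 ≤ 1 + m by linarith); linarith)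
  have e4 : (1 + m) * 4 * ρs / (1 + m) = 4 * ρs := by field_simp
  set P0 := x' + g • e with hP0
  clear hεκ hε1' hκ1 hM1 hM2
  set t'' := t' + (ρs ^ 2 - ρ0 ^ 2) / 3 with ht''
  have hx'Ω : x' ∈ Ω := hb' (mem_ball_self (by positivity))
  have hP0y : dist P0 y ≤ 1.26 * r + r / 25 := by
    have := h.dist_shift x' y hg0
    norm_num; linarith
  norm_num at hP0y
  have hbP0 : ball P0 (4 * ρs) ⊆ Ω := by
    have := h.ball_sub (x := P0) (q := (1 + m) * 4 * ρs) (by positivity) (by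
      rw [hP0, h.eta_shift]
      have := (h.mem (x := x') (by linarith)).1 hx'Ω
      linarith) (by rw [e4]; linarith)
    rwa [e4] at this
  -- the vertical segment above y
  have hvert : ∀ σ, r / 25 ≤ σ → σ ≤ r → ball (y + σ • e) (4 * ρs) ⊆ Ω := by
    intro σ h1 h2
    have h3 := h.dist_shift y y (q := σ) (by linarith)
    rw [dist_self] at h3
    have := h.ball_sub (x := y + σ • e) (q := (1 + m) * 4 * ρs) (by positivity) (by
      rw [h.eta_shift, h.eta_self]; linarith) (by rw [e4]; linarith)
    rwa [e4] at this
  set P1 := y + (r / 25) • e with hP1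
  have hP1y : dist P1 y ≤ r / 25 := by
    have := h.dist_shift y y (q := r / 25) (by linarith)
    rw [dist_self] at this; linarith
  have hP10 : dist P1 P0 ≤ 3 / 2 * r := by
    have := dist_triangle_right P1 P0 y
    linarith
  have hI0 : (0:ℝ) ≤ I := Nat.cast_nonneg I
  have hJ : (0:ℝ) < 2 * I + 1 := by positivity
  set τ := (s + r ^ 2 - ρs ^ 2 - t'') / (2 * I + 1) with hτ
  have hτJ : (2 * I + 1) * τ = s + r ^ 2 - ρs ^ 2 - t'' := by rw [hτ]; field_simp
  have ht''u : t'' ≤ s + r ^ 2 / 10 := by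
    have : 0 < ρ0 ^ 2 := by positivity
    rw [ht'']; linarith
  have ht''l : s - 2 * r ^ 2 - r ^ 2 / 40000 ≤ t'' := by
    have : ρ0 ^ 2 ≤ ρs ^ 2 := by gcongr; linarith
    rw [ht'']; linarith
  have ht''0 : 0 < t'' := by
    have : ρ0 ^ 2 ≤ ρs ^ 2 := by gcongr; linarith
    rw [ht'']; linarith
  have hτl : ρs ^ 2 ≤ τ := by
    rw [hτ, le_div_iff₀ hJ]
    have e5 : ρs ^ 2 * (2 * I + 1) = (2 * (I * μ) + μ) * μ * r ^ 2 := by rw [hρsdef]; ring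
    have h6 : (2 * (I * μ) + μ) * μ ≤ 1 / 10 := by (exact (mul_le_mul (show 2 * (I * μ) + μ ≤ 2 by linarith) hμs hμ0.le (by norm_num)).trans (by norm_num))
    have h7 : (2 * (I * μ) + μ) * μ * r ^ 2 ≤ 1 / 10 * r ^ 2 := by gcongr
    rw [e5]; linarith
  have e6 : 4 / μ ^ 2 * ρs ^ 2 = 4 * r ^ 2 := by rw [hρsdef]; field_simp
  have hlink := link_aux hmove hc0 hc1 hm hu hch (L := 3 / 2 * r) (τ := τ) hρs0 (by
      rw [hρsdef]; apply le_of_eq; field_simp) hD8 (by (linarith)) hτl I (by rw [hτJ, e6]; linarith [sq_nonneg ρs]) P0 P1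
      (c ^ N * (cs * a)) t'' (by positivity) hP10 hbP0 (hvert _ le_rfl (by linarith)) (by
        intro z hz hzd
        have e7 : (I:ℝ) * (2 * ρs) = 2 * (I * μ) * r := by rw [hρsdef]; ring
        have h8 : 3 / 2 * r ≤ (I:ℝ) * (2 * ρs) := by rw [e7]; (have := mul_le_mul_of_nonneg_right hIμ1 hr.le; linarith)
        have h9 : dist z P0 ≤ 0 := by linarith
        have h10 := dist_le_zero.1 h9
        rw [h10]; exact hbP0) ht''0 (by rw [hτJ]; (linarith [sq_nonneg ρs])) hrise
  rw [hτJ] at hlink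
  have hP1e : y + r • e = P1 + (r - r / 25) • e := by
    rw [hP1, add_assoc, ← add_smul]; congr 2; ring
  have hfin := hmove T Ω u θ p H k P1 (y + r • e) ρs (t'' + (s + r ^ 2 - ρs ^ 2 - t'')) (s + r ^ 2)
    (c ^ (2 * I + 1) * (c ^ N * (cs * a))) hu hρs0 (by positivity) (by
      intro z hz
      rw [hP1e] at hz
      obtain ⟨σ, hσ0, hσ1, rfl⟩ := Chart.seg_mem (by linarith) hz
      rw [hP1, add_assoc, ← add_smul]
      exact hvert _ (by linarith) (by linarith)) (by
      rw [hP1e]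
      have := h.dist_shift P1 P1 (q := r - r / 25) (by linarith)
      rw [dist_self] at this
      have e8 : 3 / 2 / μ * ρs = 3 / 2 * r := by rw [hρsdef]; field_simp
      rw [e8]; linarith) (by (linarith)) (by linarith) (by linarith) (by rw [e6]; (linarith))
    (fun x hx => hlink x (ball_subset_ball (by linarith) hx)) (y + r • e) (mem_ball_self (by positivity))
  refine le_trans ?_ hfin
  -- compare constants
  have hcN : (ε / (2 * μ)) ^ q * (ρ / r) ^ q ≤ c ^ N := by
    calc (ε / (2 * μ)) ^ q * (ρ / r) ^ q = (ε * ρ / ρs / 2) ^ q := by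
          rw [← mul_pow]; congr 1; rw [hρsdef]; field_simp
      _ ≤ ((1 / 2) ^ N) ^ q := by gcongr; linarith
      _ = ((1 / 2) ^ q) ^ N := by rw [← pow_mul, ← pow_mul, mul_comm]
      _ ≤ c ^ N := by gcongr
  calc (ε / (2 * μ)) ^ q * cs * c ^ (2 * I + 1) * c * (ρ / r) ^ q * a
      = ((ε / (2 * μ)) ^ q * (ρ / r) ^ q) * (c * (c ^ (2 * I + 1) * (cs * a))) := by ring
    _ ≤ c ^ N * (c * (c ^ (2 * I + 1) * (cs * a))) := by gcongr
    _ = _ := by ring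

theorem posx_cont {n : ℕ} {Ω : Set (En n)} (hΩ : IsOpen Ω) {T : ℝ} {C D : Set (En n × ℝ)} {u : En n × ℝ → ℝ} {a : ℝ} (ha : 0 < a)
    (hC : IsClosed C) (hCT : ∀ X ∈ C, X.2 ∈ Ioo 0 T) (hD : ContinuousOn u D)
    (hCD : ∀ X ∈ C, X.1 ∈ closure Ω → X ∈ D) (h0 : ∀ X ∈ C, X.1 ∈ frontier Ω → u X = 0) :
    ContinuousOn (posx (Ω ×ˢ Ioo 0 T) (fun X => -a + u X)) C := by
  have e : C = (C ∩ {X | X.1 ∈ closure Ω}) ∪ (C ∩ {X | X.1 ∈ Ωᶜ}) := by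
    ext X; constructor
    · intro hX
      by_cases h : X.1 ∈ Ω
      · exact Or.inl ⟨hX, subset_closure h⟩
      · exact Or.inr ⟨hX, h⟩
    · rintro (h | h) <;> exact h.1
  rw [e]
  refine ContinuousOn.union_of_isClosed ?_ ?_ ?_ ?_
  · have h1 : ContinuousOn (fun X => max (-a + u X) 0) (C ∩ {X | X.1 ∈ closure Ω}) := by
      refine ContinuousOn.sup (continuousOn_const.add (hD.mono ?_)) continuousOn_const
      intro X hX; exact hCD X hX.1 hX.2
    refine h1.congr ?_
    intro X hX
    by_cases h : X.1 ∈ Ω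
    · exact Set.indicator_of_mem (show X ∈ Ω ×ˢ Ioo 0 T from ⟨h, hCT X hX.1⟩) _
    · have hf : X.1 ∈ frontier Ω := by rw [hΩ.frontier_eq]; exact ⟨hX.2, h⟩
      have : posx (Ω ×ˢ Ioo 0 T) (fun X => -a + u X) X = 0 :=
        Set.indicator_of_notMem (fun hh => h hh.1) _
      rw [this]
      show (0:ℝ) = max (-a + u X) 0
      rw [h0 X hX.1 hf, max_eq_right]; linarith
  · have h1 : ContinuousOn (fun _ : En n × ℝ => (0:ℝ)) (C ∩ {X | X.1 ∈ Ωᶜ}) := continuousOn_const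
    refine h1.congr ?_
    intro X hX
    exact Set.indicator_of_notMem (fun hh => hX.2 hh.1) _
  · exact hC.inter (isClosed_closure.preimage continuous_fst)
  · exact hC.inter (hΩ.isClosed_compl.preimage continuous_fst)

/-- distance-like weight -/
def dw {n : ℕ} (y : En n) (L τ : ℝ) (X : En n × ℝ) : ℝ := min (L - dist X.1 y) (Real.sqrt (X.2 - τ))

theorem dw_lower {n : ℕ} {y : En n} {L τ ε : ℝ} {X X0 : En n × ℝ} (hε : 0 < ε) (hε1 : ε ≤ 1 / 2)
    (hd : 0 < dw y L τ X0) (h1 : dist X.1 X0.1 ≤ ε * dw y L τ X0) (h2 : X0.2 - (ε * dw y L τ X0) ^ 2 ≤ X.2) :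
    (1 - ε) * dw y L τ X0 ≤ dw y L τ X := by
  have a1 : dw y L τ X0 ≤ L - dist X0.1 y := min_le_left _ _
  have a2 : dw y L τ X0 ≤ Real.sqrt (X0.2 - τ) := min_le_right _ _
  set d := dw y L τ X0
  have a3 : d ^ 2 ≤ X0.2 - τ := (Real.le_sqrt' hd).1 a2
  refine le_min ?_ (Real.le_sqrt_of_sq_le ?_)
  · have := dist_triangle X.1 X0.1 y
    linarith
  · have : 0 ≤ ε * d ^ 2 * (1 - ε) := mul_nonneg (by positivity) (by linarith)
    nlinarith

theorem blow_step {ε A σ d d' ux : ℝ} {q : ℕ} (hε : 0 < ε) (hε2 : ε ≤ 1 / (50 * (q + 1))) (hA : 0 < A) (hd : 0 < d) (hux : 0 ≤ ux)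
    (hd' : (1 - ε) * d ≤ d') (hσ : σ < 1.05 * (A * d ^ q)) (hx : ux * d' ^ q ≤ σ) : ux ≤ 1.1 * A := by
  have hq : (0:ℝ) ≤ q := Nat.cast_nonneg q
  have h1 : ε * (50 * (q + 1)) ≤ 1 := by rwa [le_div_iff₀ (by positivity)] at hε2
  have hq2 : 0 ≤ q * ε := by positivity
  have h2 : ε * q ≤ 1 / 50 := by linarith
  have h2' : ε ≤ 1 / 50 := by linarith
  have h3 : 1 - (q:ℝ) * ε ≤ (1 - ε) ^ q := by
    have := one_add_mul_le_pow (a := -ε) (by linarith) q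
    have e : 1 + (q:ℝ) * -ε = 1 - q * ε := by ring
    rw [e] at this; simpa [sub_eq_add_neg] using this
  have h4 : 0.98 * d ^ q ≤ d' ^ q := by
    calc 0.98 * d ^ q ≤ (1 - ε) ^ q * d ^ q := by gcongr; norm_num; linarith
      _ = ((1 - ε) * d) ^ q := (mul_pow _ _ _).symm
      _ ≤ d' ^ q := by
        refine pow_le_pow_left₀ (mul_nonneg (by linarith) hd.le) hd' q
  have h5 : ux * (0.98 * d ^ q) ≤ 1.05 * (A * d ^ q) := by
    have := mul_le_mul_of_nonneg_left h4 hux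
    linarith
  have h6 : 0 < d ^ q := by positivity
  have h7 : (0.98 * ux) * d ^ q ≤ (1.05 * A) * d ^ q := by linarith
  have h8 := le_of_mul_le_mul_right h7 h6
  norm_num at h8 ⊢
  linarith

set_option maxHeartbeats 1600000 in
theorem blow {n : ℕ} (hn : 0 < n) {ν : ℝ} (hν : 1 ≤ ν) (S : ℝ) (hS : 0 ≤ S) (m : ℝ) (hm : 0 ≤ m) :
    ∃ N : ℝ, 0 < N ∧ ∀ (T : ℝ) (Ω : Set (En n)) (u θ : En n × ℝ → ℝ) (p : En n × ℝ → En n)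
    (H : En n × ℝ → (En n →L[ℝ] En n)) (k : En n → ℝ) (R : ℝ) (y e : En n) (φ : En n → ℝ) (r s : ℝ),
    Sol ν S T Ω u θ p H k → (∀ y ∈ frontier Ω, ∃ e φ, Chart Ω R m y e φ) → Chart Ω R m y e φ →
    0 < r → 2 * r < R → s + 4 * r ^ 2 < T → 4 * r ^ 2 < s →
    ContinuousOn u ((Ω ×ˢ Ioo (0 : ℝ) T) ∪ ((frontier Ω ×ˢ Ioo (0 : ℝ) T) ∩ pcyl (y, s) (2 * r))) →
    (∀ X ∈ (frontier Ω ×ˢ Ioo (0 : ℝ) T) ∩ pcyl (y, s) (2 * r), u X = 0) →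
    ∀ X ∈ (Ω ×ˢ Ioo (0 : ℝ) T) ∩ pcyl (y, s) r, u X ≤ N * u (y + r • e, s + r ^ 2) := by
  obtain ⟨δ, hδ, hgl⟩ := gl1 hn hν S hS
  obtain ⟨μ, c, q, hμ, hμ1, hc, hcarl⟩ := carl hn hν S hS m hm δ hδ
  set ε : ℝ := min (μ / 2) (1 / (50 * (q + 1))) with hε
  have hε0 : 0 < ε := by positivity
  have hεμ : ε ≤ μ / 2 := min_le_left _ _
  have hεq : ε ≤ 1 / (50 * (q + 1)) := min_le_right _ _
  have hεh : ε ≤ 1 / 2 := by linarith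
  set K : ℝ := 2 / (c * ε ^ q) with hK
  have hK0 : 0 < K := by positivity
  refine ⟨K * 4 ^ q, by positivity, ?_⟩
  intro T Ω u θ p H k R y e φ r s hu hch h hr hrR hsT hs hcont hz X1 hX1
  have hr2 : 0 < r ^ 2 := by positivity
  have hX1Ω : X1.1 ∈ Ω := hX1.1.1
  have hX1b : dist X1.1 y < r := hX1.2.1
  have hX1l : s - r ^ 2 < X1.2 := hX1.2.2.1
  have hX1s : X1.2 < s := hX1.2.2.2
  set B := u (y + r • e, s + r ^ 2) with hB
  have hyr : y + r • e ∈ Ω := by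
    have h3 := h.dist_shift y y (q := r) hr.le
    rw [dist_self] at h3
    rw [h.mem (by linarith), h.eta_shift, h.eta_self]; linarith
  have hB0 : 0 ≤ B := hu.nn _ ⟨hyr, by show 0 < s + r ^ 2; linarith, by show s + r ^ 2 < T; linarith⟩
  set τ := s - 2 * r ^ 2 with hτ
  set Rs : Set (En n × ℝ) := {X | X.1 ∈ Ω ∧ dist X.1 y < 5 / 4 * r ∧ τ < X.2 ∧ X.2 ≤ X1.2} with hRs
  set D : Set (En n × ℝ) := ((Ω ×ˢ Ioo (0 : ℝ) T) ∪ ((frontier Ω ×ˢ Ioo (0 : ℝ) T) ∩ pcyl (y, s) (2 * r))) with hD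
  have hin : ∀ X : En n × ℝ, X.1 ∈ closure Ω → dist X.1 y ≤ 5 / 4 * r → τ ≤ X.2 → X.2 ≤ X1.2 → X ∈ D := by
    intro X a1 a2 a3 a4
    have b2 : X.2 ∈ Ioo 0 T := ⟨by linarith, by linarith⟩
    by_cases hX : X.1 ∈ Ω
    · exact Or.inl ⟨hX, b2⟩
    · right
      refine ⟨⟨by rw [hu.op.frontier_eq]; exact ⟨a1, hX⟩, b2⟩, ?_, ?_, ?_⟩
      · show dist X.1 y < 2 * r; linarith
      · show s - (2 * r) ^ 2 < X.2
        have : (2 * r) ^ 2 = 4 * r ^ 2 := by ring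
        linarith
      · show X.2 < s; linarith
  have hfr : ∀ X : En n × ℝ, X.1 ∈ frontier Ω → dist X.1 y ≤ 5 / 4 * r → τ ≤ X.2 → X.2 ≤ X1.2 → u X = 0 := by
    intro X a1 a2 a3 a4
    rcases hin X (frontier_subset_closure a1) a2 a3 a4 with hX | hX
    · exfalso
      rw [hu.op.frontier_eq] at a1
      exact a1.2 hX.1
    · exact hz X hX
  have hRsG : ∀ X ∈ Rs, X ∈ Ω ×ˢ Ioo (0:ℝ) T := by
    rintro X ⟨a1, a2, a3, a4⟩
    exact ⟨a1, by show 0 < X.2; linarith, by show X.2 < T; linarith⟩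
  -- bound on the compact set
  obtain ⟨M0, hM0⟩ : ∃ M0, ∀ X ∈ Rs, u X ≤ M0 := by
    have hcp : IsCompact ((closure Ω ∩ closedBall y (5 / 4 * r)) ×ˢ Icc τ X1.2) :=
      ((isCompact_closedBall y (5 / 4 * r)).inter_left isClosed_closure).prod isCompact_Icc
    obtain ⟨M0, hM0⟩ := (hcp.image_of_continuousOn (hcont.mono (fun X hX => hin X hX.1.1 hX.1.2 hX.2.1 hX.2.2))).bddAbove
    refine ⟨M0, fun X hX => hM0 ⟨X, ⟨⟨subset_closure hX.1, mem_closedBall.2 hX.2.1.le⟩, hX.2.2.1.le, hX.2.2.2⟩, rfl⟩⟩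
  set d : En n × ℝ → ℝ := dw y (5 / 4 * r) τ with hd
  have hdpos : ∀ X ∈ Rs, 0 < d X := by
    rintro X ⟨a1, a2, a3, a4⟩
    exact lt_min (by linarith) (Real.sqrt_pos.2 (by linarith))
  have hdle : ∀ X : En n × ℝ, d X ≤ 5 / 4 * r := fun X => (min_le_left _ _).trans (by linarith [dist_nonneg (x := X.1) (y := y)])
  set f : En n × ℝ → ℝ := fun X => u X * d X ^ q with hf
  have hbdd : BddAbove (f '' Rs) := by
    refine ⟨|M0| * (5 / 4 * r) ^ q, ?_⟩
    rintro _ ⟨X, hX, rfl⟩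
    have := hdpos X hX
    exact mul_le_mul ((hM0 X hX).trans (le_abs_self _)) (pow_le_pow_left₀ this.le (hdle X) q) (by positivity) (abs_nonneg _)
  have hX1R : X1 ∈ Rs := ⟨hX1Ω, by linarith, by linarith, le_rfl⟩
  have hclaim : f X1 ≤ K * B * r ^ q := by
    by_contra hcon
    push Not at hcon
    set σ := sSup (f '' Rs) with hσ
    have hσ1 : f X1 ≤ σ := le_csSup hbdd ⟨X1, hX1R, rfl⟩
    have hKB : 0 ≤ K * B * r ^ q := by positivity
    have hσ0 : 0 < σ := by linarith
    have hσl : max (σ / 1.05) (K * B * r ^ q) < σ := by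
      refine max_lt ?_ (by linarith)
      rw [div_lt_iff₀ (by norm_num)]; norm_num; linarith
    obtain ⟨_, ⟨X0, hX0, rfl⟩, hX0f⟩ := exists_lt_of_lt_csSup (Set.Nonempty.image f ⟨X1, hX1R⟩) hσl
    have hf1 : σ / 1.05 < f X0 := lt_of_le_of_lt (le_max_left _ _) hX0f
    have hf2 : K * B * r ^ q < f X0 := lt_of_le_of_lt (le_max_right _ _) hX0f
    rw [div_lt_iff₀ (by norm_num)] at hf1
    have hd0 := hdpos X0 hX0
    have hd0q : 0 < d X0 ^ q := by positivity
    have hA0 : 0 < u X0 := by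
      have : 0 < u X0 * d X0 ^ q := lt_of_le_of_lt hKB hf2
      exact (pos_iff_pos_of_mul_pos this).2 hd0q
    set A := u X0 with hA
    set ρ := ε * d X0 with hρ
    have hρ0 : 0 < ρ := by positivity
    obtain ⟨b1, b2, b3, b4⟩ := hX0
    have c1 : d X0 ≤ 5 / 4 * r - dist X0.1 y := min_le_left _ _
    have c2 : d X0 ^ 2 ≤ X0.2 - τ := (Real.le_sqrt' hd0).1 (min_le_right _ _)
    have hρd : ρ ≤ d X0 / 2 := by rw [hρ]; nlinarith
    have hρ2 : ρ ^ 2 ≤ d X0 ^ 2 / 4 := by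
      have := pow_le_pow_left₀ hρ0.le hρd 2
      rw [div_pow] at this; norm_num at this; exact this
    set C : Set (En n × ℝ) := closedBall X0.1 ρ ×ˢ Icc (X0.2 - ρ ^ 2) X0.2 with hC
    have hCin : ∀ X ∈ C, dist X.1 y < 5 / 4 * r ∧ τ < X.2 ∧ X.2 ≤ X1.2 := by
      intro X hX
      have g1 : dist X.1 X0.1 ≤ ρ := hX.1
      have g2 : X0.2 - ρ ^ 2 ≤ X.2 := hX.2.1
      have g3 : X.2 ≤ X0.2 := hX.2.2
      have g4 := dist_triangle X.1 X0.1 y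
      have g5 : 0 < d X0 ^ 2 := by positivity
      exact ⟨by linarith, by linarith, by linarith⟩
    have hub : ∀ X ∈ C, X ∈ Ω ×ˢ Ioo (0:ℝ) T → -(A / 2) + u X ≤ 0.6 * A := by
      intro X hX hXG
      have hXR : X ∈ Rs := ⟨hXG.1, hCin X hX⟩
      have := blow_step (ux := u X) (d' := d X) hε0 hεq hA0 hd0 (hu.nn X hXG)
        (dw_lower hε0 hεh hd0 hX.1 hX.2.1) (by linarith) (le_csSup hbdd ⟨X, hXR, rfl⟩)
      norm_num at this ⊢
      linarith
    by_cases hv : volume {X | X ∈ C ∧ X ∈ Ω ×ˢ Ioo (0:ℝ) T ∧ 0 < -(A / 2) + u X} ≤ ENNReal.ofReal (δ * ρ ^ (n + 2))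
    · have := hgl _ θ p H (Ω ×ˢ Ioo 0 T) X0.1 ρ X0.2 (0.6 * A) k (hu.c21.const_add (-(A / 2))) hρ0 (by positivity) hu.k0 hu.km
        (hu.mass_le _) (by
          filter_upwards [hu.pde] with x hx t _ _ hG _
          obtain ⟨A', hA', hle⟩ := hx t hG
          exact ⟨A', hA', by have := le_of_abs_le hle; linarith⟩) hub
        (posx_cont hu.op (by positivity) (isClosed_closedBall.prod isClosed_Icc) (fun X hX => by
            have := hCin X hX
            exact ⟨by linarith, by linarith⟩) hcont
          (fun X hX hXc => by
            have := hCin X hX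
            exact hin X hXc this.1.le this.2.1.le this.2.2) (fun X hX hXc => by
            have := hCin X hX
            exact hfr X hXc this.1.le this.2.1.le this.2.2)) hv ⟨b1, by linarith, by linarith⟩
      have e1 : -(A / 2) + A ≤ 0.6 * A / 2 := this
      norm_num at e1
      linarith
    · push Not at hv
      have hvol : ENNReal.ofReal (δ * ρ ^ (n + 2)) ≤
          volume {X : En n × ℝ | X ∈ C ∧ X.1 ∈ Ω ∧ A / 2 < u X} := by
        refine hv.le.trans (measure_mono ?_)
        rintro X ⟨g1, g2, g3⟩
        exact ⟨g1, g2.1, by linarith⟩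
      have := hcarl T Ω u θ p H k R y e φ r s X0.1 X0.2 ρ (A / 2) hu hch h hr hrR (by linarith) b2.le b3.le (by linarith)
        (by linarith) hρ0 (by
          have g := mul_le_mul hεμ (hdle X0) hd0.le (by positivity)
          have g2 : 0 < μ * r := by positivity
          rw [hρ]; linarith) (by positivity) hvol
      rw [← hB] at this
      have hf3 : K * B * r ^ q < A * d X0 ^ q := hf2
      have e3 : c * (ρ / r) ^ q * (A / 2) = (c * ε ^ q) / 2 * (A * d X0 ^ q) / r ^ q := by
        rw [hρ, div_pow, mul_pow]; ring
      rw [e3, div_le_iff₀ (by positivity)] at this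
      have h9 := mul_lt_mul_of_pos_left hf3 (show 0 < (c * ε ^ q) / 2 by positivity)
      have e4 : (c * ε ^ q) / 2 * (K * B * r ^ q) = B * r ^ q := by
        rw [hK]; field_simp
      rw [e4] at h9
      linarith
  have hd1 : r / 4 ≤ d X1 := by
    refine le_min (by linarith) (Real.le_sqrt_of_sq_le ?_)
    rw [div_pow]; norm_num; linarith
  have h10 : u X1 * (r / 4) ^ q ≤ K * B * r ^ q := by
    refine le_trans ?_ hclaim
    exact mul_le_mul_of_nonneg_left (pow_le_pow_left₀ (by positivity) hd1 q) (hu.nn X1 hX1.1)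
  rw [div_pow, ← mul_div_assoc, div_le_iff₀ (by positivity)] at h10
  have h11 : u X1 * r ^ q ≤ (K * 4 ^ q * B) * r ^ q := by linarith
  exact le_of_mul_le_mul_right h11 (by positivity)

theorem clm_eq_sum {n : ℕ} (f : En n →L[ℝ] ℝ) :
    f = ∑ i, f (EuclideanSpace.single i 1) • (EuclideanSpace.proj i : En n →L[ℝ] ℝ) := by
  ext v
  have hv : v = ∑ i, v i • EuclideanSpace.single i (1:ℝ) := by
    have := (EuclideanSpace.basisFun (Fin n) ℝ).sum_repr v
    simpa using this.symm
  conv_lhs => rw [hv]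
  rw [map_sum, ContinuousLinearMap.sum_apply]
  refine Finset.sum_congr rfl fun i _ => ?_
  rw [map_smul]
  simp [mul_comm]

def gradv {n : ℕ} (u : En n × ℝ → ℝ) (X : En n × ℝ) : En n := ∑ j, Dx u j X • EuclideanSpace.single j (1:ℝ)

def hessv {n : ℕ} (u : En n × ℝ → ℝ) (X : En n × ℝ) : En n →L[ℝ] En n :=
  ∑ j, ∑ i, Dxx u i j X • (EuclideanSpace.proj i : En n →L[ℝ] ℝ).smulRight (EuclideanSpace.single j (1:ℝ))

theorem gradv_apply {n : ℕ} (u : En n × ℝ → ℝ) (X : En n × ℝ) (i : Fin n) : gradv u X i = Dx u i X := by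
  unfold gradv
  simp [Finset.sum_apply, Pi.single_apply]

theorem hessv_single {n : ℕ} (u : En n × ℝ → ℝ) (X : En n × ℝ) (i j : Fin n) :
    hessv u X (EuclideanSpace.single i 1) j = Dxx u i j X := by
  unfold hessv
  simp [Finset.sum_apply, Pi.single_apply]

theorem c21_of {n : ℕ} {u : En n × ℝ → ℝ} {Q : Set (En n × ℝ)} (hQ : IsOpen Q) (h : IsC21 u Q) :
    C21 u (Dt u) (gradv u) (hessv u) Q := by
  refine ⟨hQ, fun X hX => (h.diff_t X hX).hasDerivAt, fun X hX => ?_, fun X hX => ?_, h.cont, h.cont_t, ?_, ?_⟩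
  · refine (h.diff_x X hX).hasFDerivAt.congr_fderiv ?_
    rw [clm_eq_sum (fderiv ℝ (fun x => u (x, X.2)) X.1)]
    ext v
    rw [innerSL_apply_apply, ContinuousLinearMap.sum_apply, PiLp.inner_apply]
    refine Finset.sum_congr rfl fun i _ => ?_
    rw [gradv_apply]
    simp [Dx, mul_comm]
  · have h1 : HasFDerivAt (fun x => ∑ j, Dx u j (x, X.2) • (EuclideanSpace.single j (1:ℝ) : En n))
        (∑ j, (fderiv ℝ (fun x => Dx u j (x, X.2)) X.1).smulRight (EuclideanSpace.single j (1:ℝ) : En n)) X.1 := by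
      refine HasFDerivAt.fun_sum fun j _ => ?_
      exact (h.diff_xx j X hX).hasFDerivAt.smul_const _
    refine h1.congr_fderiv ?_
    unfold hessv
    refine Finset.sum_congr rfl fun j _ => ?_
    rw [clm_eq_sum (fderiv ℝ (fun x => Dx u j (x, X.2)) X.1)]
    refine ContinuousLinearMap.ext fun v => ?_
    rw [ContinuousLinearMap.smulRight_apply, ContinuousLinearMap.sum_apply, ContinuousLinearMap.sum_apply, Finset.sum_smul]
    refine Finset.sum_congr rfl fun i _ => ?_
    rw [ContinuousLinearMap.smul_apply, ContinuousLinearMap.smul_apply, ContinuousLinearMap.smulRight_apply, smul_eq_mul, mul_smul]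
    rfl
  · exact continuousOn_finsetSum _ fun j _ => (h.cont_x j).smul continuousOn_const
  · exact continuousOn_finsetSum _ fun j _ => continuousOn_finsetSum _ fun i _ => (h.cont_xx i j).smul continuousOn_const

theorem eucl_apply {n : ℕ} (M : Matrix (Fin n) (Fin n) ℝ) (v : En n) (i : Fin n) :
    Matrix.toEuclideanCLM (n := Fin n) (𝕜 := ℝ) M v i = ∑ j, M i j * v j := by
  rfl

theorem adm_of {n : ℕ} {ν : ℝ} (hν : 1 ≤ ν) {M : Matrix (Fin n) (Fin n) ℝ}
    (h1 : ∀ ξ : Fin n → ℝ, ν⁻¹ * (∑ i, ξ i ^ 2) ≤ ∑ i, ∑ j, M i j * ξ i * ξ j)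
    (h2 : (∑ i, ∑ j, (M i j) ^ 2) ≤ ν ^ 2) : Adm ν (Matrix.toEuclideanCLM (n := Fin n) (𝕜 := ℝ) M) := by
  constructor
  · intro ξ
    have := h1 ξ
    rw [EuclideanSpace.real_norm_sq_eq]
    refine this.trans (le_of_eq ?_)
    rw [PiLp.inner_apply]
    refine Finset.sum_congr rfl fun i _ => ?_
    rw [eucl_apply]
    simp only [RCLike.inner_apply, conj_trivial]
    rw [Finset.mul_sum]
    exact Finset.sum_congr rfl fun j _ => by ring
  · refine ContinuousLinearMap.opNorm_le_bound _ (by linarith) fun v => ?_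
    refine abs_le_of_sq_le_sq' ?_ (by positivity) |>.2
    rw [mul_pow, EuclideanSpace.real_norm_sq_eq, EuclideanSpace.real_norm_sq_eq]
    calc ∑ i, (Matrix.toEuclideanCLM (n := Fin n) (𝕜 := ℝ) M v i) ^ 2
        ≤ ∑ i, (∑ j, M i j ^ 2) * (∑ j, v j ^ 2) := by
          refine Finset.sum_le_sum fun i _ => ?_
          rw [eucl_apply]
          exact Finset.sum_mul_sq_le_sq_mul_sq _ _ _
      _ = (∑ i, ∑ j, M i j ^ 2) * (∑ j, v j ^ 2) := by rw [Finset.sum_mul]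
      _ ≤ _ := by gcongr

theorem trc_of {n : ℕ} (u : En n × ℝ → ℝ) (X : En n × ℝ) (M : Matrix (Fin n) (Fin n) ℝ) :
    trc (Matrix.toEuclideanCLM (n := Fin n) (𝕜 := ℝ) M) (hessv u X) = ∑ i, ∑ j, M i j * Dxx u i j X := by
  rw [trc_eq_sum (EuclideanSpace.basisFun (Fin n) ℝ)]
  refine Finset.sum_congr rfl fun i _ => ?_
  rw [EuclideanSpace.basisFun_apply, EuclideanSpace.inner_single_left, eucl_apply]
  simp only [map_one, one_mul]
  exact Finset.sum_congr rfl fun j _ => by rw [hessv_single]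

theorem adm_compact {n : ℕ} (ν : ℝ) : IsCompact {A : En n →L[ℝ] En n | Adm ν A} := by
  have hc : IsClosed {A : En n →L[ℝ] En n | Adm ν A} := by
    have e : {A : En n →L[ℝ] En n | Adm ν A} = (⋂ ξ : En n, {A | ν⁻¹ * ‖ξ‖ ^ 2 ≤ ⟪A ξ, ξ⟫}) ∩ {A | ‖A‖ ≤ ν} := by
      ext A; simp [Adm]
    rw [e]
    refine IsClosed.inter (isClosed_iInter fun ξ => ?_) (isClosed_le continuous_norm continuous_const)
    refine isClosed_le continuous_const ?_
    exact ((ContinuousLinearMap.apply ℝ (En n) ξ).continuous).inner continuous_const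
  have : ProperSpace (En n →L[ℝ] En n) := FiniteDimensional.proper ℝ _
  refine Metric.isCompact_of_isClosed_isBounded hc ?_
  refine (Metric.isBounded_closedBall (x := (0 : En n →L[ℝ] En n)) (r := ν)).subset ?_
  intro A hA
  rw [mem_closedBall_zero_iff]; exact hA.2

/-- the least defect `|θ - tr(AH)|` over admissible `A` -/
def defect {n : ℕ} (ν : ℝ) (θ : En n × ℝ → ℝ) (H : En n × ℝ → (En n →L[ℝ] En n)) (X : En n × ℝ) : ℝ :=
  sInf ((fun A => |θ X - trc A (H X)|) '' {A | Adm ν A})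

theorem trc_cont {n : ℕ} : Continuous (fun P : (En n →L[ℝ] En n) × (En n →L[ℝ] En n) => trc P.1 P.2) := by
  have e : (fun P : (En n →L[ℝ] En n) × (En n →L[ℝ] En n) => trc P.1 P.2) = fun P => 
     ∑ i, ⟪EuclideanSpace.basisFun (Fin n) ℝ i, P.1 (P.2 (EuclideanSpace.basisFun (Fin n) ℝ i))⟫ := by
    funext P; exact trc_eq_sum _ _ _
  rw [e]
  fun_prop

theorem defect_cont {n : ℕ} {ν : ℝ} {θ : En n × ℝ → ℝ} {H : En n × ℝ → (En n →L[ℝ] En n)} {Q : Set (En n × ℝ)}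
    (hθ : ContinuousOn θ Q) (hH : ContinuousOn H Q) : ContinuousOn (defect ν θ H) Q := by
  rw [continuousOn_iff_continuous_restrict] at hθ hH ⊢
  refine (adm_compact ν).continuous_sInf (f := fun (X : Q) A => |θ X - trc A (H X)|) ?_
  have h1 : Continuous fun P : Q × (En n →L[ℝ] En n) => θ P.1 := hθ.comp continuous_fst
  have h2 : Continuous fun P : Q × (En n →L[ℝ] En n) => H P.1 := hH.comp continuous_fst
  have h3 := trc_cont.comp (continuous_snd.prodMk h2)
  exact (h1.sub h3).abs

theorem defect_le {n : ℕ} {ν : ℝ} {θ : En n × ℝ → ℝ} {H : En n × ℝ → (En n →L[ℝ] En n)} {X : En n × ℝ} {A : En n →L[ℝ] En n}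
    (hA : Adm ν A) : defect ν θ H X ≤ |θ X - trc A (H X)| :=
  csInf_le ⟨0, by rintro _ ⟨A, _, rfl⟩; exact abs_nonneg _⟩ ⟨A, hA, rfl⟩

theorem defect_attained {n : ℕ} {ν : ℝ} {θ : En n × ℝ → ℝ} {H : En n × ℝ → (En n →L[ℝ] En n)} {X : En n × ℝ}
    (hne : ∃ A : En n →L[ℝ] En n, Adm ν A) : ∃ A, Adm ν A ∧ |θ X - trc A (H X)| = defect ν θ H X := by
  have hc : Continuous fun A : En n →L[ℝ] En n => |θ X - trc A (H X)| :=
    (continuous_const.sub (trc_cont.comp (continuous_id.prodMk continuous_const))).abs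
  obtain ⟨A, hA, he⟩ := (adm_compact ν).exists_sInf_image_eq hne hc.continuousOn
  exact ⟨A, hA, he.symm⟩

def khat {n : ℕ} (Q : Set (En n × ℝ)) (F P : En n × ℝ → ℝ) (x : En n) : ℝ≥0∞ :=
  ⨆ t : ℝ, ⨆ (_ : (x, t) ∈ Q), ENNReal.ofReal (F (x, t)) / ENNReal.ofReal (P (x, t))

theorem khat_aux {c a b : ℝ} (hc : 0 ≤ c) (hb : 0 ≤ b) :
    ENNReal.ofReal c < ENNReal.ofReal a / ENNReal.ofReal b ↔ c * b < a := by
  rw [ENNReal.lt_div_iff_mul_lt (Or.inr ENNReal.ofReal_ne_top) (Or.inl ENNReal.ofReal_ne_top), ← ENNReal.ofReal_mul hc,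
    ENNReal.ofReal_lt_ofReal_iff_of_nonneg (by positivity)]

theorem khat_meas {n : ℕ} {Q : Set (En n × ℝ)} (hQ : IsOpen Q) {F P : En n × ℝ → ℝ} (hF : ContinuousOn F Q)
    (hP : ContinuousOn P Q) (hP0 : ∀ X, 0 ≤ P X) : Measurable (khat Q F P) := by
  refine measurable_of_Ioi fun c => ?_
  by_cases hc : c = ⊤
  · subst hc; simp
  obtain ⟨c', hc0, rfl⟩ : ∃ c' : ℝ, 0 ≤ c' ∧ c = ENNReal.ofReal c' :=
    ⟨c.toReal, ENNReal.toReal_nonneg, (ENNReal.ofReal_toReal hc).symm⟩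
  have e : khat Q F P ⁻¹' Ioi (ENNReal.ofReal c') = Prod.fst '' (Q ∩ {X | 0 < F X - c' * P X}) := by
    ext x
    rw [mem_preimage, mem_Ioi]
    unfold khat
    simp only [lt_iSup_iff]
    constructor
    · rintro ⟨t, ht, hlt⟩
      rw [khat_aux hc0 (hP0 _)] at hlt
      exact ⟨(x, t), ⟨ht, by show 0 < F (x, t) - c' * P (x, t); linarith⟩, rfl⟩
    · rintro ⟨⟨x', t⟩, ⟨ht, hlt⟩, rfl⟩
      refine ⟨t, ht, ?_⟩
      rw [khat_aux hc0 (hP0 _)]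
      have : 0 < F (x', t) - c' * P (x', t) := hlt
      linarith
  rw [e]
  have ho : IsOpen (Q ∩ (fun X => F X - c' * P X) ⁻¹' Ioi 0) :=
    (hF.sub (continuousOn_const.mul hP)).isOpen_inter_preimage hQ isOpen_Ioi
  exact (isOpenMap_fst _ ho).measurableSet

theorem khat_le {n : ℕ} {Q : Set (En n × ℝ)} (hQ : IsOpen Q) {F P : En n × ℝ → ℝ} (hF : ContinuousOn F Q)
    (hP : ContinuousOn P Q) (hP0 : ∀ X, 0 ≤ P X) {b : En n × ℝ → En n} (hb : ∀ X ∈ Q, F X ≤ ‖b X‖ * P X) (x : En n) :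
    khat Q F P x ≤ essSup (fun t => (‖b (x, t)‖₊ : ℝ≥0∞)) (volume.restrict {t | (x, t) ∈ Q}) := by
  refine iSup₂_le fun t ht => ?_
  by_contra hcon
  push Not at hcon
  set h := essSup (fun t => (‖b (x, t)‖₊ : ℝ≥0∞)) (volume.restrict {t | (x, t) ∈ Q}) with hh
  have hfin : h ≠ ⊤ := hcon.ne_top
  have he : h = ENNReal.ofReal h.toReal := (ENNReal.ofReal_toReal hfin).symm
  have hc0 : 0 ≤ h.toReal := ENNReal.toReal_nonneg
  rw [he, khat_aux hc0 (hP0 _)] at hcon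
  set c := h.toReal with hc
  have ho : IsOpen (Q ∩ (fun X => F X - c * P X) ⁻¹' Ioi 0) :=
    (hF.sub (continuousOn_const.mul hP)).isOpen_inter_preimage hQ isOpen_Ioi
  have ho2 : IsOpen {τ : ℝ | (x, τ) ∈ (Q ∩ (fun X => F X - c * P X) ⁻¹' Ioi 0)} :=
    ho.preimage (by fun_prop : Continuous fun τ : ℝ => (x, τ))
  have hpos := ho2.measure_pos volume ⟨t, ht, by show 0 < F (x, t) - c * P (x, t); linarith⟩
  have hoQ : IsOpen {τ : ℝ | (x, τ) ∈ Q} := hQ.preimage (by fun_prop : Continuous fun τ : ℝ => (x, τ))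
  have hae := ENNReal.ae_le_essSup (μ := volume.restrict {t | (x, t) ∈ Q}) (fun t => (‖b (x, t)‖₊ : ℝ≥0∞))
  rw [ae_restrict_iff' hoQ.measurableSet] at hae
  have hz : volume {τ : ℝ | (x, τ) ∈ (Q ∩ (fun X => F X - c * P X) ⁻¹' Ioi 0)} = 0 := by
    refine measure_mono_null ?_ hae
    intro τ hτ hcc
    have h1 := hcc hτ.1
    have h2 : 0 < F (x, τ) - c * P (x, τ) := hτ.2
    have h3 := hb (x, τ) hτ.1
    rw [← hh, he] at h1
    have h4 : ‖b (x, τ)‖ ≤ c := by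
      have h5 := ENNReal.toReal_mono ENNReal.ofReal_ne_top h1
      rw [ENNReal.toReal_ofReal hc0] at h5
      simpa using h5
    have h6 := mul_le_mul_of_nonneg_right h4 (hP0 (x, τ))
    linarith
  exact hpos.ne' hz

theorem sol_of {n : ℕ} (hn : 0 < n) {ν S T : ℝ} (hν : 1 ≤ ν) {Ω : Set (En n)} (hΩ : IsOpen Ω) {u : En n × ℝ → ℝ}
    {a : En n × ℝ → Matrix (Fin n) (Fin n) ℝ} {b : En n × ℝ → En n}
    (hu : IsC21 u (Ω ×ˢ Ioo (0 : ℝ) T)) (ha : UnifParabolic ν a (Ω ×ˢ Ioo (0 : ℝ) T))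
    (hb : LxnLtinfPow b (Ω ×ˢ Ioo (0 : ℝ) T) ≤ ENNReal.ofReal S)
    (h0 : ∀ X ∈ Ω ×ˢ Ioo (0 : ℝ) T, 0 ≤ u X)
    (heq : ∀ X ∈ Ω ×ˢ Ioo (0 : ℝ) T, -Dt u X + Lop a b u X = 0) :
    ∃ k, Sol ν S T Ω u (Dt u) (gradv u) (hessv u) k := by
  set Q : Set (En n × ℝ) := Ω ×ˢ Ioo (0 : ℝ) T with hQ
  have hQo : IsOpen Q := hΩ.prod isOpen_Ioo
  have hc := c21_of hQo hu
  set F := defect ν (Dt u) (hessv u) with hF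
  set P : En n × ℝ → ℝ := fun X => ‖gradv u X‖ with hP
  have hFc : ContinuousOn F Q := defect_cont hc.ct hc.cH
  have hPc : ContinuousOn P Q := hc.cp.norm
  have hP0 : ∀ X, 0 ≤ P X := fun X => norm_nonneg _
  have hFb : ∀ X ∈ Q, F X ≤ ‖b X‖ * P X := by
    intro X hX
    refine (defect_le (adm_of hν (ha X hX).1 (ha X hX).2)).trans ?_
    rw [trc_of]
    have h1 := heq X hX
    unfold Lop at h1
    have h2 : Dt u X - ∑ i, ∑ j, a X i j * Dxx u i j X = ⟪gradv u X, b X⟫ := by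
      rw [PiLp.inner_apply]
      simp only [gradv_apply, RCLike.inner_apply, conj_trivial]
      linarith
    rw [h2, mul_comm]
    exact abs_real_inner_le_norm _ _
  have hkm := khat_meas hQo hFc hPc hP0
  have hkle := khat_le hQo hFc hPc hP0 hFb
  have hkint : ∫⁻ x, khat Q F P x ^ n ≤ ENNReal.ofReal S :=
    (lintegral_mono fun x => pow_le_pow_left' (hkle x) n).trans hb
  have hfin : ∀ᵐ x, khat Q F P x ^ n < ⊤ :=
    MeasureTheory.ae_lt_top (hkm.pow_const n) (hkint.trans_lt ENNReal.ofReal_lt_top).ne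
  refine ⟨fun x => (khat Q F P x).toReal, hc, hΩ, h0, hkm.ennreal_toReal, fun x => ENNReal.toReal_nonneg, ?_, ?_⟩
  · unfold mass
    rw [Measure.restrict_univ]
    refine le_trans (lintegral_mono fun x => ?_) hkint
    rw [← ENNReal.toReal_pow]
    exact ENNReal.ofReal_toReal_le
  · filter_upwards [hfin] with x hx t ht
    have hx' : khat Q F P x ≠ ⊤ := fun h => by
      rw [h, ENNReal.top_pow hn.ne'] at hx
      exact lt_irrefl _ hx
    obtain ⟨A, hA, hAe⟩ := defect_attained (ν := ν) (θ := Dt u) (H := hessv u) (X := (x, t))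
      ⟨_, adm_of hν (ha _ ht).1 (ha _ ht).2⟩
    refine ⟨A, hA, ?_⟩
    rw [hAe]
    have h1 : ENNReal.ofReal (F (x, t)) / ENNReal.ofReal (P (x, t)) ≤ ENNReal.ofReal (khat Q F P x).toReal := by
      rw [ENNReal.ofReal_toReal hx']
      exact le_iSup₂_of_le t ht le_rfl
    have h2 := not_lt.2 h1
    rw [khat_aux ENNReal.toReal_nonneg (hP0 _)] at h2
    exact not_lt.1 h2

theorem final {n : ℕ} (hn : 0 < n) (ν S mΩ : ℝ) (hν : 1 ≤ ν) (hm : 0 ≤ mΩ) :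
    ∃ N : ℝ, 0 < N ∧
      ∀ (Ω : Set (En n)) (rΩ T s r : ℝ) (y : En n) (e : En n) (φ : En n → ℝ)
        (u : En n × ℝ → ℝ)
        (a : En n × ℝ → Matrix (Fin n) (Fin n) ℝ) (b : En n × ℝ → En n),
        IsOpen Ω → IsConnected Ω → Bornology.IsBounded Ω →
        IsLipschitzDomain Ω rΩ mΩ →
        0 < T → 0 < s → s < T →
        y ∈ frontier Ω →
        ‖e‖ = 1 → LipschitzWith (Real.toNNReal mΩ) φ → φ 0 = 0 →
        (∀ x, x ∈ Ω ∩ ball y rΩ ↔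
          dist x y < rΩ ∧ φ ((x - y) - ⟪x - y, e⟫ • e) < ⟪x - y, e⟫) →
        (∀ ρ : ℝ, 0 < ρ → ρ ≤ rΩ → y + ρ • e ∈ Ω) →
        0 < r → r < rΩ / 2 → r < Real.sqrt (T - s) / 2 → r < Real.sqrt s / 2 →
        IsC21 u (Ω ×ˢ Ioo (0 : ℝ) T) →
        UnifParabolic ν a (Ω ×ˢ Ioo (0 : ℝ) T) →
        LxnLtinfPow b (Ω ×ˢ Ioo (0 : ℝ) T) ≤ ENNReal.ofReal S →
        (∀ X ∈ Ω ×ˢ Ioo (0 : ℝ) T, 0 ≤ u X) →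
        (∀ X ∈ Ω ×ˢ Ioo (0 : ℝ) T, -Dt u X + Lop a b u X = 0) →
        ContinuousOn u ((Ω ×ˢ Ioo (0 : ℝ) T) ∪
          ((frontier Ω ×ˢ Ioo (0 : ℝ) T) ∩ pcyl (y, s) (2 * r))) →
        (∀ X ∈ (frontier Ω ×ˢ Ioo (0 : ℝ) T) ∩ pcyl (y, s) (2 * r), u X = 0) →
        ∀ X ∈ (Ω ×ˢ Ioo (0 : ℝ) T) ∩ pcyl (y, s) r,
          u X ≤ N * u (y + r • e, s + r ^ 2) := by
  obtain ⟨N, hN, h⟩ := blow hn hν (max S 0) (le_max_right _ _) mΩ hm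
  refine ⟨N, hN, ?_⟩
  intro Ω rΩ T s r y e φ u a b hΩ _ _ hLip _ _ _ _ he hφ hφ0 hiff _ hr hr1 hr2 hr3 hu ha hb h0 heq hcont hz
  have hb' : LxnLtinfPow b (Ω ×ˢ Ioo (0 : ℝ) T) ≤ ENNReal.ofReal (max S 0) :=
    hb.trans (ENNReal.ofReal_le_ofReal (le_max_left _ _))
  obtain ⟨k, hk⟩ := sol_of hn hν hΩ hu ha hb' h0 heq
  have hs1 : (2 * r) ^ 2 < T - s := (Real.lt_sqrt (by linarith)).1 (by linarith)
  have hs2 : (2 * r) ^ 2 < s := (Real.lt_sqrt (by linarith)).1 (by linarith)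
  refine h T Ω u _ _ _ k rΩ y e φ r s hk ?_ ⟨hm, he, hφ, hφ0, hiff⟩ hr (by linarith) (by linarith) (by linarith) hcont hz
  intro y' hy'
  obtain ⟨e', φ', a1, a2, a3, a4, -⟩ := hLip.2.2 y' hy'
  exact ⟨e', φ', hm, a1, a2, a3, a4⟩

/-- **Boundary Harnack (Carleson-type) inequality** (Theorem 8.2). -/
theorem boundary_harnack_inequality
    (n : ℕ) (hn : 0 < n) (ν S mΩ : ℝ) (hν : 1 ≤ ν) (hm : 0 ≤ mΩ) :
    ∃ N : ℝ, 0 < N ∧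
      ∀ (Ω : Set (En n)) (rΩ T s r : ℝ) (y : En n) (e : En n) (φ : En n → ℝ)
        (u : En n × ℝ → ℝ)
        (a : En n × ℝ → Matrix (Fin n) (Fin n) ℝ) (b : En n × ℝ → En n),
        IsOpen Ω → IsConnected Ω → Bornology.IsBounded Ω →
        IsLipschitzDomain Ω rΩ mΩ →
        0 < T → 0 < s → s < T →
        y ∈ frontier Ω →
        -- the Lipschitz coordinate frame of `Ω` at `y`, with vertical unit vector `e`
        ‖e‖ = 1 → LipschitzWith (Real.toNNReal mΩ) φ → φ 0 = 0 →
        (∀ x, x ∈ Ω ∩ ball y rΩ ↔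
          dist x y < rΩ ∧ φ ((x - y) - ⟪x - y, e⟫ • e) < ⟪x - y, e⟫) →
        (∀ ρ : ℝ, 0 < ρ → ρ ≤ rΩ → y + ρ • e ∈ Ω) →
        0 < r → r < rΩ / 2 → r < Real.sqrt (T - s) / 2 → r < Real.sqrt s / 2 →
        IsC21 u (Ω ×ˢ Ioo (0 : ℝ) T) →
        UnifParabolic ν a (Ω ×ˢ Ioo (0 : ℝ) T) →
        LxnLtinfPow b (Ω ×ˢ Ioo (0 : ℝ) T) ≤ ENNReal.ofReal S →
        (∀ X ∈ Ω ×ˢ Ioo (0 : ℝ) T, 0 ≤ u X) →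
        (∀ X ∈ Ω ×ˢ Ioo (0 : ℝ) T, -Dt u X + Lop a b u X = 0) →
        ContinuousOn u ((Ω ×ˢ Ioo (0 : ℝ) T) ∪
          ((frontier Ω ×ˢ Ioo (0 : ℝ) T) ∩ pcyl (y, s) (2 * r))) →
        (∀ X ∈ (frontier Ω ×ˢ Ioo (0 : ℝ) T) ∩ pcyl (y, s) (2 * r), u X = 0) →
        ∀ X ∈ (Ω ×ˢ Ioo (0 : ℝ) T) ∩ pcyl (y, s) r,
          u X ≤ N * u (y + r • e, s + r ^ 2) := by
  exact final hn ν S mΩ hν hm
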